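/- The class TRR∀ of finite rule sets Σ such that every restricted chase sequence of ⟨Σ, D⟩ is finite for every database D is Π¹₁-complete. -/

import Mathlib

/-!
Common formalization framework for "Restricted Chase Termination: You Want More than Fairness"
(Carral, Gerlach, Larroque, Thomazo).

Syntax is encoded over natural numbers so that all finite objects (rules, databases, knowledge
bases, Turing machines) live in `Primcodable` types, which allows us to speak about
many-one reductions and about the arithmetical/analytical hierarchy.
-/

namespace ChaseTermination

/-! ### Terms, atoms, facts, rules, knowledge bases -/

/-- Ground terms: `Sum.inl c` is the constant `c`, `Sum.inr n` is the null `n`. -/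
abbrev GroundTerm : Type := ℕ ⊕ ℕ

/-- Terms of rules: `Sum.inl v` is the variable `v`, `Sum.inr g` a ground term. -/
abbrev RTerm : Type := ℕ ⊕ GroundTerm

/-- A fact: a predicate (coded by a natural number) applied to ground terms. -/
abbrev Fact : Type := ℕ × List GroundTerm

/-- An atom: a predicate applied to terms. -/
abbrev Atom : Type := ℕ × List RTerm

/-- An existential rule, given by its body and its head (lists of atoms);
the universally quantified variables are those occurring in the body, the existentially
quantified ones are the head variables not occurring in the body. -/
abbrev Rule : Type := List Atom × List Atom

abbrev RuleSet : Type := List Rule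

abbrev Database : Type := List Fact

/-- A knowledge base: a (finite) rule set together with a database. -/
abbrev KB : Type := RuleSet × Database

def atomHasVar (a : Atom) (v : ℕ) : Prop := (Sum.inl v : RTerm) ∈ a.2

def atomNullFree (a : Atom) : Prop := ∀ t ∈ a.2, ∀ n : ℕ, t ≠ Sum.inr (Sum.inr n)

def factNullFree (f : Fact) : Prop := ∀ t ∈ f.2, ∀ n : ℕ, t ≠ Sum.inr n

/-- A database is a finite fact set without nulls. -/
def IsDatabase (D : Database) : Prop := ∀ f ∈ D, factNullFree f

/-- Well-formed rule: non-empty head, no nulls. -/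
def IsRule (r : Rule) : Prop := r.2 ≠ [] ∧ ∀ a ∈ r.1 ++ r.2, atomNullFree a

def IsRuleSet (S : RuleSet) : Prop := ∀ r ∈ S, IsRule r

def IsKB (kb : KB) : Prop := IsRuleSet kb.1 ∧ IsDatabase kb.2

/-- `v` occurs in the body of `r` (i.e. is universally quantified). -/
def bodyVar (r : Rule) (v : ℕ) : Prop := ∃ a ∈ r.1, atomHasVar a v

/-- `v` is an existential variable of `r`. -/
def existVar (r : Rule) (v : ℕ) : Prop := (∃ a ∈ r.2, atomHasVar a v) ∧ ¬ bodyVar r v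

def applyT (σ : ℕ → GroundTerm) : RTerm → GroundTerm
  | Sum.inl v => σ v
  | Sum.inr g => g

def applyA (σ : ℕ → GroundTerm) (a : Atom) : Fact := (a.1, a.2.map (applyT σ))

/-- A trigger: a rule together with a substitution for its (universal) variables. -/
abbrev Trigger : Type := Rule × (ℕ → GroundTerm)

/-- The support of a trigger: the instantiated body. -/
def support (t : Trigger) : Set Fact := {f | ∃ a ∈ t.1.1, f = applyA t.2 a}

/-- A trigger is loaded for `F` if `F` includes its support. -/
def loaded (t : Trigger) (F : Set Fact) : Prop := ∀ a ∈ t.1.1, applyA t.2 a ∈ F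

/-- `σ'` agrees with the substitution of `t` on all universally quantified (body) variables. -/
def agreesOnBody (t : Trigger) (σ' : ℕ → GroundTerm) : Prop :=
  ∀ v, bodyVar t.1 v → σ' v = t.2 v

/-- A trigger is obsolete for `F` if some extension of its substitution to the existential
variables sends the head into `F`. -/
def obsolete (t : Trigger) (F : Set Fact) : Prop :=
  ∃ σ' : ℕ → GroundTerm, agreesOnBody t σ' ∧ ∀ a ∈ t.1.2, applyA σ' a ∈ F

/-- The (ground) terms occurring in a fact set. -/
def termsOf (F : Set Fact) : Set GroundTerm := {g | ∃ f ∈ F, g ∈ f.2}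

/-- `σ'` is a proper output extension of the trigger `t` w.r.t. `F`: it agrees with the trigger
substitution on body variables and maps existential variables to pairwise distinct fresh nulls. -/
def properExt (t : Trigger) (F : Set Fact) (σ' : ℕ → GroundTerm) : Prop :=
  agreesOnBody t σ' ∧
  (∀ v, existVar t.1 v → ∃ n : ℕ, σ' v = Sum.inr n ∧ (Sum.inr n : GroundTerm) ∉ termsOf F) ∧
  (∀ v w, existVar t.1 v → existVar t.1 w → σ' v = σ' w → v = w)

/-- The output of a trigger under an extended substitution. -/
def outputOf (t : Trigger) (σ' : ℕ → GroundTerm) : Set Fact := {f | ∃ a ∈ t.1.2, f = applyA σ' a}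

/-- An active trigger of `S` for `F`: loaded and not obsolete. -/
def Active (S : RuleSet) (F : Set Fact) (t : Trigger) : Prop :=
  t.1 ∈ S ∧ loaded t F ∧ ¬ obsolete t F

/-- One restricted chase step. -/
def ChaseStep (S : RuleSet) (F F' : Set Fact) : Prop :=
  ∃ t : Trigger, Active S F t ∧ ∃ σ', properExt t F σ' ∧ F' = F ∪ outputOf t σ'

def dbSet (D : Database) : Set Fact := {f | f ∈ D}

/-- A (possibly infinite) restricted chase derivation for `⟨S, D⟩`, of length `len ∈ ℕ∞`.
Beyond the length the fact sets stall, so that the result is always `⋃ i, fact i`. -/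
structure Chase (S : RuleSet) (D : Set Fact) where
  len : ℕ∞
  fact : ℕ → Set Fact
  trig : ℕ → Trigger
  ext : ℕ → ℕ → GroundTerm
  init : fact 0 = D
  activeAt : ∀ i : ℕ, (i : ℕ∞) < len → Active S (fact i) (trig i)
  extOk : ∀ i : ℕ, (i : ℕ∞) < len → properExt (trig i) (fact i) (ext i)
  succ : ∀ i : ℕ, (i : ℕ∞) < len → fact (i + 1) = fact i ∪ outputOf (trig i) (ext i)
  stall : ∀ i : ℕ, ¬ ((i : ℕ∞) < len) → fact (i + 1) = fact i

/-- Fairness: every trigger that becomes loaded is eventually obsolete.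
A fair chase derivation is a *restricted chase sequence*; note that for a finite derivation
fairness forces maximality (no active trigger remains at the end). -/
def Fair {S : RuleSet} {D : Set Fact} (c : Chase S D) : Prop :=
  ∀ t : Trigger, t.1 ∈ S → ∀ i : ℕ, loaded t (c.fact i) → ∃ j : ℕ, i ≤ j ∧ obsolete t (c.fact j)

/-- The result of a chase derivation. -/
def chaseResult {S : RuleSet} {D : Set Fact} (c : Chase S D) : Set Fact := ⋃ i, c.fact i

/-- The derivation is infinite (non-terminating). -/
def IsInfinite {S : RuleSet} {D : Set Fact} (c : Chase S D) : Prop := c.len = ⊤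

/-- `TKR∀`: knowledge bases all of whose restricted chase sequences are finite. -/
def TKRall (kb : KB) : Prop :=
  IsKB kb ∧ ¬ ∃ c : Chase kb.1 (dbSet kb.2), IsInfinite c ∧ Fair c

/-- `TRR∀`: rule sets universally terminating for the restricted chase on every database. -/
def TRRall (S : RuleSet) : Prop :=
  IsRuleSet S ∧ ∀ D : Database, IsDatabase D → ¬ ∃ c : Chase S (dbSet D), IsInfinite c ∧ Fair c

/-! ### Breadth-first chase -/

/-- The instance of a trigger: its rule together with its instantiated body (this determines the
substitution on all body variables). -/
def instOf (t : Trigger) : Rule × List Fact := (t.1, t.1.1.map (applyA t.2))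

/-- The set of instances of active triggers (this is what "the number of triggers that are loaded
and not obsolete" counts). -/
def activeInsts (S : RuleSet) (F : Set Fact) : Set (Rule × List Fact) :=
  {p | ∃ t : Trigger, Active S F t ∧ p = instOf t}

/-- The breadth-first condition (†): a trigger loaded at step `i` becomes obsolete within the
next `n` steps, where `n` is the number of active triggers at step `i`. -/
def BreadthFirst {S : RuleSet} {D : Set Fact} (c : Chase S D) : Prop :=
  ∀ i : ℕ, ∀ t : Trigger, t.1 ∈ S → loaded t (c.fact i) →
    ∃ j : ℕ, i ≤ j ∧ j ≤ i + (activeInsts S (c.fact i)).ncard ∧ obsolete t (c.fact j)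

/-- `TKRBF∀`: knowledge bases all of whose breadth-first chase sequences are finite. -/
def TKRBFall (kb : KB) : Prop :=
  IsKB kb ∧ ¬ ∃ c : Chase kb.1 (dbSet kb.2), IsInfinite c ∧ BreadthFirst c

/-- `TRRBF∀`: rule sets whose breadth-first chase terminates on every database. -/
def TRRBFall (S : RuleSet) : Prop :=
  IsRuleSet S ∧ ∀ D : Database, IsDatabase D →
    ¬ ∃ c : Chase S (dbSet D), IsInfinite c ∧ BreadthFirst c

/-! ### Classes of the arithmetical and analytical hierarchies -/

/-- `Π⁰₂` predicates, via the Kleene normal form `∀ m ∃ k. R`. -/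
def Pi02 {α : Type} [Primcodable α] (p : α → Prop) : Prop :=
  ∃ R : α × ℕ → ℕ → Bool, Computable₂ R ∧ ∀ a, p a ↔ ∀ m : ℕ, ∃ k : ℕ, R (a, m) k = true

/-- `Π¹₁` predicates, via the Kleene normal form: `p a` iff for every function `f : ℕ → ℕ` some
finite initial segment of `f` witnesses a computable predicate. -/
def Pi11 {α : Type} [Primcodable α] (p : α → Prop) : Prop :=
  ∃ R : α → List ℕ → Bool, Computable₂ R ∧
    ∀ a, p a ↔ ∀ f : ℕ → ℕ, ∃ k : ℕ, R a ((List.range k).map f) = true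

/-- `Π¹₁`-hardness: every `Π¹₁` problem many-one reduces to `p`. -/
def Pi11Hard {α : Type} [Primcodable α] (p : α → Prop) : Prop :=
  ∀ q : ℕ → Prop, Pi11 q → q ≤₀ p

def Pi11Complete {α : Type} [Primcodable α] (p : α → Prop) : Prop := Pi11 p ∧ Pi11Hard p

/-! ### Non-deterministic Turing machines -/

/-- A non-deterministic Turing machine `(numStates, alphaSize, table)`.
States are `0, …, numStates - 1` with initial state `0`; tape symbols `0, …, alphaSize - 1`
form `Γ` (so `{0,1} ⊆ Γ` iff `2 ≤ alphaSize`), and the blank `B` is coded by `alphaSize`.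
An entry `((q, a), (q', b, d))` means `(q', b, d) ∈ δ(q, a)`, with `d = true` for a right move
and `d = false` for a left move. -/
abbrev NTM : Type := ℕ × ℕ × List ((ℕ × ℕ) × (ℕ × ℕ × Bool))

def NTM.numStates (M : NTM) : ℕ := M.1
def NTM.blank (M : NTM) : ℕ := M.2.1
def NTM.table (M : NTM) : List ((ℕ × ℕ) × (ℕ × ℕ × Bool)) := M.2.2

/-- Well-formedness: `Γ ⊇ {0,1}`, transitions use valid states and symbols, and the machine
never writes the blank. -/
def NTM.WF (M : NTM) : Prop :=
  1 ≤ NTM.numStates M ∧ 2 ≤ NTM.blank M ∧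
    ∀ e ∈ NTM.table M, e.1.1 < NTM.numStates M ∧ e.1.2 ≤ NTM.blank M ∧
      e.2.1 < NTM.numStates M ∧ e.2.2.1 < NTM.blank M

/-- A configuration `(tape, p, q)`: tape contents (a list of symbol codes whose last cell is
blank and in which no proper symbol occurs after a blank), 0-based head position `p`,
and current state `q`. -/
abbrev Config : Type := List ℕ × ℕ × ℕ

def WFConfig (M : NTM) (ρ : Config) : Prop :=
  ρ.2.1 < ρ.1.length ∧ ρ.1.getLast? = some (NTM.blank M) ∧
    (∀ i j : ℕ, i ≤ j → j < ρ.1.length → ρ.1.getD i 0 = NTM.blank M →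
      ρ.1.getD j 0 = NTM.blank M) ∧
    (∀ a ∈ ρ.1, a ≤ NTM.blank M) ∧ ρ.2.2 < NTM.numStates M

/-- The one-step relation `Next_M` between configurations; each step extends the represented
part of the tape by one blank cell. -/
def NTM.Next (M : NTM) (ρ ρ' : Config) : Prop :=
  ∃ q' b : ℕ, ∃ d : Bool,
    ((ρ.2.2, ρ.1.getD ρ.2.1 0), (q', b, d)) ∈ NTM.table M ∧
    (d = true ∨ 1 ≤ ρ.2.1) ∧
    ρ' = (ρ.1.set ρ.2.1 b ++ [NTM.blank M], if d then ρ.2.1 + 1 else ρ.2.1 - 1, q')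

/-- The starting configuration of `M` on a word. -/
def startConfig (M : NTM) (w : List ℕ) : Config := (w ++ [NTM.blank M], 0, 0)

/-- Words are over the input alphabet `{0, 1}`. -/
def IsWord (w : List ℕ) : Prop := ∀ a ∈ w, a < 2

/-- There is a run of `M` starting in `ρ` that visits the state `qr` infinitely often.
(Such a run is necessarily infinite, and every infinite sequence of `Next_M`-successive
configurations is a run; finite runs trivially feature `qr` only finitely many times.) -/
def RecurringFrom (M : NTM) (qr : ℕ) (ρ : Config) : Prop :=
  ∃ c : ℕ → Config, c 0 = ρ ∧ (∀ i, NTM.Next M (c i) (c (i + 1))) ∧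
    ∀ N : ℕ, ∃ i : ℕ, N ≤ i ∧ (c i).2.2 = qr

/-- `M` is non-recurring through `qr` on the configuration `ρ`: every run of `M` on `ρ`
features `qr` only finitely many times. -/
def NonRecurringFrom (M : NTM) (qr : ℕ) (ρ : Config) : Prop := ¬ RecurringFrom M qr ρ

end ChaseTermination
namespace ChaseTermination

/-! ### The rule set `Σ_M` of Section 4 and the databases `D_ρ` -/

/-- Predicate codes. `pF`, `pR` are the ternary time/tape successor predicates. -/
def pF : ℕ := 0
def pR : ℕ := 1
def pCL : ℕ := 2
def pCR : ℕ := 3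
def pReal : ℕ := 4
def pBrake : ℕ := 5
def pNextBr : ℕ := 6
def pEnd : ℕ := 7
/-- The binary letter predicate for the tape symbol `a`. -/
def pLetter (a : ℕ) : ℕ := 8 + 2 * a
/-- The binary state predicate for the state `q`. -/
def pState (q : ℕ) : ℕ := 9 + 2 * q

/-- Variable codes used in the rules: `x, y, x', y', w, w'` are `0, …, 5`. -/
def tv (v : ℕ) : RTerm := Sum.inl v

def A1 (p : ℕ) (s : RTerm) : Atom := (p, [s])
def A2 (p : ℕ) (s t : RTerm) : Atom := (p, [s, t])
def A3 (p : ℕ) (s t u : RTerm) : Atom := (p, [s, t, u])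

/-- `brSet(x, w)` as atoms: `{F(x,w,w), R(x,w,w), Real(x), Brake(w)}`. -/
def brSetA (x w : RTerm) : List Atom := [A3 pF x w w, A3 pR x w w, A1 pReal x, A1 pBrake w]

/-- Tape alphabet including the blank: `Γ ∪ {B}`. -/
def letters (M : NTM) : List ℕ := List.range (NTM.blank M + 1)
def states (M : NTM) : List ℕ := List.range (NTM.numStates M)

/-- The rule `R_Brake`. -/
def ruleBrake (M : NTM) : Rule :=
  ([A1 pBrake (tv 4)],
    ((letters M).map fun a => A2 (pLetter a) (tv 4) (tv 4)) ++
    ((states M).map fun q => A2 (pState q) (tv 4) (tv 4)) ++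
    [A3 pF (tv 4) (tv 4) (tv 4), A3 pR (tv 4) (tv 4) (tv 4),
     A2 pCL (tv 4) (tv 4), A2 pCR (tv 4) (tv 4), A1 pReal (tv 4), A2 pNextBr (tv 4) (tv 4)])

/-- The rule `R_nextBr`. -/
def ruleNextBr : Rule :=
  (brSetA (tv 0) (tv 4) ++ [A2 pNextBr (tv 4) (tv 5)], brSetA (tv 0) (tv 5))

/-- Transition rule for `(q', b, →) ∈ δ(q, a)` and the letter `c`; if `q = qr` a fresh
brake `w'` is created together with a `nextBr`-atom, otherwise the brake `w` is reused. -/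
def mkTransRight (qr q a q' b c : ℕ) : Rule :=
  ([A2 (pState q) (tv 0) (tv 4), A2 (pLetter a) (tv 0) (tv 4), A3 pR (tv 0) (tv 1) (tv 4),
    A2 (pLetter c) (tv 1) (tv 4)] ++ brSetA (tv 0) (tv 4) ++ brSetA (tv 1) (tv 4),
   if q = qr then
     [A2 (pState q') (tv 3) (tv 5), A2 (pLetter c) (tv 3) (tv 5), A2 (pLetter b) (tv 2) (tv 5),
      A3 pR (tv 2) (tv 3) (tv 5), A3 pF (tv 0) (tv 2) (tv 5), A3 pF (tv 1) (tv 3) (tv 5),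
      A2 pCL (tv 2) (tv 5), A2 pCR (tv 3) (tv 5)] ++
      brSetA (tv 2) (tv 5) ++ brSetA (tv 3) (tv 5) ++ [A2 pNextBr (tv 4) (tv 5)]
   else
     [A2 (pState q') (tv 3) (tv 4), A2 (pLetter c) (tv 3) (tv 4), A2 (pLetter b) (tv 2) (tv 4),
      A3 pR (tv 2) (tv 3) (tv 4), A3 pF (tv 0) (tv 2) (tv 4), A3 pF (tv 1) (tv 3) (tv 4),
      A2 pCL (tv 2) (tv 4), A2 pCR (tv 3) (tv 4)] ++ brSetA (tv 2) (tv 4) ++ brSetA (tv 3) (tv 4))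

/-- Transition rule for `(q', b, ←) ∈ δ(q, a)` and the letter `c`. -/
def mkTransLeft (qr q a q' b c : ℕ) : Rule :=
  ([A2 (pState q) (tv 0) (tv 4), A2 (pLetter a) (tv 0) (tv 4), A3 pR (tv 1) (tv 0) (tv 4),
    A2 (pLetter c) (tv 1) (tv 4)] ++ brSetA (tv 0) (tv 4) ++ brSetA (tv 1) (tv 4),
   if q = qr then
     [A2 (pState q') (tv 3) (tv 5), A2 (pLetter c) (tv 3) (tv 5), A2 (pLetter b) (tv 2) (tv 5),
      A3 pR (tv 3) (tv 2) (tv 5), A3 pF (tv 0) (tv 2) (tv 5), A3 pF (tv 1) (tv 3) (tv 5),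
      A2 pCL (tv 3) (tv 5), A2 pCR (tv 2) (tv 5)] ++
      brSetA (tv 2) (tv 5) ++ brSetA (tv 3) (tv 5) ++ [A2 pNextBr (tv 4) (tv 5)]
   else
     [A2 (pState q') (tv 3) (tv 4), A2 (pLetter c) (tv 3) (tv 4), A2 (pLetter b) (tv 2) (tv 4),
      A3 pR (tv 3) (tv 2) (tv 4), A3 pF (tv 0) (tv 2) (tv 4), A3 pF (tv 1) (tv 3) (tv 4),
      A2 pCL (tv 3) (tv 4), A2 pCR (tv 2) (tv 4)] ++ brSetA (tv 2) (tv 4) ++ brSetA (tv 3) (tv 4))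

/-- All transition rules of `Σ_M` (one per table entry and letter `c`). -/
def transRules (M : NTM) (qr : ℕ) : List Rule :=
  (NTM.table M).foldr (fun e acc =>
    ((letters M).map fun cc =>
      if e.2.2.2 = true then mkTransRight qr e.1.1 e.1.2 e.2.1 e.2.2.1 cc
      else mkTransLeft qr e.1.1 e.1.2 e.2.1 e.2.2.1 cc) ++ acc) []

/-- The rule `R_{C_R}` for the letter `a`. -/
def mkCopyRight (a : ℕ) : Rule :=
  ([A2 pCR (tv 2) (tv 5), A3 pF (tv 0) (tv 2) (tv 5), A3 pR (tv 0) (tv 1) (tv 4),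
    A2 (pLetter a) (tv 1) (tv 4)] ++
    brSetA (tv 0) (tv 4) ++ brSetA (tv 2) (tv 5) ++ brSetA (tv 1) (tv 4),
   [A3 pF (tv 1) (tv 3) (tv 5), A3 pR (tv 2) (tv 3) (tv 5), A2 (pLetter a) (tv 3) (tv 5),
    A2 pCR (tv 3) (tv 5)] ++ brSetA (tv 3) (tv 5))

/-- The rule `R_{C_L}` for the letter `a`. -/
def mkCopyLeft (a : ℕ) : Rule :=
  ([A2 pCL (tv 2) (tv 5), A3 pF (tv 0) (tv 2) (tv 5), A3 pR (tv 1) (tv 0) (tv 4),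
    A2 (pLetter a) (tv 1) (tv 4)] ++
    brSetA (tv 0) (tv 4) ++ brSetA (tv 2) (tv 5) ++ brSetA (tv 1) (tv 4),
   [A3 pF (tv 1) (tv 3) (tv 5), A3 pR (tv 3) (tv 2) (tv 5), A2 (pLetter a) (tv 3) (tv 5),
    A2 pCL (tv 3) (tv 5)] ++ brSetA (tv 3) (tv 5))

def copyRightRules (M : NTM) : List Rule := (letters M).map mkCopyRight
def copyLeftRules (M : NTM) : List Rule := (letters M).map mkCopyLeft

/-- The tape-extension rule `R_End`. -/
def ruleEnd (M : NTM) : Rule :=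
  ([A2 pCR (tv 2) (tv 5), A3 pF (tv 0) (tv 2) (tv 5), A2 pEnd (tv 0) (tv 4)] ++
    brSetA (tv 0) (tv 4) ++ brSetA (tv 2) (tv 5),
   [A3 pR (tv 2) (tv 3) (tv 5), A2 (pLetter (NTM.blank M)) (tv 3) (tv 5),
    A2 pEnd (tv 3) (tv 5)] ++ brSetA (tv 3) (tv 5))

/-- The rule set `Σ_M` of Section 4 (simulating `M`, with the designated state `qr`). -/
def SigmaM (M : NTM) (qr : ℕ) : RuleSet :=
  [ruleBrake M, ruleNextBr] ++ transRules M qr ++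
    copyLeftRules M ++ copyRightRules M ++ [ruleEnd M]

/-- The constant `c_i` (0-based). -/
def cst (i : ℕ) : GroundTerm := Sum.inl (i + 1)
/-- The brake constant `w₁` of the database. -/
def w1 : GroundTerm := Sum.inl 0

/-- `brSet(x, w)` as facts. -/
def brSetF (x w : GroundTerm) : List Fact :=
  [(pF, [x, w, w]), (pR, [x, w, w]), (pReal, [x]), (pBrake, [w])]

/-- The database `D_ρ` encoding a configuration `ρ`. -/
def Drho (M : NTM) (ρ : Config) : Database :=
  ((List.range ρ.1.length).map fun i => ((pR, [cst i, cst (i + 1), w1]) : Fact)) ++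
  ((List.range ρ.1.length).map fun i => ((pLetter (ρ.1.getD i 0), [cst i, w1]) : Fact)) ++
  [((pState ρ.2.2, [cst ρ.2.1, w1]) : Fact),
   ((pLetter (NTM.blank M), [cst ρ.1.length, w1]) : Fact),
   ((pEnd, [cst ρ.1.length, w1]) : Fact)] ++
  (List.range (ρ.1.length + 1)).foldr (fun i acc => brSetF (cst i) w1 ++ acc) []

/-! ### Wild frontiers -/

/-- The atoms explicitly required by the wild-frontier condition ("other" atoms are those
not in this set). -/
def wfListed (M : NTM) (ρ : Config) (w : GroundTerm) (x : ℕ → GroundTerm) : Set Fact :=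
  {f | (∃ i < ρ.1.length,
          f = ((pR, [x i, x (i + 1), w]) : Fact) ∨
          f = ((pLetter (ρ.1.getD i 0), [x i, w]) : Fact)) ∨
    f = ((pState ρ.2.2, [x ρ.2.1, w]) : Fact) ∨
    f = ((pEnd, [x ρ.1.length, w]) : Fact) ∨
    f = ((pLetter (NTM.blank M), [x ρ.1.length, w]) : Fact) ∨
    (∃ i ≤ ρ.1.length, f ∈ brSetF (x i) w)}

/-- `F` has a wild frontier of the configuration `ρ` overseen by `w` (Definition 4.4). -/
def WildFrontier (M : NTM) (F : Set Fact) (ρ : Config) (w : GroundTerm) : Prop :=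
  ∃ x : ℕ → GroundTerm,
    ((pReal, [w]) : Fact) ∉ F ∧
    (∀ i < ρ.1.length, ((pR, [x i, x (i + 1), w]) : Fact) ∈ F ∧
      ((pLetter (ρ.1.getD i 0), [x i, w]) : Fact) ∈ F) ∧
    ((pState ρ.2.2, [x ρ.2.1, w]) : Fact) ∈ F ∧
    ((pEnd, [x ρ.1.length, w]) : Fact) ∈ F ∧
    ((pLetter (NTM.blank M), [x ρ.1.length, w]) : Fact) ∈ F ∧
    (∀ i ≤ ρ.1.length, ∀ f ∈ brSetF (x i) w, f ∈ F) ∧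
    (∀ f ∈ F, f ∉ wfListed M ρ w x →
      ∀ i ≤ ρ.1.length, f.2.head? = some (x i) → f.2[1]? = some w)

/-! ### State atoms, generation, bow ties -/

/-- `g` is a brake of `F`. -/
def isBrake (F : Set Fact) (g : GroundTerm) : Prop := ((pBrake, [g]) : Fact) ∈ F

/-- A state atom of `F`: an atom `q(x, w)` with `q` a state of `M` and `x` not a brake. -/
def StateAtom (M : NTM) (F : Set Fact) (f : Fact) : Prop :=
  ∃ q : ℕ, q < NTM.numStates M ∧ ∃ x wb : GroundTerm,
    f = ((pState q, [x, wb]) : Fact) ∧ f ∈ F ∧ ¬ isBrake F x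

/-- `A` precedes `A'` in the derivation `c`: some applied trigger has `A` in its support
and `A'` in its output. -/
def precedes {S : RuleSet} {D : Set Fact} (c : Chase S D) (A A' : Fact) : Prop :=
  ∃ i : ℕ, (i : ℕ∞) < c.len ∧ A ∈ support (c.trig i) ∧ A' ∈ outputOf (c.trig i) (c.ext i)

/-- The fact `f` is generated (newly produced) at step `i` of the derivation `c`. -/
def generatedAt {S : RuleSet} {D : Set Fact} (c : Chase S D) (i : ℕ) (f : Fact) : Prop :=
  (i : ℕ∞) < c.len ∧ f ∈ outputOf (c.trig i) (c.ext i) ∧ f ∉ c.fact i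

/-- The fact `f` is generated by (an application of) one of the rules in `Rs`. -/
def generatedBy {S : RuleSet} {D : Set Fact} (c : Chase S D) (Rs : List Rule) (f : Fact) : Prop :=
  ∃ i : ℕ, generatedAt c i f ∧ (c.trig i).1 ∈ Rs

/-- Semantically meaningful terms: all terms of `F` except the brakes. -/
def semterms (F : Set Fact) : Set GroundTerm := {g | g ∈ termsOf F ∧ ¬ isBrake F g}

/-- The edge relation `E_R`: `(x, y) ∈ E_R` iff `R(x, y, w) ∈ F` for some `w`. -/
def ER (F : Set Fact) (u v : GroundTerm) : Prop := ∃ w, ((pR, [u, v, w]) : Fact) ∈ F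

/-- The weakly connected component of `x` in the graph induced by `E` on the vertex set `V`. -/
def wcc {α : Type} (V : Set α) (E : α → α → Prop) (x : α) : Set α :=
  {z | z ∈ V ∧ Relation.ReflTransGen (fun u v => u ∈ V ∧ v ∈ V ∧ (E u v ∨ E v u)) x z}

/-- Directed tree rooted in `r` on the vertex set `V` with edge relation `E`. -/
def IsDirTree {α : Type} (V : Set α) (E : α → α → Prop) (r : α) : Prop :=
  r ∈ V ∧
  (∀ v ∈ V, Relation.ReflTransGen (fun u v' => u ∈ V ∧ v' ∈ V ∧ E u v') r v) ∧
  (∀ v ∈ V, v ≠ r → ∃! u, u ∈ V ∧ E u v) ∧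
  (∀ u ∈ V, ¬ E u r)

/-- A bow tie with center `(x, y)` (Definition 6.2): `V_x^{-y}` induces a directed tree on the
inverse edges rooted in `x`, `V_y^{-x}` induces a directed tree rooted in `y`, and the two
components partition `V`. -/
def IsBowTie {α : Type} (V : Set α) (E : α → α → Prop) (x y : α) : Prop :=
  x ∈ V ∧ y ∈ V ∧ E x y ∧
  IsDirTree (wcc (V \ {y}) E x) (fun u v => E v u) x ∧
  IsDirTree (wcc (V \ {x}) E y) E y ∧
  wcc (V \ {y}) E x ∩ wcc (V \ {x}) E y = ∅ ∧
  wcc (V \ {y}) E x ∪ wcc (V \ {x}) E y = V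

/-- `bowtie(A)` for a state atom `q(x, w)`: the weakly connected component of `x` in
`(semterms F, E_R)`. -/
def bowtieOf (F : Set Fact) (x : GroundTerm) : Set GroundTerm := wcc (semterms F) (ER F) x

/-- A maximal `E`-path in the vertex set `V`. -/
def IsMaxPath {α : Type} (V : Set α) (E : α → α → Prop) (l : List α) : Prop :=
  l ≠ [] ∧ (∀ z ∈ l, z ∈ V) ∧ List.Chain' E l ∧
  (∀ z ∈ V, ∀ a, l.head? = some a → ¬ E z a) ∧
  (∀ z ∈ V, ∀ a, l.getLast? = some a → ¬ E a z)

/-- `configs(A)` (Definition 6.4): one candidate configuration per maximal path of `bowtie(A)`. -/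
def configsOf (M : NTM) (F : Set Fact) (A : Fact) : Set (Set Fact) :=
  {S | ∃ q : ℕ, ∃ x w : GroundTerm, A = ((pState q, [x, w]) : Fact) ∧
    ∃ l : List GroundTerm, IsMaxPath (bowtieOf F x) (ER F) l ∧
      S = insert A
        ({f | ∃ z ∈ l, f ∈ brSetF z w} ∪
         {f | f ∈ F ∧ (f.1 = pR ∨ f.1 = pEnd ∨ ∃ a ∈ letters M, f.1 = pLetter a) ∧
           f.2 ≠ [] ∧ f.2.getLast? = some w ∧ ∀ z ∈ f.2.dropLast, z ∈ l})}

/-- Homomorphic embedding of fact sets: a map on nulls (fixing all constants) sending `S`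
into `T`. -/
def mapG (h : ℕ → GroundTerm) : GroundTerm → GroundTerm
  | Sum.inl cc => Sum.inl cc
  | Sum.inr n => h n

def mapFact (h : ℕ → GroundTerm) (f : Fact) : Fact := (f.1, f.2.map (mapG h))

def HomEmbeds (S T : Set Fact) : Prop := ∃ h : ℕ → GroundTerm, ∀ f ∈ S, mapFact h f ∈ T

end ChaseTermination
namespace ChaseTermination

/-! ### The machine `M_Σ` (Definition 4.1), modelled by its canonical runs

A run of `M_Σ` on the encoding of a database corresponds exactly to a restricted chase
derivation of `⟨Σ, D⟩` (step 4 of the procedure) together with the counter `j`; the machine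
visits its designated state `q_r` once each time `j` is incremented (step 5), so a run visits
`q_r` infinitely often iff the derivation is infinite and `jseq` is unbounded. -/

open scoped Classical in
/-- The value of the counter `j` of `M_Σ` after `i` iterations of its main loop, when its
non-deterministic choices build the chase derivation `c`. -/
noncomputable def jseq {S : RuleSet} {D : Set Fact} (c : Chase S D) : ℕ → ℕ
  | 0 => 0
  | i + 1 =>
      if ∀ t : Trigger, Active S (c.fact (jseq c i)) t → obsolete t (c.fact i) then
        jseq c i + 1
      else jseq c i

/-! ### Oblivious and core chase variants -/

/-- A (possibly infinite) oblivious chase derivation: triggers need only be loaded, but no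
trigger (instance) is ever applied twice. -/
structure OblChase (S : RuleSet) (D : Set Fact) where
  len : ℕ∞
  fact : ℕ → Set Fact
  trig : ℕ → Trigger
  ext : ℕ → ℕ → GroundTerm
  init : fact 0 = D
  memAt : ∀ i : ℕ, (i : ℕ∞) < len → (trig i).1 ∈ S
  loadAt : ∀ i : ℕ, (i : ℕ∞) < len → loaded (trig i) (fact i)
  noRepeat : ∀ i j : ℕ, (i : ℕ∞) < len → (j : ℕ∞) < len →
    instOf (trig i) = instOf (trig j) → i = j
  extOk : ∀ i : ℕ, (i : ℕ∞) < len → properExt (trig i) (fact i) (ext i)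
  succ : ∀ i : ℕ, (i : ℕ∞) < len → fact (i + 1) = fact i ∪ outputOf (trig i) (ext i)
  stall : ∀ i : ℕ, ¬ ((i : ℕ∞) < len) → fact (i + 1) = fact i

/-- Fairness for the oblivious chase: every trigger that becomes loaded is eventually applied. -/
def OblFair {S : RuleSet} {D : Set Fact} (c : OblChase S D) : Prop :=
  ∀ t : Trigger, t.1 ∈ S → ∀ i : ℕ, loaded t (c.fact i) →
    ∃ j : ℕ, (j : ℕ∞) < c.len ∧ instOf (c.trig j) = instOf t

/-- `H` is a retract of `G`: `H ⊆ G` and some homomorphism (fixing constants) maps `G` into `H`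
leaving `H` pointwise fixed. -/
def RetractOf (G H : Set Fact) : Prop :=
  H ⊆ G ∧ ∃ h : ℕ → GroundTerm, (∀ f ∈ G, mapFact h f ∈ H) ∧ ∀ f ∈ H, mapFact h f = f

/-- `H` is a core of `G`: a retract of `G` without proper retracts. -/
def IsCoreOf (H G : Set Fact) : Prop := RetractOf G H ∧ ∀ H', RetractOf H H' → H' = H

/-- `G` is obtained from `F` by applying all active triggers in parallel, each with fresh
pairwise distinct nulls (distinct trigger instances use disjoint fresh nulls). -/
def IsParallelStep (S : RuleSet) (F G : Set Fact) : Prop :=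
  ∃ pe : Trigger → (ℕ → GroundTerm),
    (∀ t : Trigger, Active S F t → properExt t F (pe t)) ∧
    (∀ t t' : Trigger, Active S F t → Active S F t' → instOf t = instOf t' →
      outputOf t (pe t) = outputOf t' (pe t')) ∧
    (∀ t t' : Trigger, Active S F t → Active S F t' → instOf t ≠ instOf t' →
      ∀ n : ℕ, (Sum.inr n : GroundTerm) ∉ termsOf F →
        (Sum.inr n : GroundTerm) ∈ termsOf (outputOf t (pe t)) →
        (Sum.inr n : GroundTerm) ∉ termsOf (outputOf t' (pe t'))) ∧
    G = F ∪ ⋃ t ∈ {t : Trigger | Active S F t}, outputOf t (pe t)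

/-- A (possibly infinite) core chase sequence: `F_{i+1}` is a core of the parallel application
of all active triggers to `F_i`, and the sequence stops exactly when this is a fixpoint. -/
structure CoreChase (S : RuleSet) (D : Set Fact) where
  len : ℕ∞
  fact : ℕ → Set Fact
  init : fact 0 = D
  step : ∀ i : ℕ, (i : ℕ∞) < len →
    ∃ G, IsParallelStep S (fact i) G ∧ IsCoreOf (fact (i + 1)) G ∧ fact (i + 1) ≠ fact i
  halt : ∀ i : ℕ, ¬ ((i : ℕ∞) < len) → ∃ G, IsParallelStep S (fact i) G ∧ IsCoreOf (fact i) G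
  stall : ∀ i : ℕ, ¬ ((i : ℕ∞) < len) → fact (i + 1) = fact i

/-- The three chase variants. -/
inductive Variant : Type | obl | rest | core

/-- `qExists` ("sometimes") and `qForall` ("always") termination. -/
inductive Quant : Type | qExists | qForall

/-- `Terminates v q S D`: the knowledge base `⟨S, D⟩` `q`-terminates for the chase variant `v`
(`qExists`: some chase sequence is finite; `qForall`: all chase sequences are finite). -/
def Terminates (v : Variant) (q : Quant) (S : RuleSet) (D : Set Fact) : Prop :=
  match v, q with
  | .rest, .qExists => ∃ c : Chase S D, Fair c ∧ c.len ≠ ⊤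
  | .rest, .qForall => ∀ c : Chase S D, Fair c → c.len ≠ ⊤
  | .obl, .qExists => ∃ c : OblChase S D, OblFair c ∧ c.len ≠ ⊤
  | .obl, .qForall => ∀ c : OblChase S D, OblFair c → c.len ≠ ⊤
  | .core, .qExists => ∃ c : CoreChase S D, c.len ≠ ⊤
  | .core, .qForall => ∀ c : CoreChase S D, c.len ≠ ⊤

end ChaseTermination

namespace ChaseTermination

/-! ### Primitive recursive predicates with bounded quantifiers -/

section Primrec

variable {α β γ : Type} [Primcodable α] [Primcodable β] [Primcodable γ]

theorem primrecPred_forall_mem {f : α → List β} {p : α → β → Prop} (hf : Primrec f)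
    (hp : PrimrecRel p) : PrimrecPred fun a => ∀ b ∈ f a, p a b :=
  (PrimrecRel.forall_mem_list hp.swap).comp hf Primrec.id

theorem primrecPred_exists_mem {f : α → List β} {p : α → β → Prop} (hf : Primrec f)
    (hp : PrimrecRel p) : PrimrecPred fun a => ∃ b ∈ f a, p a b :=
  (PrimrecRel.exists_mem_list hp.swap).comp hf Primrec.id

theorem primrecPred_mem {f : α → β} {g : α → List β} (hf : Primrec f) (hg : Primrec g) :
    PrimrecPred fun a => f a ∈ g a :=
  (primrecPred_exists_mem (p := fun a b => b = f a) hg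
    (Primrec.eq.comp Primrec.snd (hf.comp Primrec.fst))).of_eq fun a => by simp

theorem primrecPred_imp {p q : α → Prop} (hp : PrimrecPred p) (hq : PrimrecPred q) :
    PrimrecPred fun a => p a → q a :=
  (hp.not.or hq).of_eq fun _ => imp_iff_not_or.symm

/-- Normal form for a game-free `Σ¹₁` definition: a function `f` all of whose finitely many
values inspected by a challenge `c` satisfy a primitive recursive condition. -/
theorem pi11_of_forall_exists_not [Inhabited β] {q₁ q₂ : γ → ℕ} {j : β → ℕ}
    {P : α × γ → (β × β) × (β × β) → Prop} (hq₁ : Primrec q₁) (hq₂ : Primrec q₂)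
    (hj : Primrec j) (hP : PrimrecRel P) {p : α → Prop}
    (h : ∀ a, p a ↔ ∀ f : ℕ → β, ∃ c : γ,
      ¬ P (a, c) ((f (q₁ c), f (q₁ c + 1)), (f (q₂ c), f (j (f (q₂ c)))))) : Pi11 p := by
  classical
  let rd : List ℕ → ℕ → β := fun l n => (Encodable.decode (α := β) (l.getD n 0)).getD default
  have hrd : Primrec₂ rd :=
    Primrec.option_getD.comp (Primrec.decode.comp (Primrec.list_getD 0)) (Primrec.const default)
  let V : (α × List ℕ) → γ → Prop := fun x c =>
    (q₁ c + 1 < x.2.length ∧ q₂ c < x.2.length ∧ j (rd x.2 (q₂ c)) < x.2.length) ∧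
    ¬ P (x.1, c) ((rd x.2 (q₁ c), rd x.2 (q₁ c + 1)),
      (rd x.2 (q₂ c), rd x.2 (j (rd x.2 (q₂ c)))))
  have hV : PrimrecRel V := by
    have l : Primrec fun x : (α × List ℕ) × γ => x.1.2 := Primrec.snd.comp Primrec.fst
    have len : Primrec fun x : (α × List ℕ) × γ => x.1.2.length := Primrec.list_length.comp l
    have h1 : Primrec fun x : (α × List ℕ) × γ => q₁ x.2 := hq₁.comp Primrec.snd
    have h2 : Primrec fun x : (α × List ℕ) × γ => q₂ x.2 := hq₂.comp Primrec.snd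
    have h1' : Primrec fun x : (α × List ℕ) × γ => q₁ x.2 + 1 := Primrec.succ.comp h1
    have h3 : Primrec fun x : (α × List ℕ) × γ => j (rd x.1.2 (q₂ x.2)) :=
      hj.comp (hrd.comp l h2)
    refine PrimrecPred.and (PrimrecPred.and (Primrec.nat_lt.comp h1' len)
      (PrimrecPred.and (Primrec.nat_lt.comp h2 len) (Primrec.nat_lt.comp h3 len))) ?_
    refine PrimrecPred.not (hP.comp ((Primrec.fst.comp Primrec.fst).pair Primrec.snd) ?_)
    exact ((hrd.comp l h1).pair (hrd.comp l h1')).pair ((hrd.comp l h2).pair (hrd.comp l h3))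
  let R : α → List ℕ → Bool := fun a l =>
    ((Encodable.decode (α := γ) l.length.unpair.1).map fun c => decide (V (a, l) c)).getD false
  refine ⟨R, ?_, fun a => ?_⟩
  · refine Primrec₂.to_comp ?_
    refine Primrec.option_getD.comp (Primrec.option_map (Primrec.decode.comp
      (Primrec.fst.comp (Primrec.unpair.comp (Primrec.list_length.comp Primrec.snd)))) ?_)
      (Primrec.const false)
    exact hV.decide
  · rw [h a]
    have key : ∀ (g : ℕ → ℕ) (k : ℕ), R a ((List.range k).map g) = true ↔
        ∃ c, Encodable.decode (α := γ) k.unpair.1 = some c ∧ V (a, (List.range k).map g) c := by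
      intro g k
      simp only [R, List.length_map, List.length_range]
      cases Encodable.decode (α := γ) k.unpair.1 <;> simp
    have hget : ∀ (g : ℕ → ℕ) (k n : ℕ), n < k →
        rd ((List.range k).map g) n = (Encodable.decode (α := β) (g n)).getD default := by
      intro g k n hn
      simp [rd, List.getD, hn]
    constructor
    · intro H g
      obtain ⟨c, hc⟩ := H fun n => (Encodable.decode (α := β) (g n)).getD default
      set f : ℕ → β := fun n => (Encodable.decode (α := β) (g n)).getD default with hf
      let m := q₁ c + 1 + q₂ c + j (f (q₂ c)) + 1
      refine ⟨Nat.pair (Encodable.encode c) m, (key _ _).2 ⟨c, by simp, ?_⟩⟩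
      have hm : m ≤ Nat.pair (Encodable.encode c) m := Nat.right_le_pair _ _
      set K := Nat.pair (Encodable.encode c) m
      have e2 := hget g K (q₂ c) (by omega)
      have e1 := hget g K (q₁ c) (by omega)
      have e1' := hget g K (q₁ c + 1) (by omega)
      have e3 := hget g K (j (f (q₂ c))) (by omega)
      simp only [V]
      rw [e2, e1, e1']
      change (_ ∧ _ ∧ j (f (q₂ c)) < _) ∧ ¬ P _ (_, (_, rd _ (j (f (q₂ c)))))
      rw [e3]
      refine ⟨?_, hc⟩
      simp only [List.length_map, List.length_range]
      omega
    · intro H f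
      obtain ⟨k, hk⟩ := H fun n => Encodable.encode (f n)
      obtain ⟨c, -, ⟨hlt, hlt2, hlt3⟩, hc⟩ := (key _ _).1 hk
      refine ⟨c, ?_⟩
      simp only [List.length_map, List.length_range] at hlt hlt2 hlt3
      have hget' : ∀ n < k, rd ((List.range k).map fun n => Encodable.encode (f n)) n = f n := by
        intro n hn
        rw [hget _ _ _ hn]; simp
      rw [hget' _ hlt2] at hlt3
      rw [hget' _ hlt2, hget' _ hlt3, hget' _ hlt, hget' _ (by omega)] at hc
      exact hc

end Primrec

/-! ### Finite representations of chase derivations -/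

/-- The substitution represented by a finite list of values. -/
def sub (s : List GroundTerm) (v : ℕ) : GroundTerm := s.getD v (Sum.inl 0)

/-- Two represented substitutions agree on a list of atoms. -/
def subAgree (as : List Atom) (s t : List GroundTerm) : Prop :=
  ∀ a ∈ as, applyA (sub s) a = applyA (sub t) a

/-- The data recorded for a step: facts, rule, trigger substitution, extension; and a fairness
witness (step and extension) for the challenge whose code is the index. -/
abbrev StepData : Type :=
  ((List Fact × Rule) × (List GroundTerm × List GroundTerm)) × (ℕ × List GroundTerm)

/-- A challenge to a recorded derivation: a step, two variables, a rule and a substitution. -/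
abbrev Challenge : Type := (ℕ × ℕ × ℕ) × (Rule × List GroundTerm)

/-- The condition checked for a challenge. -/
def chaseCond (x : RuleSet × Challenge) (d : (StepData × StepData) × (StepData × StepData)) :
    Prop :=
  (x.2.1.1 = 0 → ∀ f ∈ d.1.1.1.1.1, factNullFree f) ∧
  d.1.1.1.1.2 ∈ x.1 ∧
  (∀ a ∈ d.1.1.1.1.2.1, applyA (sub d.1.1.1.2.1) a ∈ d.1.1.1.1.1) ∧
  (subAgree d.1.1.1.1.2.1 x.2.2.2 d.1.1.1.2.1 →
    ∃ a ∈ d.1.1.1.1.2.2, applyA (sub x.2.2.2) a ∉ d.1.1.1.1.1) ∧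
  subAgree d.1.1.1.1.2.1 d.1.1.1.2.2 d.1.1.1.2.1 ∧
  (existVar d.1.1.1.1.2 x.2.1.2.1 →
    (sub d.1.1.1.2.2 x.2.1.2.1).isRight = true ∧
      ∀ f ∈ d.1.1.1.1.1, sub d.1.1.1.2.2 x.2.1.2.1 ∉ f.2) ∧
  (existVar d.1.1.1.1.2 x.2.1.2.1 → existVar d.1.1.1.1.2 x.2.1.2.2 →
    sub d.1.1.1.2.2 x.2.1.2.1 = sub d.1.1.1.2.2 x.2.1.2.2 → x.2.1.2.1 = x.2.1.2.2) ∧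
  d.1.2.1.1.1 = d.1.1.1.1.1 ++ d.1.1.1.1.2.2.map (applyA (sub d.1.1.1.2.2)) ∧
  (x.2.2.1 ∈ x.1 → (∀ a ∈ x.2.2.1.1, applyA (sub x.2.2.2) a ∈ d.1.1.1.1.1) →
    subAgree x.2.2.1.1 d.2.1.2.2 x.2.2.2 ∧
      ∀ a ∈ x.2.2.1.2, applyA (sub d.2.1.2.2) a ∈ d.2.2.1.1.1)

section Primrec

open Primrec

variable {α : Type} [Primcodable α]

theorem primrec_sub : Primrec₂ sub := Primrec.list_getD _

theorem primrec_applyT : Primrec₂ fun (s : List GroundTerm) (t : RTerm) => applyT (sub s) t := by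
  refine (Primrec.sumCasesOn (f := fun x : List GroundTerm × RTerm => x.2)
    (g := fun x v => sub x.1 v) (h := fun _ g => g) Primrec.snd
    (primrec_sub.comp (Primrec.fst.comp Primrec.fst) Primrec.snd) Primrec.snd).of_eq ?_
  rintro ⟨s, v | g⟩ <;> rfl

theorem primrec_applyA : Primrec₂ fun (s : List GroundTerm) (a : Atom) => applyA (sub s) a := by
  refine (Primrec.fst.comp Primrec.snd).pair (Primrec.list_map (Primrec.snd.comp Primrec.snd) ?_)
  exact primrec_applyT.comp (Primrec.fst.comp Primrec.fst) Primrec.snd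

theorem primrecPred_subAgree {as : α → List Atom} {s t : α → List GroundTerm} (ha : Primrec as)
    (hs : Primrec s) (ht : Primrec t) : PrimrecPred fun x => subAgree (as x) (s x) (t x) :=
  primrecPred_forall_mem ha
    (Primrec.eq.comp (primrec_applyA.comp (hs.comp Primrec.fst) Primrec.snd)
      (primrec_applyA.comp (ht.comp Primrec.fst) Primrec.snd))

theorem primrecPred_factNullFree : PrimrecPred factNullFree := by
  have h : PrimrecPred fun f : Fact => ∀ t ∈ f.2, ¬ (t.isRight = true) := by
    refine primrecPred_forall_mem Primrec.snd (PrimrecPred.not ?_)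
    refine Primrec.eq.comp ?_ (Primrec.const true)
    refine (Primrec.sumCasesOn (f := fun x : Fact × GroundTerm => x.2)
      (g := fun _ _ => false) (h := fun _ _ => true) Primrec.snd
      (Primrec.const false).to₂ (Primrec.const true).to₂).of_eq ?_
    rintro ⟨s, v | g⟩ <;> rfl
  refine h.of_eq fun f => forall₂_congr fun t _ => ?_
  cases t <;> simp

theorem primrecPred_atomNullFree : PrimrecPred atomNullFree := by
  have h : PrimrecPred fun f : Atom => ∀ t ∈ f.2, ¬ (t.elim (fun _ => false)
      (fun g => g.elim (fun _ => false) (fun _ => true)) = true) := by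
    refine primrecPred_forall_mem Primrec.snd (PrimrecPred.not ?_)
    refine Primrec.eq.comp ?_ (Primrec.const true)
    have inner : Primrec fun g : GroundTerm => g.elim (fun _ => false) (fun _ => true) := by
      refine (Primrec.sumCasesOn (f := fun x : GroundTerm => x)
        (g := fun _ _ => false) (h := fun _ _ => true) Primrec.id
        (Primrec.const false).to₂ (Primrec.const true).to₂).of_eq ?_
      rintro (v | g) <;> rfl
    refine (Primrec.sumCasesOn (f := fun x : Atom × RTerm => x.2)
      (g := fun _ _ => false) (h := fun _ g => g.elim (fun _ => false) (fun _ => true)) Primrec.snd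
      (Primrec.const false).to₂ (inner.comp Primrec.snd).to₂).of_eq ?_
    rintro ⟨s, v | g⟩ <;> rfl
  refine h.of_eq fun f => forall₂_congr fun t _ => ?_
  rcases t with v | c | n <;> simp

theorem primrecPred_isRuleSet : PrimrecPred IsRuleSet := by
  refine primrecPred_forall_mem Primrec.id (PrimrecPred.and ?_ ?_)
  · exact PrimrecPred.not (Primrec.eq.comp (Primrec.snd.comp Primrec.snd) (Primrec.const []))
  · refine primrecPred_forall_mem (Primrec.list_append.comp (Primrec.fst.comp Primrec.snd)
      (Primrec.snd.comp Primrec.snd)) ?_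
    exact primrecPred_atomNullFree.comp Primrec.snd

theorem primrecRel_existVar : PrimrecRel existVar := by
  have h : PrimrecRel fun (as : List Atom) (v : ℕ) => ∃ a ∈ as, atomHasVar a v := by
    refine primrecPred_exists_mem Primrec.fst ?_
    exact primrecPred_mem (Primrec.sumInl.comp (Primrec.snd.comp Primrec.fst))
      (Primrec.snd.comp Primrec.snd)
  exact PrimrecPred.and (h.comp (Primrec.snd.comp Primrec.fst) Primrec.snd)
    (PrimrecPred.not (h.comp (Primrec.fst.comp Primrec.fst) Primrec.snd))

set_option synthInstance.maxHeartbeats 400000 in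
set_option synthInstance.maxSize 1000 in
set_option maxHeartbeats 1000000 in
theorem primrecRel_chaseCond : PrimrecRel chaseCond := by
  have S : Primrec fun x : (RuleSet × Challenge) × ((StepData × StepData) × (StepData × StepData)) =>
    x.1.1 := fst.comp fst
  have i : Primrec fun x : (RuleSet × Challenge) × ((StepData × StepData) × (StepData × StepData)) =>
    x.1.2.1.1 := fst.comp (fst.comp (snd.comp fst))
  have v : Primrec fun x : (RuleSet × Challenge) × ((StepData × StepData) × (StepData × StepData)) =>
    x.1.2.1.2.1 := fst.comp (snd.comp (fst.comp (snd.comp fst)))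
  have w : Primrec fun x : (RuleSet × Challenge) × ((StepData × StepData) × (StepData × StepData)) =>
    x.1.2.1.2.2 := snd.comp (snd.comp (fst.comp (snd.comp fst)))
  have r : Primrec fun x : (RuleSet × Challenge) × ((StepData × StepData) × (StepData × StepData)) =>
    x.1.2.2.1 := fst.comp (snd.comp (snd.comp fst))
  have t : Primrec fun x : (RuleSet × Challenge) × ((StepData × StepData) × (StepData × StepData)) =>
    x.1.2.2.2 := snd.comp (snd.comp (snd.comp fst))
  have d : Primrec fun x : (RuleSet × Challenge) × ((StepData × StepData) × (StepData × StepData)) =>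
    x.2.1.1.1 := fst.comp (fst.comp (fst.comp snd))
  have F := fst.comp (fst.comp d)
  have ρ := snd.comp (fst.comp d)
  have s := fst.comp (snd.comp d)
  have s' := snd.comp (snd.comp d)
  have F' : Primrec fun x : (RuleSet × Challenge) ×
    ((StepData × StepData) × (StepData × StepData)) => x.2.1.2.1.1.1 :=
    fst.comp (fst.comp (fst.comp (snd.comp (fst.comp snd))))
  have ws : Primrec fun x : (RuleSet × Challenge) ×
    ((StepData × StepData) × (StepData × StepData)) => x.2.2.1.2.2 :=
    snd.comp (snd.comp (fst.comp (snd.comp snd)))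
  have G : Primrec fun x : (RuleSet × Challenge) ×
    ((StepData × StepData) × (StepData × StepData)) => x.2.2.2.1.1.1 :=
    fst.comp (fst.comp (fst.comp (snd.comp (snd.comp snd))))
  refine PrimrecPred.and ?_ (PrimrecPred.and ?_ (PrimrecPred.and ?_ (PrimrecPred.and ?_
    (PrimrecPred.and ?_ (PrimrecPred.and ?_ (PrimrecPred.and ?_ (PrimrecPred.and ?_ ?_)))))))
  · exact primrecPred_imp (Primrec.eq.comp i (const 0))
      (primrecPred_forall_mem F (primrecPred_factNullFree.comp snd))
  · exact primrecPred_mem ρ S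
  · exact primrecPred_forall_mem (fst.comp ρ)
      (primrecPred_mem (primrec_applyA.comp (s.comp fst) snd) (F.comp fst))
  · exact primrecPred_imp (primrecPred_subAgree (fst.comp ρ) t s)
      (primrecPred_exists_mem (snd.comp ρ)
        (PrimrecPred.not (primrecPred_mem (primrec_applyA.comp (t.comp fst) snd) (F.comp fst))))
  · exact primrecPred_subAgree (fst.comp ρ) s' s
  · refine primrecPred_imp (primrecRel_existVar.comp ρ v) (PrimrecPred.and ?_ ?_)
    · refine Primrec.eq.comp ?_ (const true)
      have h : Primrec fun g : GroundTerm => g.isRight :=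
        (Primrec.sumCasesOn (f := fun x : GroundTerm => x) (g := fun _ _ => false)
          (h := fun _ _ => true) Primrec.id (Primrec.const false).to₂
          (Primrec.const true).to₂).of_eq (by rintro (v | g) <;> rfl)
      exact h.comp (primrec_sub.comp s' v)
    · exact primrecPred_forall_mem F (PrimrecPred.not (primrecPred_mem
        (primrec_sub.comp (s'.comp fst) (v.comp fst)) (snd.comp snd)))
  · exact primrecPred_imp (primrecRel_existVar.comp ρ v)
      (primrecPred_imp (primrecRel_existVar.comp ρ w)
        (primrecPred_imp (Primrec.eq.comp (primrec_sub.comp s' v) (primrec_sub.comp s' w))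
          (Primrec.eq.comp v w)))
  · exact Primrec.eq.comp F' (Primrec.list_append.comp F
      (Primrec.list_map (snd.comp ρ) (primrec_applyA.comp (s'.comp fst) snd)))
  · refine primrecPred_imp (primrecPred_mem r S) (primrecPred_imp ?_ (PrimrecPred.and ?_ ?_))
    · exact primrecPred_forall_mem (fst.comp r)
        (primrecPred_mem (primrec_applyA.comp (t.comp fst) snd) (F.comp fst))
    · exact primrecPred_subAgree (fst.comp r) ws t
    · exact primrecPred_forall_mem (snd.comp r)
        (primrecPred_mem (primrec_applyA.comp (ws.comp fst) snd) (G.comp fst))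

end Primrec

end ChaseTermination

namespace ChaseTermination

theorem applyA_congr {σ τ : ℕ → GroundTerm} {a : Atom} (h : ∀ v, atomHasVar a v → σ v = τ v) :
    applyA σ a = applyA τ a := by
  refine Prod.ext rfl (List.map_congr_left fun t ht => ?_)
  rcases t with v | g
  · exact h v ht
  · rfl

theorem applyA_eq_iff {σ τ : ℕ → GroundTerm} {a : Atom} :
    applyA σ a = applyA τ a ↔ ∀ v, atomHasVar a v → σ v = τ v := by
  refine ⟨fun h v hv => ?_, applyA_congr⟩
  have h2 : a.2.map (applyT σ) = a.2.map (applyT τ) := congrArg Prod.snd h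
  exact List.map_inj_left.1 h2 _ hv

theorem subAgree_iff {as : List Atom} {s t : List GroundTerm} :
    subAgree as s t ↔ ∀ v, (∃ a ∈ as, atomHasVar a v) → sub s v = sub t v := by
  simp only [subAgree, applyA_eq_iff]
  exact ⟨fun h v ⟨a, ha, hv⟩ => h a ha v hv, fun h a ha v hv => h v ⟨a, ha, hv⟩⟩

theorem exists_sub_eq (as : List Atom) (σ : ℕ → GroundTerm) :
    ∃ s, ∀ v, (∃ a ∈ as, atomHasVar a v) → sub s v = σ v := by
  obtain ⟨N, hN⟩ := (as.flatMap fun a => a.2.filterMap Sum.getLeft?).toFinset.exists_nat_subset_range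
  refine ⟨(List.range N).map σ, fun v ⟨a, ha, hv⟩ => ?_⟩
  have : v < N := by
    refine Finset.mem_range.1 (hN ?_)
    simp only [List.mem_toFinset, List.mem_flatMap, List.mem_filterMap]
    exact ⟨a, ha, _, hv, rfl⟩
  simp [sub, List.getD, this]

/-- The index of the fairness witness for a challenge. -/
def witnessIndex (c : Challenge) : ℕ := Encodable.encode ((c.1.1, c.2) : ℕ × (Rule × List GroundTerm))

theorem loaded_mono {t : Trigger} {F G : Set Fact} (h : F ⊆ G) (ht : loaded t F) : loaded t G :=
  fun a ha => h (ht a ha)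

theorem obsolete_mono {t : Trigger} {F G : Set Fact} (h : F ⊆ G) (ht : obsolete t F) :
    obsolete t G := by
  obtain ⟨σ, h1, h2⟩ := ht
  exact ⟨σ, h1, fun a ha => h (h2 a ha)⟩

theorem Chase.mono {S : RuleSet} {D : Set Fact} (c : Chase S D) : Monotone c.fact := by
  refine monotone_nat_of_le_succ fun i => ?_
  by_cases h : (i : ℕ∞) < c.len
  · rw [c.succ i h]; exact Set.subset_union_left
  · rw [c.stall i h]

theorem exists_record {S : RuleSet} {D : Database} (hD : IsDatabase D) (c : Chase S (dbSet D))
    (hinf : IsInfinite c) (hfair : Fair c) :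
    ∃ f : ℕ → StepData, ∀ x : Challenge, chaseCond (S, x)
      ((f x.1.1, f (x.1.1 + 1)), (f (witnessIndex x), f (f (witnessIndex x)).2.1)) := by
  have hlt : ∀ i : ℕ, (i : ℕ∞) < c.len := fun i => by
    rw [show c.len = ⊤ from hinf]; exact ENat.natCast_lt_top i
  choose s hs using fun i => exists_sub_eq (c.trig i).1.1 (c.trig i).2
  choose s' hs' using fun i => exists_sub_eq ((c.trig i).1.1 ++ (c.trig i).1.2) (c.ext i)
  have hw : ∀ y : ℕ × (Rule × List GroundTerm), ∃ w : ℕ × List GroundTerm,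
      y.2.1 ∈ S → (∀ a ∈ y.2.1.1, applyA (sub y.2.2) a ∈ c.fact y.1) →
        subAgree y.2.1.1 w.2 y.2.2 ∧ ∀ a ∈ y.2.1.2, applyA (sub w.2) a ∈ c.fact w.1 := by
    intro y
    by_cases h : y.2.1 ∈ S ∧ ∀ a ∈ y.2.1.1, applyA (sub y.2.2) a ∈ c.fact y.1
    · obtain ⟨j, -, σ, h1, h2⟩ := hfair (y.2.1, sub y.2.2) h.1 y.1 h.2
      obtain ⟨t, ht⟩ := exists_sub_eq (y.2.1.1 ++ y.2.1.2) σ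
      refine ⟨(j, t), fun _ _ => ⟨subAgree_iff.2 fun v hv => ?_, fun a ha => ?_⟩⟩
      · obtain ⟨a, ha, hv'⟩ := hv
        exact (ht v ⟨a, List.mem_append_left _ ha, hv'⟩).trans (h1 v ⟨a, ha, hv'⟩)
      · rw [applyA_congr (τ := σ) fun v hv => ht v ⟨a, List.mem_append_right _ ha, hv⟩]
        exact h2 a ha
    · exact ⟨(0, []), fun h1 h2 => absurd ⟨h1, h2⟩ h⟩
  choose W hW using hw
  let fs : ℕ → List Fact := fun n =>
    Nat.rec D (fun i F => F ++ (c.trig i).1.2.map (applyA (sub (s' i)))) n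
  have hfs : ∀ i x, x ∈ fs i ↔ x ∈ c.fact i := by
    intro i
    induction i with
    | zero => intro x; rw [c.init]; rfl
    | succ i ih =>
      intro x
      rw [c.succ i (hlt i)]
      change x ∈ fs i ++ _ ↔ _
      rw [List.mem_append, Set.mem_union, ih]
      refine or_congr Iff.rfl ?_
      simp only [List.mem_map, outputOf, Set.mem_ofPred_eq]
      refine exists_congr fun a => and_congr_right fun ha => ?_
      rw [applyA_congr (τ := c.ext i) fun v hv => hs' i v ⟨a, List.mem_append_right _ ha, hv⟩]
      exact eq_comm
  refine ⟨fun n => (((fs n, (c.trig n).1), (s n, s' n)),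
    W ((Encodable.decode n).getD (0, (([], []), [])))), fun x => ?_⟩
  obtain ⟨⟨i, v, w⟩, r, t⟩ := x
  have hex : ∀ v, existVar (c.trig i).1 v → sub (s' i) v = c.ext i v := by
    rintro v ⟨⟨a, ha, hv⟩, -⟩
    exact hs' i v ⟨a, List.mem_append_right _ ha, hv⟩
  obtain ⟨hS, hload, hobs⟩ := c.activeAt i (hlt i)
  obtain ⟨e1, e2, e3⟩ := c.extOk i (hlt i)
  have hbody : ∀ v, (∃ a ∈ (c.trig i).1.1, atomHasVar a v) → sub (s' i) v = sub (s i) v := by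
    rintro v ⟨a, ha, hv⟩
    rw [hs' i v ⟨a, List.mem_append_left _ ha, hv⟩, hs i v ⟨a, ha, hv⟩, e1 v ⟨a, ha, hv⟩]
  simp only [chaseCond, witnessIndex, Encodable.encodek, Option.getD_some]
  refine ⟨?_, hS, ?_, ?_, subAgree_iff.2 hbody, ?_, ?_, rfl, ?_⟩
  · rintro rfl; exact hD
  · intro a ha
    rw [hfs, applyA_congr (τ := (c.trig i).2) fun v hv => hs i v ⟨a, ha, hv⟩]
    exact hload a ha
  · intro h
    by_contra! hall
    refine hobs ⟨sub t, fun v hv => ?_, fun a ha => (hfs _ _).1 (hall a ha)⟩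
    exact (subAgree_iff.1 h v hv).trans (hs i v hv)
  · intro hv
    obtain ⟨n, hn, hn'⟩ := e2 v hv
    rw [hex v hv, hn]
    refine ⟨rfl, fun f hf hmem => hn' ⟨f, (hfs _ _).1 hf, hmem⟩⟩
  · intro hv hw h
    rw [hex v hv, hex w hw] at h
    exact e3 v w hv hw h
  · intro hr hl
    have := hW (i, r, t) hr fun a ha => (hfs _ _).1 (hl a ha)
    exact ⟨this.1, fun a ha => (hfs _ _).2 (this.2 a ha)⟩

theorem exists_chase_of_record {S : RuleSet} {f : ℕ → StepData}
    (hf : ∀ x : Challenge, chaseCond (S, x)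
      ((f x.1.1, f (x.1.1 + 1)), (f (witnessIndex x), f (f (witnessIndex x)).2.1))) :
    ∃ D, IsDatabase D ∧ ∃ c : Chase S (dbSet D), IsInfinite c ∧ Fair c := by
  let dr : Rule := ([], [])
  have H := fun i v w r t => hf ((i, v, w), (r, t))
  simp only [chaseCond] at H
  let c : Chase S (dbSet (f 0).1.1.1) :=
    { len := ⊤
      fact := fun i => {x | x ∈ (f i).1.1.1}
      trig := fun i => ((f i).1.1.2, sub (f i).1.2.1)
      ext := fun i => sub (f i).1.2.2
      init := rfl
      activeAt := fun i _ => by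
        refine ⟨(H i 0 0 dr []).2.1, (H i 0 0 dr []).2.2.1, ?_⟩
        rintro ⟨σ, h1, h2⟩
        obtain ⟨t, ht⟩ := exists_sub_eq ((f i).1.1.2.1 ++ (f i).1.1.2.2) σ
        obtain ⟨a, ha, hna⟩ := (H i 0 0 dr t).2.2.2.1 (subAgree_iff.2 fun v ⟨a, ha, hv⟩ =>
          (ht v ⟨a, List.mem_append_left _ ha, hv⟩).trans (h1 v ⟨a, ha, hv⟩))
        refine hna ?_
        rw [applyA_congr (τ := σ) fun v hv => ht v ⟨a, List.mem_append_right _ ha, hv⟩]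
        exact h2 a ha
      extOk := fun i _ => by
        refine ⟨fun v hv => subAgree_iff.1 (H i 0 0 dr []).2.2.2.2.1 v hv, fun v hv => ?_,
          fun v w hv hw => (H i v w dr []).2.2.2.2.2.2.1 hv hw⟩
        obtain ⟨h1, h2⟩ := (H i v 0 dr []).2.2.2.2.2.1 hv
        obtain ⟨n, hn⟩ := Sum.isRight_iff.1 h1
        refine ⟨n, hn, ?_⟩
        rintro ⟨g, hg, hmem⟩
        exact h2 g hg (hn ▸ hmem)
      succ := fun i _ => by
        ext x
        have := (H i 0 0 dr []).2.2.2.2.2.2.2.1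
        simp only [Set.mem_ofPred_eq, this, List.mem_append, List.mem_map, Set.mem_union, outputOf,
          eq_comm]
      stall := fun i h => absurd (ENat.natCast_lt_top i) h }
  refine ⟨(f 0).1.1.1, (H 0 0 0 dr []).1 rfl, c, rfl, ?_⟩
  rintro ⟨r, σ⟩ hr i hl
  obtain ⟨t, ht⟩ := exists_sub_eq r.1 σ
  have h9 := (H i 0 0 r t).2.2.2.2.2.2.2.2 hr fun a ha => by
    rw [applyA_congr (τ := σ) fun v hv => ht v ⟨a, ha, hv⟩]
    exact hl a ha
  set k := (f (witnessIndex ((i, 0, 0), (r, t)))).2.1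
  refine ⟨max i k, le_max_left _ _, obsolete_mono (c.mono (le_max_right i k))
    ⟨_, fun v hv => (subAgree_iff.1 h9.1 v hv).trans (ht v hv), h9.2⟩⟩

set_option synthInstance.maxHeartbeats 400000 in
set_option synthInstance.maxSize 1000 in
theorem pi11_TRRall : Pi11 TRRall := by
  refine pi11_of_forall_exists_not (β := StepData) (γ := Challenge)
    (P := fun x d => IsRuleSet x.1 → chaseCond x d) (q₁ := fun c => c.1.1) (q₂ := witnessIndex)
    (j := fun d => d.2.1) (Primrec.fst.comp Primrec.fst) ?_
    (Primrec.fst.comp Primrec.snd) ?_ fun S => ?_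
  · exact Primrec.encode.comp ((Primrec.fst.comp Primrec.fst).pair Primrec.snd)
  · exact primrecPred_imp (primrecPred_isRuleSet.comp (Primrec.fst.comp Primrec.fst))
      primrecRel_chaseCond
  · constructor
    · rintro ⟨hS, h⟩ f
      by_contra! hf
      obtain ⟨D, hD, hc⟩ := exists_chase_of_record fun x => hf x hS
      exact h D hD hc
    · intro h
      have hS : IsRuleSet S := by
        obtain ⟨c, hc⟩ := h fun _ => (default : StepData)
        exact (Classical.not_imp.1 hc).1
      refine ⟨hS, fun D hD ⟨c, hc, hfair⟩ => ?_⟩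
      obtain ⟨f, hf⟩ := exists_record hD c hc hfair
      obtain ⟨x, hx⟩ := h f
      exact hx fun _ => hf x

end ChaseTermination

namespace ChaseTermination

/-- `n` codes a one-point extension of the sequence coded by `p`, no initial part of which is
accepted by `R`. -/
def extendsBy (R : List ℕ → Bool) (p n : ℕ) : Prop :=
  Denumerable.ofNat (List ℕ) n ≠ [] ∧
  p = Encodable.encode ((Denumerable.ofNat (List ℕ) n).take
    ((Denumerable.ofNat (List ℕ) n).length - 1)) ∧
  ∀ j < (Denumerable.ofNat (List ℕ) n).length + 1,
    R ((Denumerable.ofNat (List ℕ) n).take j) = false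

theorem exists_chain_extendsBy {R : List ℕ → Bool} {f : ℕ → ℕ}
    (hf : ∀ k, R ((List.range k).map f) = false) :
    ∃ s : ℕ → ℕ, s 0 = 0 ∧ ∀ k, extendsBy R (s k) (s (k + 1)) := by
  have ht : ∀ k j, j ≤ k → ((List.range k).map f).take j = (List.range j).map f := by
    intro k j h
    rw [← List.map_take, List.take_range, min_eq_left h]
  refine ⟨fun k => Encodable.encode ((List.range k).map f), rfl, fun k => ⟨?_, ?_, ?_⟩⟩
  · simp
  · simp only [Denumerable.ofNat_encode, List.length_map, List.length_range, Nat.add_sub_cancel]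
    rw [ht _ _ (by omega)]
  · simp only [Denumerable.ofNat_encode, List.length_map, List.length_range]
    intro j hj
    rw [ht _ _ (by omega)]
    exact hf j

theorem exists_of_chain_extendsBy {R : List ℕ → Bool} {s : ℕ → ℕ}
    (hs : ∀ k, extendsBy R (s k) (s (k + 1))) : ∃ f : ℕ → ℕ, ∀ k, R ((List.range k).map f) = false := by
  set l : ℕ → List ℕ := fun k => Denumerable.ofNat (List ℕ) (s k) with hl
  have hl1 : ∀ k, l k = (l (k + 1)).take ((l (k + 1)).length - 1) := by
    intro k
    have := congrArg (Denumerable.ofNat (List ℕ)) (hs k).2.1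
    rwa [Denumerable.ofNat_encode] at this
  have hlen : ∀ k, k ≤ (l k).length := by
    intro k
    induction k with
    | zero => omega
    | succ k ih =>
      have h1 := congrArg List.length (hl1 k)
      have h2 := List.length_pos_iff.2 (hs k).1
      rw [List.length_take] at h1
      change 0 < (l (k + 1)).length at h2
      omega
  have hpre : ∀ i j, i ≤ j → l i <+: l j := by
    intro i j h
    induction h with
    | refl => exact List.prefix_rfl
    | step _ ih => exact ih.trans ((hl1 _).symm ▸ List.take_prefix _ _)
  refine ⟨fun i => (l (i + 1)).getD i 0, fun k => ?_⟩
  have : (List.range k).map (fun i => (l (i + 1)).getD i 0) = (l (k + 1)).take k := by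
    apply List.ext_getElem
    · have := hlen (k + 1)
      simp; omega
    · intro i h1 h2
      simp only [List.length_map, List.length_range] at h1
      have hi := hlen (i + 1)
      have hp := hpre (i + 1) (k + 1) (by omega)
      rw [List.getElem_map, List.getElem_range, List.getElem_take,
        List.getD_eq_getElem _ _ (by omega)]
      exact hp.getElem (by omega)
  rw [this]
  exact (hs k).2.2 k (by have := hlen (k + 1); change _ < (l (k + 1)).length + 1; omega)

theorem exists_code_extendsBy {R : ℕ → List ℕ → Bool} (hR : Computable₂ R) :
    ∃ c : Nat.Partrec.Code, ∀ a p n,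
      0 ∈ c.eval (Nat.pair a (Nat.pair p n)) ↔ extendsBy (R a) p n := by
  classical
  let chk : ℕ → List ℕ → ℕ → Bool := fun a l k =>
    Nat.rec true (fun j b => b && !R a (l.take j)) k
  have hchk : ∀ a l k, chk a l k = true ↔ ∀ j < k, R a (l.take j) = false := by
    intro a l k
    induction k with
    | zero => simp [chk]
    | succ k ih =>
      change (chk a l k && !R a (l.take k)) = true ↔ _
      simp only [Bool.and_eq_true, ih, Bool.not_eq_true', Nat.lt_succ_iff_lt_or_eq, or_imp,
        forall_and, forall_eq]
  let g : ℕ → ℕ := fun m => bif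
    ((decide (Denumerable.ofNat (List ℕ) m.unpair.2.unpair.2 ≠ []) &&
    decide (m.unpair.2.unpair.1 = Encodable.encode
      ((Denumerable.ofNat (List ℕ) m.unpair.2.unpair.2).take
        ((Denumerable.ofNat (List ℕ) m.unpair.2.unpair.2).length - 1)))) &&
    chk m.unpair.1 (Denumerable.ofNat (List ℕ) m.unpair.2.unpair.2)
      ((Denumerable.ofNat (List ℕ) m.unpair.2.unpair.2).length + 1)) then 0 else 1
  have hg : Computable g := by
    have hp : Primrec fun m : ℕ => m.unpair.2.unpair.1 :=
      Primrec.fst.comp (Primrec.unpair.comp (Primrec.snd.comp Primrec.unpair))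
    have hl : Primrec fun m : ℕ => Denumerable.ofNat (List ℕ) m.unpair.2.unpair.2 :=
      (Primrec.ofNat _).comp (Primrec.snd.comp (Primrec.unpair.comp (Primrec.snd.comp Primrec.unpair)))
    refine Computable.cond ?_ (Computable.const 0) (Computable.const 1)
    refine Primrec.and.to_comp.comp (Primrec.to_comp (Primrec.and.comp ?_ ?_)) ?_
    · exact (PrimrecPred.not (Primrec.eq.comp hl (Primrec.const []))).decide
    · exact (Primrec.eq.comp hp (Primrec.encode.comp (Primrec.list_take.comp
        (Primrec.nat_sub.comp (Primrec.list_length.comp hl) (Primrec.const 1)) hl))).decide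
    · refine Computable.nat_rec (f := fun m : ℕ =>
        (Denumerable.ofNat (List ℕ) m.unpair.2.unpair.2).length + 1) (g := fun _ => true)
        (h := fun m jb => jb.2 && !R m.unpair.1
          ((Denumerable.ofNat (List ℕ) m.unpair.2.unpair.2).take jb.1))
        (Primrec.succ.comp (Primrec.list_length.comp hl)).to_comp (Computable.const true) ?_
      refine Primrec.and.to_comp.comp (Computable.snd.comp Computable.snd)
        (Primrec.not.to_comp.comp (hR.comp ?_ ?_))
      · exact ((Primrec.fst.comp Primrec.unpair).comp Primrec.fst).to_comp
      · exact (Primrec.list_take.comp (Primrec.fst.comp Primrec.snd) (hl.comp Primrec.fst)).to_comp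
  obtain ⟨c, hc⟩ := Nat.Partrec.Code.exists_code.1 (Partrec.nat_iff.1 hg.partrec)
  refine ⟨c, fun a p n => ?_⟩
  rw [hc]
  simp only [PFun.coe_val, Part.mem_some_iff, g, Nat.unpair_pair]
  rw [extendsBy, ← hchk, ← and_assoc]
  by_cases h1 : Denumerable.ofNat (List ℕ) n = [] <;> by_cases h2 : p = Encodable.encode
      ((Denumerable.ofNat (List ℕ) n).take ((Denumerable.ofNat (List ℕ) n).length - 1)) <;>
    cases hb : chk a (Denumerable.ofNat (List ℕ) n) ((Denumerable.ofNat (List ℕ) n).length + 1) <;>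
    simp [h1, h2]

theorem exists_code_of_pi11 {q : ℕ → Prop} (hq : Pi11 q) :
    ∃ c : Nat.Partrec.Code,
      (∀ a, q a → WellFounded fun n p => 0 ∈ c.eval (Nat.pair a (Nat.pair p n))) ∧
      ∀ a, ¬ q a → ∃ s : ℕ → ℕ, s 0 = 0 ∧
        ∀ k, 0 ∈ c.eval (Nat.pair a (Nat.pair (s k) (s (k + 1)))) := by
  obtain ⟨R, hR, h⟩ := hq
  obtain ⟨c, hc⟩ := exists_code_extendsBy hR
  refine ⟨c, fun a ha => ?_, fun a ha => ?_⟩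
  · simp only [hc]
    refine wellFounded_iff_isEmpty_descending_chain.2 ⟨fun ⟨s, hs⟩ => ?_⟩
    obtain ⟨f, hf⟩ := exists_of_chain_extendsBy (R := R a) hs
    obtain ⟨k, hk⟩ := (h a).1 ha f
    simp [hf k] at hk
  · simp only [hc]
    rw [h] at ha
    push Not at ha
    obtain ⟨f, hf⟩ := ha
    exact exists_chain_extendsBy fun k => by simpa using hf k

end ChaseTermination

namespace ChaseTermination

open Nat.Partrec (Code)

/-! ### The rule set of the hardness reduction

Every atom carries, as its first argument, the level (brake) to which it belongs. -/

/-- Atoms all of whose arguments are variables. -/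
abbrev VAtom : Type := ℕ × List ℕ

def VAtom.toAtom (a : VAtom) : Atom := (a.1, a.2.map Sum.inl)

/-- The instance of a variable-only atom. -/
def VAtom.inst (σ : ℕ → GroundTerm) (a : VAtom) : Fact := (a.1, a.2.map σ)

theorem applyA_toAtom (σ : ℕ → GroundTerm) (a : VAtom) : applyA σ a.toAtom = a.inst σ := by
  simp [applyA, VAtom.toAtom, VAtom.inst, applyT]

/-- The rule with the given variable-only body and head. -/
def mkRule (b h : List VAtom) : Rule := (b.map VAtom.toAtom, h.map VAtom.toAtom)

/-- The core predicates: levels, zero, real elements, successor, next level. -/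
abbrev prLv : ℕ := 0
abbrev prZr : ℕ := 1
abbrev prRe : ℕ := 2
abbrev prSu : ℕ := 3
abbrev prNx : ℕ := 4
/-- The derived predicates: successor and zero on real elements, correspondence with the parent
level, number of the parent, input, order, pairing, accepted number. -/
abbrev prS : ℕ := 5
abbrev prZ : ℕ := 6
abbrev prCp : ℕ := 7
abbrev prPrev : ℕ := 8
abbrev prA : ℕ := 9
abbrev prLt : ℕ := 10
abbrev prPair : ℕ := 11
abbrev prGd : ℕ := 12
/-- The graph of the partial function coded by `c`. -/
abbrev prCode (c : Code) : ℕ := Encodable.encode c + 13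

/-- Body of the rule that extends the number line of a level. -/
def guessBody : List VAtom := [(prLv, [0]), (prRe, [0, 1]), (prSu, [0, 1, 0]), (prNx, [0, 1, 0, 0])]

def guessHead : List VAtom :=
  [(prSu, [0, 1, 2]), (prRe, [0, 2]), (prSu, [0, 2, 0]), (prNx, [0, 2, 0, 0])]

def levelHead : List VAtom :=
  [(prNx, [0, 1, 2, 3]), (prLv, [2]), (prZr, [2, 3]), (prRe, [2, 3]), (prSu, [2, 3, 2]),
    (prNx, [2, 3, 2, 2])]

def brakeHead : List VAtom :=
  [(prZr, [0, 0]), (prRe, [0, 0]), (prSu, [0, 0, 0]), (prNx, [0, 0, 0, 0])]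

/-- Extend the number line of the level `0` after `1` by `2`. -/
def guessRule : Rule := mkRule guessBody guessHead

/-- Open a new level `2` with zero `3`, for the accepted number `1` of the level `0`. -/
def levelRule : Rule := mkRule ((prGd, [0, 1]) :: guessBody) levelHead

/-- Brake the level `0`. -/
def brakeRule : Rule := mkRule [(prLv, [0])] brakeHead

/-- Datalog rules: a body and a single head atom. -/
abbrev DRule : Type := List VAtom × VAtom

/-- Add the level variable `0` to an atom. -/
def VAtom.lift (a : VAtom) : VAtom := (a.1, 0 :: a.2)

def DRule.lift (r : DRule) : DRule := (r.1.map VAtom.lift, r.2.lift)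

def DRule.toRule (r : DRule) : Rule := mkRule r.1 [r.2]

/-- Rules that restrict the core predicates to real elements and compare a level with its
parent. -/
def linkRules : List DRule :=
  [([(prSu, [0, 1, 2]), (prRe, [0, 2])], (prS, [0, 1, 2])),
   ([(prZr, [0, 1]), (prRe, [0, 1])], (prZ, [0, 1])),
   ([(prNx, [0, 1, 2, 3]), (prRe, [2, 3]), (prZr, [0, 4]), (prZ, [2, 5])], (prCp, [2, 4, 5])),
   ([(prNx, [0, 1, 2, 3]), (prRe, [2, 3]), (prCp, [2, 4, 5]), (prSu, [0, 4, 6]),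
      (prS, [2, 5, 7])], (prCp, [2, 6, 7])),
   ([(prNx, [0, 1, 2, 3]), (prRe, [2, 3]), (prCp, [2, 1, 4])], (prPrev, [2, 4]))]

/-- Order and pairing within a level. -/
def arithRules : List DRule :=
  [([(prS, [1, 2])], (prLt, [1, 2])),
   ([(prLt, [1, 2]), (prS, [2, 3])], (prLt, [1, 3])),
   ([(prZ, [1])], (prPair, [1, 1, 1])),
   ([(prPair, [1, 2, 3]), (prS, [3, 4]), (prS, [1, 5]), (prLt, [5, 2])], (prPair, [5, 2, 4])),
   ([(prPair, [1, 2, 3]), (prS, [3, 4]), (prS, [1, 2]), (prZ, [5])], (prPair, [2, 5, 4])),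
   ([(prPair, [1, 2, 3]), (prS, [3, 4]), (prLt, [2, 1]), (prS, [2, 5])], (prPair, [1, 5, 4])),
   ([(prPair, [1, 1, 2]), (prS, [2, 3]), (prS, [1, 4]), (prZ, [5])], (prPair, [5, 4, 3]))]

/-- Rules computing the graph of a partial recursive function within a level. -/
def codeRules : Code → List DRule
  | .zero => [([(prRe, [1]), (prZ, [2])], (prCode .zero, [1, 2]))]
  | .succ => [([(prS, [1, 2])], (prCode .succ, [1, 2]))]
  | .left => [([(prPair, [1, 2, 3])], (prCode .left, [3, 1]))]
  | .right => [([(prPair, [1, 2, 3])], (prCode .right, [3, 2]))]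
  | .pair f g => ([(prCode f, [1, 2]), (prCode g, [1, 3]), (prPair, [2, 3, 4])],
      (prCode (.pair f g), [1, 4])) :: (codeRules f ++ codeRules g)
  | .comp f g => ([(prCode g, [1, 2]), (prCode f, [2, 3])], (prCode (.comp f g), [1, 3])) ::
      (codeRules f ++ codeRules g)
  | .prec f g =>
      ([(prCode f, [1, 2]), (prZ, [3]), (prPair, [1, 3, 4])], (prCode (.prec f g), [4, 2])) ::
      ([(prPair, [1, 2, 3]), (prCode (.prec f g), [3, 4]), (prS, [2, 5]), (prPair, [2, 4, 6]),
        (prPair, [1, 6, 7]), (prCode g, [7, 8]), (prPair, [1, 5, 9])],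
        (prCode (.prec f g), [9, 8])) :: (codeRules f ++ codeRules g)
  | .rfind' f =>
      ([(prCode f, [1, 2]), (prZ, [2]), (prPair, [3, 4, 1])], (prCode (.rfind' f), [1, 4])) ::
      ([(prCode f, [1, 2]), (prS, [3, 2]), (prPair, [4, 5, 1]), (prS, [5, 6]),
        (prPair, [4, 6, 7]), (prCode (.rfind' f), [7, 8])], (prCode (.rfind' f), [1, 8])) ::
        codeRules f

/-- A number is accepted if the code `c` maps it, together with the input and the number of the
parent level, to zero. -/
def acceptRule (c : Code) : DRule :=
  ([(prPrev, [1]), (prPair, [1, 2, 3]), (prA, [4]), (prPair, [4, 3, 5]), (prCode c, [5, 6]),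
    (prZ, [6])], (prGd, [2]))

/-- The rule marking the input `a`. -/
def inputRule (a : ℕ) : DRule :=
  ((prZ, [1]) :: (List.range a).map fun i => (prS, [i + 1, i + 2]), (prA, [a + 1]))

def localRules (c : Code) (a : ℕ) : List DRule :=
  inputRule a :: acceptRule c :: (arithRules ++ codeRules c)

def datalogRules (c : Code) (a : ℕ) : List DRule :=
  (localRules c a).map DRule.lift ++ linkRules

/-- The rule set of the reduction. -/
def reductionRules (c : Code) (a : ℕ) : RuleSet :=
  guessRule :: levelRule :: brakeRule :: (datalogRules c a).map DRule.toRule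

theorem isRule_mkRule {b h : List VAtom} (hh : h ≠ []) : IsRule (mkRule b h) := by
  refine ⟨by simpa [mkRule] using hh, fun a ha t ht n => ?_⟩
  simp only [mkRule, List.mem_append, List.mem_map] at ha
  rcases ha with ⟨a, -, rfl⟩ | ⟨a, -, rfl⟩ <;>
  · obtain ⟨v, -, rfl⟩ := List.mem_map.1 ht
    simp

theorem isRuleSet_reductionRules (c : Code) (a : ℕ) : IsRuleSet (reductionRules c a) := by
  intro r hr
  simp only [reductionRules, List.mem_cons, List.mem_map] at hr
  rcases hr with rfl | rfl | rfl | ⟨d, -, rfl⟩ <;> exact isRule_mkRule (by simp [guessHead, levelHead, brakeHead])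

theorem computable_reductionRules (c : Code) : Computable (reductionRules c) := by
  have h1 : Primrec fun a : ℕ => (inputRule a).lift.toRule := by
    have h2 : Primrec fun a : ℕ => (List.range a).map fun i : ℕ =>
        ((prS, [Sum.inl 0, Sum.inl (i + 1), Sum.inl (i + 2)]) : Atom) := by
      refine Primrec.list_map Primrec.list_range ?_
      refine (Primrec.const prS).pair (Primrec.list_cons.comp (Primrec.const _)
        (Primrec.list_cons.comp (Primrec.sumInl.comp (Primrec.succ.comp Primrec.snd))
        (Primrec.list_cons.comp (Primrec.sumInl.comp (Primrec.succ.comp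
          (Primrec.succ.comp Primrec.snd))) (Primrec.const []))))
    have h3 : Primrec fun a : ℕ => ([(prA, [Sum.inl 0, Sum.inl (a + 1)])] : List Atom) :=
      Primrec.list_cons.comp ((Primrec.const prA).pair (Primrec.list_cons.comp (Primrec.const _)
        (Primrec.list_cons.comp (Primrec.sumInl.comp Primrec.succ) (Primrec.const []))))
        (Primrec.const [])
    refine ((Primrec.list_cons.comp (Primrec.const (prZ, [Sum.inl 0, Sum.inl 1])) h2).pair
      h3).of_eq fun a => ?_
    simp [inputRule, DRule.lift, DRule.toRule, VAtom.lift, VAtom.toAtom, mkRule, Function.comp_def]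
  have h4 : Primrec (reductionRules c) := by
    refine (Primrec.list_cons.comp (Primrec.const guessRule) (Primrec.list_cons.comp
      (Primrec.const levelRule) (Primrec.list_cons.comp (Primrec.const brakeRule)
      (Primrec.list_cons.comp h1 (Primrec.const
        (((acceptRule c :: (arithRules ++ codeRules c)).map DRule.lift ++ linkRules).map
          DRule.toRule)))))).of_eq fun a => ?_
    simp [reductionRules, datalogRules, localRules]
  exact h4.to_comp

end ChaseTermination

namespace ChaseTermination

open Nat.Partrec (Code)

theorem mem_eval_rfind' {f : Code} {a m v : ℕ} : v ∈ (Code.rfind' f).eval (Nat.pair a m) ↔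
    ∃ n, v = n + m ∧ 0 ∈ f.eval (Nat.pair a (n + m)) ∧
      ∀ k < n, ∃ y, y ≠ 0 ∧ y ∈ f.eval (Nat.pair a (k + m)) := by
  simp only [Code.eval, Nat.unpaired, Nat.unpair_pair, Part.map_eq_map, Part.mem_map_iff]
  constructor
  · rintro ⟨n, hn, rfl⟩
    obtain ⟨h0, h⟩ := Nat.mem_rfind.1 hn
    obtain ⟨x, hx, hx0⟩ := (Part.mem_map_iff _).1 h0
    refine ⟨n, rfl, of_decide_eq_true hx0 ▸ hx, fun k hk => ?_⟩
    obtain ⟨y, hy, hy0⟩ := (Part.mem_map_iff _).1 (h hk)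
    exact ⟨y, by simpa using hy0, hy⟩
  · rintro ⟨n, rfl, h0, h⟩
    refine ⟨n, Nat.mem_rfind.2 ⟨(Part.mem_map_iff _).2 ⟨0, h0, by simp⟩, fun {k} hk => ?_⟩, rfl⟩
    obtain ⟨y, hy, hy0⟩ := h k hk
    exact (Part.mem_map_iff _).2 ⟨y, hy0, by simpa using hy⟩

/-- The intended meaning of the predicates on a level whose elements are numbers, where `Q` holds
of the possible numbers of the parent level. -/
def sem (c : Code) (a : ℕ) (Q : ℕ → Prop) : ℕ → List ℕ → Prop
  | 5, [x, y] => y = x + 1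
  | 6, [x] => x = 0
  | 8, [x] => Q x
  | 9, [x] => x = a
  | 10, [x, y] => x < y
  | 11, [x, y, u] => u = Nat.pair x y
  | 12, [x] => ∃ p, Q p ∧ 0 ∈ c.eval (Nat.pair a (Nat.pair p x))
  | k + 13, [x, y] => y ∈ (Denumerable.ofNat Code k).eval x
  | _, _ => True

theorem sem_code {c d : Code} {a : ℕ} {Q : ℕ → Prop} {x y : ℕ} :
    sem c a Q (prCode d) [x, y] ↔ y ∈ d.eval x := by
  simp [sem]

/-- A Datalog rule is sound for the intended meaning. -/
def Sound (I : ℕ → List ℕ → Prop) (r : DRule) : Prop :=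
  ∀ ρ : ℕ → ℕ, (∀ b ∈ r.1, I b.1 (b.2.map ρ)) → I r.2.1 (r.2.2.map ρ)

theorem pair_succ_of_lt {x y : ℕ} (h : x + 1 < y) : Nat.pair x y + 1 = Nat.pair (x + 1) y := by
  simp [Nat.pair, h, show x < y by omega]; omega

theorem pair_succ_eq (x : ℕ) : Nat.pair x (x + 1) + 1 = Nat.pair (x + 1) 0 := by
  simp [Nat.pair]; ring

theorem pair_succ_of_gt {x y : ℕ} (h : y < x) : Nat.pair x y + 1 = Nat.pair x (y + 1) := by
  simp [Nat.pair, show ¬ x < y by omega, show ¬ x < y + 1 by omega]; omega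

theorem pair_succ_self (x : ℕ) : Nat.pair x x + 1 = Nat.pair 0 (x + 1) := by
  simp [Nat.pair]; ring

theorem sound_arithRules {c : Code} {a : ℕ} {Q : ℕ → Prop} :
    ∀ r ∈ arithRules, Sound (sem c a Q) r := by
  intro r hr
  simp only [arithRules, List.mem_cons, List.not_mem_nil, or_false] at hr
  rcases hr with rfl | rfl | rfl | rfl | rfl | rfl | rfl <;> intro ρ h <;>
    simp [sem] at h ⊢
  · omega
  · omega
  · simp [h, Nat.pair]
  · obtain ⟨h1, h2, h3, h4⟩ := h
    rw [h2, h1, h3, pair_succ_of_lt (by omega)]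
  · obtain ⟨h1, h2, h3, h4⟩ := h
    rw [h2, h1, h3, h4, pair_succ_eq]
  · obtain ⟨h1, h2, h3, h4⟩ := h
    rw [h2, h1, h4, pair_succ_of_gt h3]
  · obtain ⟨h1, h2, h3, h4⟩ := h
    rw [h2, h1, h3, h4, pair_succ_self]

theorem sound_codeRules {c : Code} {a : ℕ} {Q : ℕ → Prop} (d : Code) :
    ∀ r ∈ codeRules d, Sound (sem c a Q) r := by
  induction d with
  | zero =>
    simp only [codeRules, List.mem_singleton, forall_eq]
    intro ρ h
    simp only [List.mem_cons, List.not_mem_nil, or_false, forall_eq_or_imp, forall_eq,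
      List.map_cons, List.map_nil, sem_code] at h ⊢
    have h2 : ρ 2 = 0 := h.2
    rw [h2]; exact Part.mem_some _
  | succ =>
    simp only [codeRules, List.mem_singleton, forall_eq]
    intro ρ h
    simp only [List.mem_cons, List.not_mem_nil, or_false, forall_eq,
      List.map_cons, List.map_nil, sem_code] at h ⊢
    have h2 : ρ 2 = ρ 1 + 1 := h
    rw [h2]; exact Part.mem_some _
  | left =>
    simp only [codeRules, List.mem_singleton, forall_eq]
    intro ρ h
    simp only [List.mem_cons, List.not_mem_nil, or_false, forall_eq,
      List.map_cons, List.map_nil, sem_code] at h ⊢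
    have h2 : ρ 3 = Nat.pair (ρ 1) (ρ 2) := h
    rw [h2]; simp [Code.eval]
  | right =>
    simp only [codeRules, List.mem_singleton, forall_eq]
    intro ρ h
    simp only [List.mem_cons, List.not_mem_nil, or_false, forall_eq,
      List.map_cons, List.map_nil, sem_code] at h ⊢
    have h2 : ρ 3 = Nat.pair (ρ 1) (ρ 2) := h
    rw [h2]; simp [Code.eval]
  | pair f g hf hg =>
    intro r hr
    simp only [codeRules, List.mem_cons, List.mem_append] at hr
    rcases hr with rfl | hr | hr
    · intro ρ h
      simp only [List.mem_cons, List.not_mem_nil, or_false, forall_eq_or_imp, forall_eq,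
        List.map_cons, List.map_nil, sem_code] at h ⊢
      obtain ⟨h1, h2, h3⟩ := h
      have h3 : ρ 4 = Nat.pair (ρ 2) (ρ 3) := h3
      rw [h3]
      simp only [Code.eval, Seq.seq, Part.map_eq_map, Part.mem_bind_iff,
        Part.mem_map_iff]
      exact ⟨_, ⟨_, h1, rfl⟩, _, h2, rfl⟩
    · exact hf r hr
    · exact hg r hr
  | comp f g hf hg =>
    intro r hr
    simp only [codeRules, List.mem_cons, List.mem_append] at hr
    rcases hr with rfl | hr | hr
    · intro ρ h
      simp only [List.mem_cons, List.not_mem_nil, or_false, forall_eq_or_imp, forall_eq,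
        List.map_cons, List.map_nil, sem_code] at h ⊢
      exact Part.mem_bind h.1 h.2
    · exact hf r hr
    · exact hg r hr
  | prec f g hf hg =>
    intro r hr
    simp only [codeRules, List.mem_cons, List.mem_append] at hr
    rcases hr with rfl | rfl | hr | hr
    · intro ρ h
      simp only [List.mem_cons, List.not_mem_nil, or_false, forall_eq_or_imp, forall_eq,
        List.map_cons, List.map_nil, sem_code] at h ⊢
      obtain ⟨h1, h2, h3⟩ := h
      have h2 : ρ 3 = 0 := h2
      have h3 : ρ 4 = Nat.pair (ρ 1) (ρ 3) := h3
      rwa [h3, h2, Code.eval_prec_zero]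
    · intro ρ h
      simp only [List.mem_cons, List.not_mem_nil, or_false, forall_eq_or_imp, forall_eq,
        List.map_cons, List.map_nil, sem_code] at h ⊢
      obtain ⟨h1, h2, h3, h4, h5, h6, h7⟩ := h
      have h1 : ρ 3 = Nat.pair (ρ 1) (ρ 2) := h1
      have h3 : ρ 5 = ρ 2 + 1 := h3
      have h4 : ρ 6 = Nat.pair (ρ 2) (ρ 4) := h4
      have h5 : ρ 7 = Nat.pair (ρ 1) (ρ 6) := h5
      have h7 : ρ 9 = Nat.pair (ρ 1) (ρ 5) := h7
      rw [h7, h3]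
      rw [h5, h4] at h6
      rw [h1] at h2
      rw [Code.eval_prec_succ]
      exact Part.mem_bind h2 h6
    · exact hf r hr
    · exact hg r hr
  | rfind' f hf =>
    intro r hr
    simp only [codeRules, List.mem_cons] at hr
    rcases hr with rfl | rfl | hr
    · intro ρ h
      simp only [List.mem_cons, List.not_mem_nil, or_false, forall_eq_or_imp, forall_eq,
        List.map_cons, List.map_nil, sem_code] at h ⊢
      obtain ⟨h1, h2, h3⟩ := h
      have h2 : ρ 2 = 0 := h2
      have h3 : ρ 1 = Nat.pair (ρ 3) (ρ 4) := h3
      rw [h3, mem_eval_rfind']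
      rw [h3, h2] at h1
      exact ⟨0, by simp, by simpa using h1, by simp⟩
    · intro ρ h
      simp only [List.mem_cons, List.not_mem_nil, or_false, forall_eq_or_imp, forall_eq,
        List.map_cons, List.map_nil, sem_code] at h ⊢
      obtain ⟨h1, h2, h3, h4, h5, h6⟩ := h
      have h2 : ρ 2 = ρ 3 + 1 := h2
      have h3 : ρ 1 = Nat.pair (ρ 4) (ρ 5) := h3
      have h4 : ρ 6 = ρ 5 + 1 := h4
      have h5 : ρ 7 = Nat.pair (ρ 4) (ρ 6) := h5
      rw [h5, h4, mem_eval_rfind'] at h6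
      rw [h3] at h1
      rw [h3, mem_eval_rfind']
      obtain ⟨n, hn, h0, hk⟩ := h6
      refine ⟨n + 1, by omega, by rwa [show n + 1 + ρ 5 = n + (ρ 5 + 1) by omega], ?_⟩
      rintro (_ | k) hk'
      · exact ⟨ρ 2, by omega, by rwa [zero_add]⟩
      · rw [show k + 1 + ρ 5 = k + (ρ 5 + 1) by omega]
        exact hk k (by omega)
    · exact hf r hr

theorem sound_localRules {c : Code} {a : ℕ} {Q : ℕ → Prop} :
    ∀ r ∈ localRules c a, Sound (sem c a Q) r := by
  intro r hr
  simp only [localRules, List.mem_cons, List.mem_append] at hr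
  rcases hr with rfl | rfl | hr | hr
  · intro ρ h
    simp only [inputRule, List.mem_cons, List.mem_map, List.mem_range, forall_eq_or_imp,
      forall_exists_index, and_imp, forall_apply_eq_imp_iff₂] at h
    have h0 : ρ 1 = 0 := h.1
    have h1 : ∀ i < a, ρ (i + 2) = ρ (i + 1) + 1 := h.2
    change ρ (a + 1) = a
    have : ∀ i ≤ a, ρ (i + 1) = i := by
      intro i
      induction i with
      | zero => intro _; exact h0
      | succ i ih => intro hi; rw [h1 i (by omega), ih (by omega)]
    exact this a le_rfl
  · intro ρ h
    simp only [acceptRule, List.mem_cons, List.not_mem_nil, or_false, forall_eq_or_imp, forall_eq,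
      List.map_cons, List.map_nil, sem_code] at h ⊢
    obtain ⟨h1, h2, h3, h4, h5, h6⟩ := h
    have h2 : ρ 3 = Nat.pair (ρ 1) (ρ 2) := h2
    have h3 : ρ 4 = a := h3
    have h4 : ρ 5 = Nat.pair (ρ 4) (ρ 3) := h4
    have h6 : ρ 6 = 0 := h6
    rw [h4, h3, h2, h6] at h5
    exact ⟨_, h1, h5⟩
  · exact sound_arithRules r hr
  · exact sound_codeRules c r hr

end ChaseTermination

namespace ChaseTermination

open Nat.Partrec (Code)

/-! ### Elementary moves of the chase -/

theorem loaded_mkRule {b h : List VAtom} {σ : ℕ → GroundTerm} {F : Set Fact} :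
    loaded (mkRule b h, σ) F ↔ ∀ x ∈ b, x.inst σ ∈ F := by
  simp only [loaded, mkRule, List.forall_mem_map, applyA_toAtom]

theorem bodyVar_mkRule {b h : List VAtom} {v : ℕ} :
    bodyVar (mkRule b h) v ↔ ∃ x ∈ b, v ∈ x.2 := by
  simp [bodyVar, mkRule, atomHasVar, VAtom.toAtom]

theorem existVar_mkRule {b h : List VAtom} {v : ℕ} :
    existVar (mkRule b h) v ↔ (∃ x ∈ h, v ∈ x.2) ∧ ¬ ∃ x ∈ b, v ∈ x.2 := by
  simp [existVar, bodyVar_mkRule]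
  simp [mkRule, atomHasVar, VAtom.toAtom]

theorem outputOf_mkRule {b h : List VAtom} {σ σ' : ℕ → GroundTerm} :
    outputOf (mkRule b h, σ) σ' = {f | f ∈ h.map (VAtom.inst σ')} := by
  ext f
  simp [outputOf, mkRule, applyA_toAtom, eq_comm, -Prod.exists]

theorem obsolete_mkRule {b h : List VAtom} {σ : ℕ → GroundTerm} {F : Set Fact} :
    obsolete (mkRule b h, σ) F ↔
      ∃ σ', (∀ v, (∃ x ∈ b, v ∈ x.2) → σ' v = σ v) ∧ ∀ x ∈ h, x.inst σ' ∈ F := by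
  simp only [obsolete, agreesOnBody, bodyVar_mkRule]
  simp [mkRule, applyA_toAtom, -Prod.forall, -Prod.exists]

theorem inst_congr {σ τ : ℕ → GroundTerm} {x : VAtom} (h : ∀ v ∈ x.2, σ v = τ v) :
    x.inst σ = x.inst τ :=
  Prod.ext rfl (List.map_congr_left h)

theorem inst_lift (σ : ℕ → GroundTerm) (x : VAtom) : x.lift.inst σ = (x.1, σ 0 :: x.2.map σ) := rfl

/-- Every head variable of a Datalog rule occurs in its body. -/
def DRule.Safe (r : DRule) : Prop := ∀ v ∈ r.2.2, ∃ x ∈ r.1, v ∈ x.2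

theorem DRule.Safe.lift {r : DRule} (h : r.Safe) (hne : r.1 ≠ []) : r.lift.Safe := by
  intro v hv
  simp only [DRule.lift, VAtom.lift, List.mem_cons] at hv
  rcases hv with rfl | hv
  · obtain ⟨x, hx⟩ := List.exists_mem_of_ne_nil _ hne
    exact ⟨x.lift, List.mem_map_of_mem hx, by simp [VAtom.lift]⟩
  · obtain ⟨x, hx, hv⟩ := h v hv
    exact ⟨x.lift, List.mem_map_of_mem hx, by simp [VAtom.lift, hv]⟩

theorem codeRules_prop (c : Code) : ∀ r ∈ codeRules c, r.1 ≠ [] ∧ r.Safe ∧ 9 ≤ r.2.1 := by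
  induction c with
  | zero => simp [codeRules, DRule.Safe, -Prod.exists]
  | succ => simp [codeRules, DRule.Safe, -Prod.exists]
  | left => simp [codeRules, DRule.Safe, -Prod.exists]
  | right => simp [codeRules, DRule.Safe, -Prod.exists]
  | pair f g hf hg =>
    simp only [codeRules, List.mem_cons, List.mem_append]
    rintro r (rfl | h | h)
    · simp [DRule.Safe, -Prod.exists]
    · exact hf r h
    · exact hg r h
  | comp f g hf hg =>
    simp only [codeRules, List.mem_cons, List.mem_append]
    rintro r (rfl | h | h)
    · simp [DRule.Safe, -Prod.exists]
    · exact hf r h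
    · exact hg r h
  | prec f g hf hg =>
    simp only [codeRules, List.mem_cons, List.mem_append]
    rintro r (rfl | rfl | h | h)
    · simp [DRule.Safe, -Prod.exists]
    · simp [DRule.Safe, -Prod.exists]
    · exact hf r h
    · exact hg r h
  | rfind' f hf =>
    simp only [codeRules, List.mem_cons]
    rintro r (rfl | rfl | h)
    · simp [DRule.Safe, -Prod.exists]
    · simp [DRule.Safe, -Prod.exists]
    · exact hf r h

theorem localRules_prop (c : Code) (a : ℕ) :
    ∀ r ∈ localRules c a, r.1 ≠ [] ∧ r.Safe ∧ 9 ≤ r.2.1 := by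
  simp only [localRules, List.mem_cons, List.mem_append]
  rintro r (rfl | rfl | h | h)
  · refine ⟨by simp [inputRule], ?_, by simp [inputRule]⟩
    rcases a with _ | a
    · simp [DRule.Safe, inputRule]
    · intro v hv
      simp only [inputRule, List.mem_singleton] at hv
      refine ⟨(prS, [a + 1, a + 2]), List.mem_cons_of_mem _ (List.mem_map.2 ⟨a, by simp, rfl⟩), ?_⟩
      simp [hv]
  · simp [acceptRule, DRule.Safe, prGd, -Prod.exists]
  · have : ∀ r ∈ arithRules, r.1 ≠ [] ∧ r.Safe ∧ 9 ≤ r.2.1 := by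
      simp [arithRules, DRule.Safe, prLt, prPair, -Prod.exists]
    exact this r h
  · exact codeRules_prop c r h

theorem datalogRules_prop {c : Code} {a : ℕ} {d : DRule} (hd : d ∈ datalogRules c a) :
    d.Safe ∧ 5 ≤ d.2.1 := by
  simp only [datalogRules, List.mem_append, List.mem_map] at hd
  rcases hd with ⟨r, hr, rfl⟩ | hd
  · obtain ⟨h1, h2, h3⟩ := localRules_prop c a r hr
    refine ⟨h2.lift h1, ?_⟩
    change 5 ≤ r.2.1
    omega
  · have : ∀ r ∈ linkRules, r.Safe ∧ 5 ≤ r.2.1 := by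
      simp [linkRules, DRule.Safe, prS, prZ, prCp, prPrev, -Prod.exists]
    exact this d hd

/-- The four facts that brake the level `w`. -/
def brakeFacts (w : GroundTerm) : List Fact :=
  [(prZr, [w, w]), (prRe, [w, w]), (prSu, [w, w, w]), (prNx, [w, w, w, w])]

def Braked (F : Set Fact) (w : GroundTerm) : Prop := ∀ f ∈ brakeFacts w, f ∈ F

theorem Braked.mono {F G : Set Fact} {w : GroundTerm} (h : F ⊆ G) (hw : Braked F w) : Braked G w :=
  fun f hf => h (hw f hf)

/-- The facts needed to extend the number line of `w` after `x`. -/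
def guessFacts (w x : GroundTerm) : List Fact :=
  [(prLv, [w]), (prRe, [w, x]), (prSu, [w, x, w]), (prNx, [w, x, w, w])]

/-- The moves available to the chase. -/
inductive Move : Type
  | guess (w x y : GroundTerm)
  | level (w x u z : GroundTerm)
  | brake (w : GroundTerm)
  | datalog (d : DRule) (σ : ℕ → GroundTerm)

def IsNull (t : GroundTerm) : Prop := ∃ n, t = Sum.inr n

/-- A fresh null. -/
def Fresh (F : Set Fact) (t : GroundTerm) : Prop := IsNull t ∧ t ∉ termsOf F

def Move.Valid (c : Code) (a : ℕ) (F : Set Fact) : Move → Prop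
  | .guess w x y => (∀ f ∈ guessFacts w x, f ∈ F) ∧ ¬ Braked F w ∧ Fresh F y
  | .level w x u z => (prGd, [w, x]) ∈ F ∧ (∀ f ∈ guessFacts w x, f ∈ F) ∧ ¬ Braked F w ∧
      Fresh F u ∧ Fresh F z ∧ u ≠ z
  | .brake w => (prLv, [w]) ∈ F
  | .datalog d σ => d ∈ datalogRules c a ∧ ∀ x ∈ d.1, x.inst σ ∈ F

/-- The facts added by a move. -/
def Move.out : Move → List Fact
  | .guess w x y => [(prSu, [w, x, y]), (prRe, [w, y]), (prSu, [w, y, w]), (prNx, [w, y, w, w])]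
  | .level w x u z => [(prNx, [w, x, u, z]), (prLv, [u]), (prZr, [u, z]), (prRe, [u, z]),
      (prSu, [u, z, u]), (prNx, [u, z, u, u])]
  | .brake w => brakeFacts w
  | .datalog d σ => [d.2.inst σ]

theorem obsolete_guessRule {σ : ℕ → GroundTerm} {F : Set Fact} (hl : ∀ x ∈ guessBody, x.inst σ ∈ F)
    (hb : Braked F (σ 0)) : obsolete (guessRule, σ) F := by
  refine obsolete_mkRule.2 ⟨fun v => if v = 2 then σ 0 else σ v, ?_, ?_⟩
  · intro v hv
    simp [guessBody] at hv
    exact if_neg (by omega)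
  · simp [guessBody, VAtom.inst] at hl
    simp [Braked, brakeFacts] at hb
    simp [guessHead, VAtom.inst, hb, hl]

theorem obsolete_levelRule {σ : ℕ → GroundTerm} {F : Set Fact} (hl : ∀ x ∈ guessBody, x.inst σ ∈ F)
    (hb : Braked F (σ 0)) : obsolete (levelRule, σ) F := by
  refine obsolete_mkRule.2 ⟨fun v => if v = 2 then σ 0 else if v = 3 then σ 0 else σ v, ?_, ?_⟩
  · intro v hv
    simp [guessBody] at hv
    exact (if_neg (by omega)).trans (if_neg (by omega))
  · simp [guessBody, VAtom.inst] at hl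
    simp [Braked, brakeFacts] at hb
    simp [levelHead, VAtom.inst, hb, hl]

theorem fresh_of_properExt {t : Trigger} {F : Set Fact} {σ' : ℕ → GroundTerm}
    (h : properExt t F σ') {v : ℕ} (hv : existVar t.1 v) : Fresh F (σ' v) := by
  obtain ⟨n, hn, h'⟩ := h.2.1 v hv
  exact ⟨⟨n, hn⟩, hn ▸ h'⟩

/-- Every restricted chase step over the rule set of the reduction is a valid move. -/
theorem exists_move {c : Code} {a : ℕ} {F : Set Fact} {t : Trigger} {σ' : ℕ → GroundTerm}
    (ht : Active (reductionRules c a) F t) (hσ : properExt t F σ') :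
    ∃ m : Move, m.Valid c a F ∧ F ∪ outputOf t σ' = F ∪ {f | f ∈ m.out} := by
  obtain ⟨r, σ⟩ := t
  obtain ⟨hr, hl, hob⟩ := ht
  simp only [reductionRules, List.mem_cons, List.mem_map] at hr
  rcases hr with rfl | rfl | rfl | ⟨d, hd, rfl⟩
  · have h0 : σ' 0 = σ 0 := hσ.1 0 (bodyVar_mkRule.2 (by simp [guessBody]))
    have h1 : σ' 1 = σ 1 := hσ.1 1 (bodyVar_mkRule.2 (by simp [guessBody]))
    rw [guessRule, loaded_mkRule] at hl
    refine ⟨.guess (σ 0) (σ 1) (σ' 2), ⟨?_, fun hb => hob (obsolete_guessRule hl hb),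
      fresh_of_properExt hσ (existVar_mkRule.2 (by simp [guessBody, guessHead]))⟩, ?_⟩
    · simpa [guessBody, guessFacts, VAtom.inst] using hl
    · rw [guessRule, outputOf_mkRule]
      simp [guessHead, VAtom.inst, Move.out, h0, h1]
  · have h0 : σ' 0 = σ 0 := hσ.1 0 (bodyVar_mkRule.2 (by simp [guessBody]))
    have h1 : σ' 1 = σ 1 := hσ.1 1 (bodyVar_mkRule.2 (by simp [guessBody]))
    have e2 : existVar levelRule 2 := existVar_mkRule.2 (by simp [guessBody, levelHead])
    have e3 : existVar levelRule 3 := existVar_mkRule.2 (by simp [guessBody, levelHead])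
    rw [levelRule, loaded_mkRule, List.forall_mem_cons] at hl
    refine ⟨.level (σ 0) (σ 1) (σ' 2) (σ' 3), ⟨hl.1, ?_, fun hb => hob (obsolete_levelRule hl.2 hb),
      fresh_of_properExt hσ e2, fresh_of_properExt hσ e3,
      fun h => absurd (hσ.2.2 2 3 e2 e3 h) (by simp)⟩, ?_⟩
    · simpa [guessBody, guessFacts, VAtom.inst] using hl.2
    · rw [levelRule, outputOf_mkRule]
      simp [levelHead, VAtom.inst, Move.out, h0, h1]
  · have h0 : σ' 0 = σ 0 := hσ.1 0 (bodyVar_mkRule.2 (by simp))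
    rw [brakeRule, loaded_mkRule] at hl
    refine ⟨.brake (σ 0), by simpa [Move.Valid, VAtom.inst] using hl, ?_⟩
    rw [brakeRule, outputOf_mkRule]
    simp [brakeHead, VAtom.inst, Move.out, h0, brakeFacts]
  · rw [DRule.toRule, loaded_mkRule] at hl
    refine ⟨.datalog d σ, ⟨hd, hl⟩, ?_⟩
    rw [DRule.toRule, outputOf_mkRule]
    have : d.2.inst σ' = d.2.inst σ := inst_congr fun v hv =>
      hσ.1 v (bodyVar_mkRule.2 ((datalogRules_prop hd).1 v hv))
    simp [Move.out, this]

/-! ### The invariants -/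

/-- The core facts have the expected shape on levels that are nulls, and the derived facts have
the intended meaning on such levels unless they are braked. -/
structure Inv (c : Code) (a : ℕ) (val : GroundTerm → ℕ) (par num : GroundTerm → GroundTerm)
    (F : Set Fact) : Prop where
  re : ∀ w, IsNull w → (prRe, [w, w]) ∈ F → Braked F w
  su : ∀ w x y, IsNull w → (prSu, [w, x, y]) ∈ F → y = w ∨ (x ≠ w ∧ val y = val x + 1)
  zr : ∀ w x, IsNull w → (prZr, [w, x]) ∈ F → x = w ∨ val x = 0
  nx : ∀ w x u z, IsNull u → (prNx, [w, x, u, z]) ∈ F →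
    (u = w ∧ z = w) ∨ (par u = w ∧ num u = x ∧ (IsNull w → x ≠ w))
  cp : ∀ u x y, IsNull u → IsNull (par u) → (prCp, [u, x, y]) ∈ F →
    Braked F u ∨ x = par u ∨ val x = val y
  sem : ∀ p w l, IsNull w → (p, w :: l) ∈ F →
    Braked F w ∨ sem c a (fun m => IsNull (par w) → m = val (num w)) p (l.map val)

/-- The functions `val`, `par`, `num` assign the expected values to the nulls created by a move. -/
def Move.Compat (val : GroundTerm → ℕ) (par num : GroundTerm → GroundTerm) : Move → Prop
  | .guess _ x y => val y = val x + 1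
  | .level w x u z => par u = w ∧ num u = x ∧ val z = 0
  | _ => True

theorem sem_core {c : Code} {a : ℕ} {Q : ℕ → Prop} {p : ℕ} (hp : p < 5) (l : List ℕ) :
    sem c a Q p l := by
  interval_cases p <;> simp [ChaseTermination.sem]

variable {c : Code} {a : ℕ} {val : GroundTerm → ℕ} {par num : GroundTerm → GroundTerm}
  {F : Set Fact}

theorem Inv.ne_of_re (h : Inv c a val par num F) {w x : GroundTerm} (hw : IsNull w)
    (hb : ¬ Braked F w) (hx : (prRe, [w, x]) ∈ F) : x ≠ w := by
  rintro rfl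
  exact hb (h.re x hw hx)

/-- The invariants are preserved by adding facts that satisfy them. -/
theorem Inv.union (h : Inv c a val par num F) {G : Set Fact}
    (re : ∀ w, IsNull w → (prRe, [w, w]) ∈ G → Braked (F ∪ G) w)
    (su : ∀ w x y, IsNull w → (prSu, [w, x, y]) ∈ G → y = w ∨ (x ≠ w ∧ val y = val x + 1))
    (zr : ∀ w x, IsNull w → (prZr, [w, x]) ∈ G → x = w ∨ val x = 0)
    (nx : ∀ w x u z, IsNull u → (prNx, [w, x, u, z]) ∈ G →
      (u = w ∧ z = w) ∨ (par u = w ∧ num u = x ∧ (IsNull w → x ≠ w)))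
    (cp : ∀ u x y, IsNull u → IsNull (par u) → (prCp, [u, x, y]) ∈ G →
      Braked F u ∨ x = par u ∨ val x = val y)
    (sm : ∀ p w l, IsNull w → (p, w :: l) ∈ G →
      Braked F w ∨ ChaseTermination.sem c a (fun m => IsNull (par w) → m = val (num w)) p
        (l.map val)) :
    Inv c a val par num (F ∪ G) := by
  have hsub : F ⊆ F ∪ G := Set.subset_union_left
  refine ⟨fun w hw hf => ?_, fun w x y hw hf => ?_, fun w x hw hf => ?_, fun w x u z hu hf => ?_,
    fun u x y hu hp hf => ?_, fun p w l hw hf => ?_⟩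
  · exact hf.elim (fun hf => (h.re w hw hf).mono hsub) (re w hw)
  · exact hf.elim (h.su w x y hw) (su w x y hw)
  · exact hf.elim (h.zr w x hw) (zr w x hw)
  · exact hf.elim (h.nx w x u z hu) (nx w x u z hu)
  · exact (hf.elim (h.cp u x y hu hp) (cp u x y hu hp)).imp_left (Braked.mono hsub)
  · exact (hf.elim (h.sem p w l hw) (sm p w l hw)).imp_left (Braked.mono hsub)

theorem mem_termsOf {f : Fact} (hf : f ∈ F) {t : GroundTerm} (ht : t ∈ f.2) : t ∈ termsOf F :=
  ⟨f, hf, ht⟩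

theorem Inv.move (h : Inv c a val par num F) {m : Move} (hm : m.Valid c a F)
    (hv : m.Compat val par num) : Inv c a val par num (F ∪ {f | f ∈ m.out}) := by
  cases m with
  | guess w x y =>
    obtain ⟨hl, hb, hy⟩ := hm
    simp only [guessFacts, List.forall_mem_cons, List.not_mem_nil, false_imp_iff,
      implies_true, and_true] at hl
    change val y = val x + 1 at hv
    have hyw : w ≠ y := fun e => hy.2 (e ▸ mem_termsOf hl.1 (by simp))
    refine h.union ?_ ?_ ?_ ?_ ?_ ?_ <;> simp only [Move.out, Set.mem_ofPred_eq, List.mem_cons,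
      List.not_mem_nil, or_false, Prod.mk.injEq, List.cons.injEq, and_true]
    · rintro w' - (h' | h' | h' | h')
      · simp at h'
      · exact absurd (h'.2.1.symm.trans h'.2.2) hyw
      · simp at h'
      · simp at h'
    · rintro w' x' y' hw' (h' | h' | h' | h')
      · obtain ⟨-, rfl, rfl, rfl⟩ := h'
        exact Or.inr ⟨h.ne_of_re hw' hb hl.2.1, hv⟩
      · simp at h'
      · exact Or.inl (h'.2.2.2.trans h'.2.1.symm)
      · simp at h'
    · simp
    · rintro w' x' u z - (h' | h' | h' | h')
      · simp at h'
      · simp at h'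
      · simp at h'
      · obtain ⟨-, rfl, rfl, rfl, rfl⟩ := h'
        simp
    · simp
    · rintro p w' l - h'
      exact Or.inr (sem_core (by simp only [prSu, prRe, prNx] at h'; omega) _)
  | level w x u z =>
    obtain ⟨-, hl, hb, hu, hz, huz⟩ := hm
    simp only [guessFacts, List.forall_mem_cons, List.not_mem_nil, false_imp_iff,
      implies_true, and_true] at hl
    obtain ⟨hv1, hv2, hv3⟩ := hv
    refine h.union ?_ ?_ ?_ ?_ ?_ ?_ <;> simp only [Move.out, Set.mem_ofPred_eq, List.mem_cons,
      List.not_mem_nil, or_false, Prod.mk.injEq, List.cons.injEq, and_true]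
    · rintro w' - (h' | h' | h' | h' | h' | h')
      · simp at h'
      · simp at h'
      · simp at h'
      · exact absurd (h'.2.1.symm.trans h'.2.2) huz
      · simp at h'
      · simp at h'
    · rintro w' x' y' hw' (h' | h' | h' | h' | h' | h')
      · simp at h'
      · simp at h'
      · simp at h'
      · simp at h'
      · exact Or.inl (h'.2.2.2.trans h'.2.1.symm)
      · simp at h'
    · rintro w' x' hw' (h' | h' | h' | h' | h' | h')
      · simp at h'
      · simp at h'
      · exact Or.inr (h'.2.2 ▸ hv3)
      · simp at h'
      · simp at h'
      · simp at h'
    · rintro w' x' u' z' - (h' | h' | h' | h' | h' | h')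
      · obtain ⟨-, rfl, rfl, rfl, rfl⟩ := h'
        exact Or.inr ⟨hv1, hv2, fun hw => h.ne_of_re hw hb hl.2.1⟩
      · simp at h'
      · simp at h'
      · simp at h'
      · simp at h'
      · obtain ⟨-, rfl, rfl, rfl, rfl⟩ := h'
        simp
    · simp
    · rintro p w' l - h'
      exact Or.inr (sem_core (by simp only [prSu, prRe, prNx, prLv, prZr] at h'; omega) _)
  | brake w =>
    refine h.union ?_ ?_ ?_ ?_ ?_ ?_ <;> simp only [Move.out, Set.mem_ofPred_eq, brakeFacts,
      List.mem_cons, List.not_mem_nil, or_false, Prod.mk.injEq, List.cons.injEq, and_true]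
    · rintro w' - (h' | h' | h' | h')
      · simp at h'
      · intro f hf
        rw [← h'.2.1]
        exact Or.inr (by simpa [brakeFacts, h'.2.1] using hf)
      · simp at h'
      · simp at h'
    · rintro w' x' y' hw' (h' | h' | h' | h')
      · simp at h'
      · simp at h'
      · exact Or.inl (h'.2.2.2.trans h'.2.1.symm)
      · simp at h'
    · rintro w' x' hw' (h' | h' | h' | h')
      · exact Or.inl (h'.2.2.trans h'.2.1.symm)
      · simp at h'
      · simp at h'
      · simp at h'
    · rintro w' x' u z - (h' | h' | h' | h')
      · simp at h'
      · simp at h'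
      · simp at h'
      · obtain ⟨-, rfl, rfl, rfl, rfl⟩ := h'
        simp
    · simp
    · rintro p w' l - h'
      exact Or.inr (sem_core (by simp only [prSu, prRe, prNx, prZr] at h'; omega) _)
  | datalog d σ =>
    obtain ⟨hd, hl⟩ := hm
    have hp := (datalogRules_prop hd).2
    have hne : ∀ p l, (p, l) ∈ {f | f ∈ (Move.datalog d σ).out} → p = d.2.1 ∧ l = d.2.2.map σ := by
      intro p l hf
      simpa [Move.out, VAtom.inst] using hf
    simp only [datalogRules, List.mem_append, List.mem_map] at hd
    refine h.union (fun w _ hf => ?_) (fun w x y _ hf => ?_) (fun w x _ hf => ?_)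
      (fun w x u z _ hf => ?_) (fun u x y hu hpu hf => ?_) (fun p w l hw hf => ?_)
    · have : (2 : ℕ) = d.2.1 := (hne _ _ hf).1
      omega
    · have : (3 : ℕ) = d.2.1 := (hne _ _ hf).1
      omega
    · have : (1 : ℕ) = d.2.1 := (hne _ _ hf).1
      omega
    · have : (4 : ℕ) = d.2.1 := (hne _ _ hf).1
      omega
    · obtain ⟨h1, h2⟩ := hne _ _ hf
      rcases hd with ⟨r, hr, rfl⟩ | hd
      · have := (localRules_prop c a r hr).2.2
        change 7 = r.2.1 at h1
        omega
      · by_cases hb : Braked F u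
        · exact Or.inl hb
        refine Or.inr ?_
        simp only [linkRules, List.mem_cons, List.not_mem_nil, or_false] at hd
        rcases hd with rfl | rfl | rfl | rfl | rfl
        · simp at h1
        · simp at h1
        · simp [VAtom.inst] at hl h2
          obtain ⟨rfl, rfl, rfl⟩ := h2
          obtain ⟨l1, l2, l3, l4⟩ := hl
          have hp1 : par (σ 2) = σ 0 := by
            rcases h.nx _ _ _ _ hu l1 with ⟨e1, e2⟩ | e
            · exact absurd (e2.trans e1.symm) (h.ne_of_re hu hb l2)
            · exact e.1
          have hy : val (σ 5) = 0 := (h.sem _ _ _ hu l4).resolve_left hb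
          rcases h.zr _ _ (hp1 ▸ hpu) l3 with e | e
          · exact Or.inl (e.trans hp1.symm)
          · exact Or.inr (e.trans hy.symm)
        · simp [VAtom.inst] at hl h2
          obtain ⟨rfl, rfl, rfl⟩ := h2
          obtain ⟨l1, l2, l3, l4, l5⟩ := hl
          have hp1 : par (σ 2) = σ 0 := by
            rcases h.nx _ _ _ _ hu l1 with ⟨e1, e2⟩ | e
            · exact absurd (e2.trans e1.symm) (h.ne_of_re hu hb l2)
            · exact e.1
          have hy : val (σ 7) = val (σ 5) + 1 := (h.sem _ _ _ hu l5).resolve_left hb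
          rcases h.su _ _ _ (hp1 ▸ hpu) l4 with e | ⟨e1, e2⟩
          · exact Or.inl (e.trans hp1.symm)
          · have := ((h.cp _ _ _ hu hpu l3).resolve_left hb).resolve_left
              (fun e => e1 (e.trans hp1))
            exact Or.inr (by omega)
        · simp at h1
    · by_cases hb : Braked F w
      · exact Or.inl hb
      refine Or.inr ?_
      obtain ⟨h1, h2⟩ := hne _ _ hf
      rcases hd with ⟨r, hr, rfl⟩ | hd
      · change p = r.2.1 at h1
        change w :: l = σ 0 :: r.2.2.map σ at h2
        obtain ⟨rfl, rfl⟩ := List.cons.inj h2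
        subst h1
        rw [List.map_map]
        refine sound_localRules r hr (val ∘ σ) fun b hb' => ?_
        have := hl b.lift (List.mem_map_of_mem hb')
        rw [inst_lift] at this
        rw [← List.map_map]
        exact (h.sem _ _ _ hw this).resolve_left hb
      · simp only [linkRules, List.mem_cons, List.not_mem_nil, or_false] at hd
        rcases hd with rfl | rfl | rfl | rfl | rfl
        · simp [VAtom.inst] at hl h2 h1
          obtain ⟨rfl, rfl⟩ := h2
          subst h1
          exact ((h.su _ _ _ hw hl.1).resolve_left (h.ne_of_re hw hb hl.2)).2
        · simp [VAtom.inst] at hl h2 h1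
          obtain ⟨rfl, rfl⟩ := h2
          subst h1
          exact (h.zr _ _ hw hl.1).resolve_left (h.ne_of_re hw hb hl.2)
        · subst h1; simp [ChaseTermination.sem]
        · subst h1; simp [ChaseTermination.sem]
        · simp [VAtom.inst] at hl h2 h1
          obtain ⟨rfl, rfl⟩ := h2
          subst h1
          obtain ⟨l1, l2, l3⟩ := hl
          intro hpn
          rcases h.nx _ _ _ _ hw l1 with ⟨e1, e2⟩ | ⟨e1, e2, e3⟩
          · exact absurd (e2.trans e1.symm) (h.ne_of_re hw hb l2)
          · rcases (h.cp _ _ _ hw hpn l3).resolve_left hb with e | e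
            · exact absurd (e.trans e1) (e3 (e1 ▸ hpn))
            · rw [e2, e]

end ChaseTermination

namespace ChaseTermination

open Nat.Partrec (Code)

/-! ### Termination -/

/-- Extend the assignment of values, parents and numbers to the nulls created by a move. -/
def Move.update (V : GroundTerm → ℕ × GroundTerm × GroundTerm) :
    Move → GroundTerm → ℕ × GroundTerm × GroundTerm
  | .guess _ x y => Function.update V y ((V x).1 + 1, x, x)
  | .level w x u z => Function.update (Function.update V u (0, w, x)) z (0, w, x)
  | _ => V

theorem Move.update_of_mem {c : Code} {a : ℕ} {F : Set Fact} {m : Move} (hm : m.Valid c a F)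
    (V : GroundTerm → ℕ × GroundTerm × GroundTerm) {t : GroundTerm} (ht : t ∈ termsOf F) :
    m.update V t = V t := by
  cases m with
  | guess w x y =>
    exact Function.update_of_ne (fun e : t = y => hm.2.2.2 (e ▸ ht)) _ _
  | level w x u z =>
    obtain ⟨-, -, -, hu, hz, -⟩ := hm
    exact (Function.update_of_ne (fun e : t = z => hz.2 (e ▸ ht)) _ _).trans
      (Function.update_of_ne (fun e : t = u => hu.2 (e ▸ ht)) _ _)
  | brake w => rfl
  | datalog d σ => rfl

theorem termsOf_mono {F G : Set Fact} (h : F ⊆ G) : termsOf F ⊆ termsOf G :=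
  fun _ ⟨f, hf, ht⟩ => ⟨f, h hf, ht⟩

theorem termsOf_finite {F : Set Fact} (h : F.Finite) : (termsOf F).Finite := by
  refine (h.biUnion fun f _ => f.2.finite_toSet).subset ?_
  rintro t ⟨f, hf, ht⟩
  exact Set.mem_biUnion hf ht

/-- An infinite sequence of moves. -/
structure Moves (c : Code) (a : ℕ) (F : ℕ → Set Fact) (m : ℕ → Move) : Prop where
  valid : ∀ i, (m i).Valid c a (F i)
  succ : ∀ i, F (i + 1) = F i ∪ {f | f ∈ (m i).out}

variable {c : Code} {a : ℕ} {F : ℕ → Set Fact} {m : ℕ → Move}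

theorem Moves.mono (h : Moves c a F m) : Monotone F :=
  monotone_nat_of_le_succ fun i => h.succ i ▸ Set.subset_union_left

theorem Moves.out_mem (h : Moves c a F m) {i : ℕ} {f : Fact} (hf : f ∈ (m i).out) :
    f ∈ F (i + 1) :=
  h.succ i ▸ Or.inr hf

theorem Moves.exists_compat (h : Moves c a F m) :
    ∃ (val : GroundTerm → ℕ) (par num : GroundTerm → GroundTerm),
      ∀ i, (m i).Compat val par num := by
  classical
  let V : ℕ → GroundTerm → ℕ × GroundTerm × GroundTerm := fun i =>
    Nat.rec (fun t => (0, t, t)) (fun i V => (m i).update V) i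
  have hV : ∀ i, V (i + 1) = (m i).update (V i) := fun i => rfl
  have stable : ∀ i t, t ∈ termsOf (F i) → ∀ k, V (i + k) t = V i t := by
    intro i t ht k
    induction k with
    | zero => rfl
    | succ k ih =>
      rw [← add_assoc, hV, Move.update_of_mem (h.valid _) _
        (termsOf_mono (h.mono (Nat.le_add_right i k)) ht), ih]
  have stable' : ∀ i j t, t ∈ termsOf (F i) → t ∈ termsOf (F j) → V i t = V j t := by
    intro i j t hi hj
    rcases le_total i j with hij | hij
    · obtain ⟨k, rfl⟩ := Nat.exists_eq_add_of_le hij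
      exact (stable i t hi k).symm
    · obtain ⟨k, rfl⟩ := Nat.exists_eq_add_of_le hij
      exact stable j t hj k
  let v : GroundTerm → ℕ × GroundTerm × GroundTerm := fun t =>
    if ht : ∃ i, t ∈ termsOf (F i) then V ht.choose t else (0, t, t)
  have hv : ∀ i t, t ∈ termsOf (F i) → v t = V i t := by
    intro i t ht
    have hex : ∃ i, t ∈ termsOf (F i) := ⟨i, ht⟩
    simp only [v, dif_pos hex]
    exact stable' _ _ t hex.choose_spec ht
  refine ⟨fun t => (v t).1, fun t => (v t).2.1, fun t => (v t).2.2, fun i => ?_⟩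
  have hval := h.valid i
  have hout := @Moves.out_mem _ _ _ _ h i
  have hs := hV i
  cases hmi : m i with
  | guess w x y =>
    rw [hmi] at hval hout hs
    have hx : v x = V i x := hv i x ⟨(prRe, [w, x]), hval.1 _ (by simp [guessFacts]), by simp⟩
    have hy : v y = V (i + 1) y := hv _ y ⟨(prRe, [w, y]), hout (by simp [Move.out]), by simp⟩
    simp [Move.Compat, hx, hy, hs, Move.update]
  | level w x u z =>
    rw [hmi] at hval hout hs
    have hu : v u = V (i + 1) u := hv _ u ⟨(prLv, [u]), hout (by simp [Move.out]), by simp⟩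
    have hz : v z = V (i + 1) z := hv _ z ⟨(prZr, [u, z]), hout (by simp [Move.out]), by simp⟩
    simp [Move.Compat, hu, hz, hs, Move.update, Function.update_of_ne hval.2.2.2.2.2]
  | brake w => trivial
  | datalog d σ => trivial

theorem Moves.inv (h : Moves c a F m) {val : GroundTerm → ℕ} {par num : GroundTerm → GroundTerm}
    (hc : ∀ i, (m i).Compat val par num) (h0 : ∀ f ∈ F 0, factNullFree f) (i : ℕ) :
    Inv c a val par num (F i) := by
  induction i with
  | zero =>
    have key : ∀ {w : GroundTerm} {f : Fact}, IsNull w → f ∈ F 0 → w ∈ f.2 → False := by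
      rintro w f ⟨n, hn⟩ hf hw
      exact h0 f hf w hw n hn
    exact ⟨fun w hw hf => (key hw hf (by simp)).elim, fun w x y hw hf => (key hw hf (by simp)).elim,
      fun w x hw hf => (key hw hf (by simp)).elim, fun w x u z hw hf => (key hw hf (by simp)).elim,
      fun u x y hw _ hf => (key hw hf (by simp)).elim,
      fun p w l hw hf => (key hw hf (by simp)).elim⟩
  | succ i ih => rw [h.succ]; exact ih.move (h.valid i) (hc i)

/-- The level `u` is opened from the level `w`. -/
def Child (m : ℕ → Move) (u w : GroundTerm) : Prop := ∃ i x z, m i = .level w x u z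

theorem Moves.wellFounded_child (h : Moves c a F m) (h0 : ∀ f ∈ F 0, factNullFree f)
    (hwf : WellFounded fun n p => 0 ∈ c.eval (Nat.pair a (Nat.pair p n))) :
    WellFounded (Child m) := by
  obtain ⟨val, par, num, hc⟩ := h.exists_compat
  have hinv := h.inv hc h0
  have hch : ∀ u w, Child m u w → IsNull u ∧ par u = w := by
    rintro u w ⟨i, x, z, hi⟩
    have hv := h.valid i
    have hc' := hc i
    rw [hi] at hv hc'
    exact ⟨hv.2.2.2.1.1, hc'.1⟩
  have h2 : ∀ n w, val (num w) = n → IsNull w → IsNull (par w) → Acc (Child m) w := by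
    intro n
    induction n using hwf.induction with
    | _ n ih =>
    rintro w hn hw hpw
    refine ⟨w, fun u hu => ?_⟩
    obtain ⟨hu1, hu2⟩ := hch u w hu
    refine ih (val (num u)) ?_ u rfl hu1 (hu2 ▸ hw)
    obtain ⟨i, x, z, hi⟩ := hu
    have hv := h.valid i
    have hc' := hc i
    rw [hi] at hv hc'
    obtain ⟨p, hp, hpx⟩ : ∃ p, (IsNull (par w) → p = val (num w)) ∧
        0 ∈ c.eval (Nat.pair a (Nat.pair p (val x))) :=
      ((hinv i).sem prGd w [x] hw hv.1).resolve_left hv.2.2.1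
    rw [hc'.2.1, ← hn, ← hp hpw]
    exact hpx
  have h1 : ∀ w, IsNull w → Acc (Child m) w := fun w hw => ⟨w, fun u hu =>
    h2 _ u rfl (hch u w hu).1 ((hch u w hu).2 ▸ hw)⟩
  exact ⟨fun w => ⟨w, fun u hu => h1 u (hch u w hu).1⟩⟩

theorem finite_descendants {α : Type*} {r : α → α → Prop} (hr : WellFounded r)
    (hf : ∀ w, {u | r u w}.Finite) (w : α) : {u | Relation.ReflTransGen r u w}.Finite := by
  induction w using hr.induction with
  | _ w ih =>
  refine ((Set.finite_singleton w).union ((hf w).biUnion fun u hu => ih u hu)).subset ?_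
  intro v hv
  rcases Relation.ReflTransGen.cases_tail hv with rfl | ⟨b, hvb, hb⟩
  · exact Or.inl rfl
  · exact Or.inr (Set.mem_biUnion hb hvb)

theorem finite_lists {α : Type*} {T : Set α} (hT : T.Finite) (n : ℕ) :
    {l : List α | l.length = n ∧ ∀ t ∈ l, t ∈ T}.Finite := by
  induction n with
  | zero => exact (Set.finite_singleton []).subset fun l hl => List.length_eq_zero_iff.1 hl.1
  | succ n ih =>
    refine (Set.Finite.image2 List.cons hT ih).subset ?_
    rintro (_ | ⟨t, l⟩) ⟨hl, ht⟩
    · simp at hl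
    · exact ⟨t, ht t (by simp), l, ⟨by simpa using hl, fun s hs => ht s (by simp [hs])⟩, rfl⟩

/-- The facts over the terms `T` that can be heads of Datalog rules. -/
def datalogFacts (c : Code) (a : ℕ) (T : Set GroundTerm) : Set Fact :=
  {f | ∃ d ∈ datalogRules c a, f.1 = d.2.1 ∧ f.2.length = d.2.2.length ∧ ∀ t ∈ f.2, t ∈ T}

theorem datalogFacts_finite (c : Code) (a : ℕ) {T : Set GroundTerm} (hT : T.Finite) :
    (datalogFacts c a T).Finite := by
  refine ((datalogRules c a).finite_toSet.biUnion fun d _ =>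
    (Set.finite_singleton d.2.1).prod (finite_lists hT d.2.2.length)).subset ?_
  rintro f ⟨d, hd, h1, h2⟩
  exact Set.mem_biUnion hd ⟨h1, h2⟩

theorem inst_mem_datalogFacts {T : Set GroundTerm} {G : Set Fact} (hG : termsOf G ⊆ T) {d : DRule}
    (hd : d ∈ datalogRules c a) {σ : ℕ → GroundTerm} (hl : ∀ x ∈ d.1, x.inst σ ∈ G) :
    d.2.inst σ ∈ datalogFacts c a T := by
  refine ⟨d, hd, rfl, by simp [VAtom.inst], fun t ht => ?_⟩
  obtain ⟨v, hv, rfl⟩ := List.mem_map.1 ht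
  obtain ⟨x, hx, hvx⟩ := (datalogRules_prop hd).1 v hv
  exact hG ⟨_, hl x hx, List.mem_map_of_mem hvx⟩

/-- If every level is eventually braked, then a sequence of moves cannot be strictly increasing. -/
theorem Moves.exists_stationary (h : Moves c a F m) (hfin : (F 0).Finite)
    (h0 : ∀ f ∈ F 0, factNullFree f)
    (hwf : WellFounded fun n p => 0 ∈ c.eval (Nat.pair a (Nat.pair p n)))
    (hbr : ∀ w i, (prLv, [w]) ∈ F i → ∃ j, Braked (F j) w) :
    ∃ i, F (i + 1) = F i := by
  have hch : ∀ w, {u | Child m u w}.Finite := by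
    intro w
    by_cases hw : ∃ i, (prLv, [w]) ∈ F i
    · obtain ⟨i, hi⟩ := hw
      obtain ⟨j, hj⟩ := hbr w i hi
      refine ((Set.finite_lt_nat j).image fun i =>
        match m i with
        | .level _ _ u _ => u
        | _ => w).subset ?_
      rintro u ⟨k, x, z, hk⟩
      refine ⟨k, ?_, by simp [hk]⟩
      by_contra hjk
      have hv := h.valid k
      rw [hk] at hv
      exact hv.2.2.1 (hj.mono (h.mono (not_lt.1 hjk)))
    · refine Set.finite_empty.subset ?_
      rintro u ⟨k, x, z, hk⟩
      have hv := h.valid k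
      rw [hk] at hv
      exact hw ⟨k, hv.2.1 _ (by simp [guessFacts])⟩
  have hdesc := finite_descendants (h.wellFounded_child h0 hwf) hch
  have hL0 : {w | (prLv, [w]) ∈ F 0}.Finite :=
    hfin.preimage (f := fun w => ((prLv, [w]) : Fact)) (fun x _ y _ e => by simpa using e)
  have hL : {w | ∃ i, (prLv, [w]) ∈ F i}.Finite := by
    refine (hL0.biUnion fun w _ => hdesc w).subset ?_
    rintro w ⟨i, hi⟩
    induction i generalizing w with
    | zero => exact Set.mem_biUnion hi Relation.ReflTransGen.refl
    | succ i ih =>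
      rw [h.succ] at hi
      rcases hi with hi | hi
      · exact ih hi
      have hv := h.valid i
      cases hmi : m i with
      | guess w' x y => simp [hmi, Move.out] at hi
      | level w' x u z =>
        rw [hmi] at hv
        simp [hmi, Move.out] at hi
        subst hi
        obtain ⟨d, hd, hdw⟩ := Set.mem_iUnion₂.1 (ih (w := w') (hv.2.1 _ (by simp [guessFacts])))
        exact Set.mem_biUnion hd (Relation.ReflTransGen.head ⟨i, x, z, hmi⟩ hdw)
      | brake w' => simp [hmi, Move.out, brakeFacts] at hi
      | datalog d σ =>
        rw [hmi] at hv
        simp [hmi, Move.out, VAtom.inst] at hi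
        have := (datalogRules_prop hv.1).2
        have h3 : 0 = d.2.1 := hi.1
        omega
  obtain ⟨N, hN⟩ : ∃ N, ∀ w i, (prLv, [w]) ∈ F i → Braked (F N) w := by
    choose! j hj using fun w (hw : ∃ i, (prLv, [w]) ∈ F i) => hbr w hw.choose hw.choose_spec
    obtain ⟨N, hN⟩ := (hL.image j).bddAbove
    exact ⟨N, fun w i hi => (hj w ⟨i, hi⟩).mono (h.mono (hN ⟨w, ⟨i, hi⟩, rfl⟩))⟩
  have hFfin : ∀ i, (F i).Finite := by
    intro i
    induction i with
    | zero => exact hfin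
    | succ i ih => rw [h.succ]; exact ih.union (m i).out.finite_toSet
  set T := termsOf (F N) with hTdef
  have hT : T.Finite := termsOf_finite (hFfin N)
  set B : Set Fact := F N ∪ (datalogFacts c a T ∪ ⋃ w ∈ T, {f | f ∈ brakeFacts w}) with hB
  have hBfin : B.Finite := (hFfin N).union ((datalogFacts_finite c a hT).union
    (hT.biUnion fun w _ => (brakeFacts w).finite_toSet))
  have hBT : termsOf B ⊆ T := by
    rintro t ⟨f, hf | ⟨d, -, -, -, hf⟩ | hf, ht⟩
    · exact ⟨f, hf, ht⟩
    · exact hf t ht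
    · obtain ⟨w, hw, hf⟩ := Set.mem_iUnion₂.1 hf
      have : t = w := by
        simp [brakeFacts] at hf
        rcases hf with rfl | rfl | rfl | rfl <;> simpa using ht
      exact this ▸ hw
  have hsub : ∀ k, F (N + k) ⊆ B := by
    intro k
    induction k with
    | zero => exact Set.subset_union_left
    | succ k ih =>
      rw [← add_assoc, h.succ]
      refine Set.union_subset ih ?_
      have hv := h.valid (N + k)
      have hnb : ∀ w, ¬ Braked (F (N + k)) w → (prLv, [w]) ∉ F (N + k) := fun w hw hl =>
        hw ((hN w _ hl).mono (h.mono (Nat.le_add_right _ _)))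
      cases hmk : m (N + k) with
      | guess w x y =>
        rw [hmk] at hv
        exact (hnb w hv.2.1 (hv.1 _ (by simp [guessFacts]))).elim
      | level w x u z =>
        rw [hmk] at hv
        exact (hnb w hv.2.2.1 (hv.2.1 _ (by simp [guessFacts]))).elim
      | brake w =>
        rw [hmk] at hv
        have hw : w ∈ T := hBT (termsOf_mono ih ⟨_, hv, by simp⟩)
        exact fun f hf => Or.inr (Or.inr (Set.mem_biUnion hw hf))
      | datalog d σ =>
        rw [hmk] at hv
        intro f hf
        rw [List.mem_singleton.1 hf]
        exact Or.inr (Or.inl (inst_mem_datalogFacts ((termsOf_mono ih).trans hBT) hv.1 hv.2))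
  by_contra hne
  push Not at hne
  have hst : StrictMono fun k => F (N + k) := strictMono_nat_of_lt_succ fun k =>
    lt_of_le_of_ne (h.mono (Nat.le_succ _)) (hne (N + k)).symm
  exact Set.infinite_range_of_injective hst.injective
    (hBfin.finite_subsets.subset (Set.range_subset_iff.2 hsub))

theorem Active.union_ne {S : RuleSet} {G : Set Fact} {t : Trigger} {σ' : ℕ → GroundTerm}
    (ht : Active S G t) (hσ : properExt t G σ') : G ∪ outputOf t σ' ≠ G := fun e =>
  ht.2.2 ⟨σ', hσ.1, fun x hx => e ▸ Or.inr ⟨x, hx, rfl⟩⟩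

theorem TRRall_reductionRules
    (hwf : WellFounded fun n p => 0 ∈ c.eval (Nat.pair a (Nat.pair p n))) :
    TRRall (reductionRules c a) := by
  refine ⟨isRuleSet_reductionRules c a, ?_⟩
  rintro D hD ⟨ch, hlen, hfair⟩
  have hlt : ∀ i : ℕ, (i : ℕ∞) < ch.len := fun i => by
    rw [show ch.len = ⊤ from hlen]; exact ENat.natCast_lt_top i
  choose m hm hm' using fun i => exists_move (ch.activeAt i (hlt i)) (ch.extOk i (hlt i))
  have hmoves : Moves c a ch.fact m := ⟨hm, fun i => (ch.succ i (hlt i)).trans (hm' i)⟩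
  obtain ⟨i, hi⟩ := hmoves.exists_stationary (by rw [ch.init]; exact D.finite_toSet)
    (by rw [ch.init]; exact hD) hwf (by
    intro w i hw
    obtain ⟨j, -, hj⟩ := hfair (brakeRule, fun _ => w) (by simp [reductionRules]) i
      (loaded_mkRule.2 (by simpa [VAtom.inst] using hw))
    obtain ⟨σ', hσ', hj⟩ := obsolete_mkRule.1 hj
    have h0 : σ' 0 = w := hσ' 0 (by simp)
    refine ⟨j, ?_⟩
    simpa [brakeHead, VAtom.inst, h0, Braked, brakeFacts] using hj)
  rw [ch.succ i (hlt i)] at hi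
  exact (ch.activeAt i (hlt i)).union_ne (ch.extOk i (hlt i)) hi

end ChaseTermination

namespace ChaseTermination

open Nat.Partrec (Code)
open Filter

/-! ### Completeness of the Datalog rules -/

/-- The relations `I` on numbers are closed under the arithmetical rules, for a number line of
length `N`. -/
structure Arith (N : ℕ) (I : ℕ → List ℕ → Prop) : Prop where
  closed : ∀ r ∈ arithRules, Sound I r
  zero : I prZ [0]
  succ : ∀ i < N, I prS [i, i + 1]
  real : ∀ i ≤ N, I prRe [i]

/-- Apply a sound rule under the valuation listed by `l`. -/
theorem Sound.apply {I : ℕ → List ℕ → Prop} {b : List VAtom} {p : ℕ} {args : List ℕ}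
    (h : Sound I (b, (p, args))) (l : List ℕ)
    (hb : ∀ x ∈ b, I x.1 (x.2.map fun v => l.getD v 0)) : I p (args.map fun v => l.getD v 0) :=
  h _ hb

variable {N : ℕ} {I : ℕ → List ℕ → Prop}

theorem Arith.lt (h : Arith N I) {i j : ℕ} (hij : i < j) (hj : j ≤ N) : I prLt [i, j] := by
  induction j with
  | zero => omega
  | succ j ih =>
    have hs := h.succ j (by omega)
    rcases Nat.lt_succ_iff_lt_or_eq.1 hij with hlt | rfl
    · exact (h.closed _ (by simp [arithRules]) : Sound I ([(prLt, [1, 2]), (prS, [2, 3])],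
        (prLt, [1, 3]))).apply [0, i, j, j + 1] (by simp [ih hlt (by omega), hs])
    · exact (h.closed _ (by simp [arithRules]) : Sound I ([(prS, [1, 2])], (prLt, [1, 2]))).apply
        [0, i, i + 1] (by simp [hs])

theorem Arith.pair (h : Arith N I) {x y : ℕ} (hxy : Nat.pair x y ≤ N) :
    I prPair [x, y, Nat.pair x y] := by
  suffices H : ∀ u ≤ N, ∀ x y, Nat.pair x y = u → I prPair [x, y, u] from H _ hxy _ _ rfl
  intro u
  induction u with
  | zero =>
    intro _ x y hu
    obtain ⟨rfl, rfl⟩ := Nat.pair_eq_pair.1 (hu.trans (by decide : 0 = Nat.pair 0 0))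
    exact (h.closed _ (by simp [arithRules]) : Sound I ([(prZ, [1])], (prPair, [1, 1, 1]))).apply
      [0, 0] (by simp [h.zero])
  | succ u ih =>
    intro hu x' y' hu'
    set x := (Nat.unpair u).1
    set y := (Nat.unpair u).2
    have hux : Nat.pair x y = u := Nat.pair_unpair u
    have hI := ih (by omega) x y hux
    have hxu : x ≤ u := Nat.unpair_left_le u
    have hyu : y ≤ u := Nat.unpair_right_le u
    have hsu := h.succ u (by omega)
    have hsx := h.succ x (by omega)
    have hsy := h.succ y (by omega)
    rcases lt_trichotomy y x with hlt | heq | hgt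
    · obtain ⟨rfl, rfl⟩ := Nat.pair_eq_pair.1 (hu'.trans (hux ▸ pair_succ_of_gt hlt))
      exact (h.closed _ (by simp [arithRules]) : Sound I ([(prPair, [1, 2, 3]), (prS, [3, 4]),
        (prLt, [2, 1]), (prS, [2, 5])], (prPair, [1, 5, 4]))).apply [0, x, y, u, u + 1, y + 1]
        (by simp [hI, hsu, hsy, h.lt hlt (by omega)])
    · rw [heq] at hux hI
      obtain ⟨rfl, rfl⟩ := Nat.pair_eq_pair.1 (hu'.trans (hux ▸ pair_succ_self x))
      exact (h.closed _ (by simp [arithRules]) : Sound I ([(prPair, [1, 1, 2]), (prS, [2, 3]),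
        (prS, [1, 4]), (prZ, [5])], (prPair, [5, 4, 3]))).apply [0, x, u, u + 1, x + 1, 0]
        (by simp [hI, hsu, hsx, h.zero])
    · rcases (Nat.succ_le_of_lt hgt).lt_or_eq with hlt | heq
      · obtain ⟨rfl, rfl⟩ := Nat.pair_eq_pair.1 (hu'.trans (hux ▸ pair_succ_of_lt hlt))
        exact (h.closed _ (by simp [arithRules]) : Sound I ([(prPair, [1, 2, 3]), (prS, [3, 4]),
          (prS, [1, 5]), (prLt, [5, 2])], (prPair, [5, 2, 4]))).apply [0, x, y, u, u + 1, x + 1]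
          (by simp [hI, hsu, hsx, h.lt hlt (by omega)])
      · rw [← heq] at hux hI
        obtain ⟨rfl, rfl⟩ := Nat.pair_eq_pair.1 (hu'.trans (hux ▸ pair_succ_eq x))
        exact (h.closed _ (by simp [arithRules]) : Sound I ([(prPair, [1, 2, 3]), (prS, [3, 4]),
          (prS, [1, 2]), (prZ, [5])], (prPair, [2, 5, 4]))).apply [0, x, x + 1, u, u + 1, 0]
          (by simp [hI, hsu, hsx, h.zero])

/-- Computations are eventually derived, on long enough number lines. -/
theorem eventually_code (d : Code) : ∀ x v, v ∈ d.eval x → ∀ᶠ N in atTop, ∀ I, Arith N I →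
    (∀ r ∈ codeRules d, Sound I r) → I (prCode d) [x, v] := by
  induction d with
  | zero =>
    intro x v hv
    obtain rfl : v = 0 := by simpa [Code.eval, pure, PFun.pure] using hv
    filter_upwards [eventually_ge_atTop x] with N hN I hI hr
    simp only [codeRules, List.forall_mem_singleton] at hr
    exact hr.apply [0, x, 0] (by simp [hI.real x hN, hI.zero])
  | succ =>
    intro x v hv
    obtain rfl : v = x + 1 := by simpa [Code.eval] using hv
    filter_upwards [eventually_gt_atTop x] with N hN I hI hr
    simp only [codeRules, List.forall_mem_singleton] at hr
    exact hr.apply [0, x, x + 1] (by simp [hI.succ x hN])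
  | left =>
    intro x v hv
    obtain rfl : v = x.unpair.1 := by simpa [Code.eval] using hv
    filter_upwards [eventually_ge_atTop x] with N hN I hI hr
    have := hI.pair (x := x.unpair.1) (y := x.unpair.2) (by simpa using hN)
    rw [Nat.pair_unpair] at this
    simp only [codeRules, List.forall_mem_singleton] at hr
    exact hr.apply [0, x.unpair.1, x.unpair.2, x] (by simp [this])
  | right =>
    intro x v hv
    obtain rfl : v = x.unpair.2 := by simpa [Code.eval] using hv
    filter_upwards [eventually_ge_atTop x] with N hN I hI hr
    have := hI.pair (x := x.unpair.1) (y := x.unpair.2) (by simpa using hN)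
    rw [Nat.pair_unpair] at this
    simp only [codeRules, List.forall_mem_singleton] at hr
    exact hr.apply [0, x.unpair.1, x.unpair.2, x] (by simp [this])
  | pair f g hf hg =>
    intro x v hv
    obtain ⟨v1, h1, v2, h2, rfl⟩ : ∃ v1 ∈ f.eval x, ∃ v2 ∈ g.eval x, Nat.pair v1 v2 = v := by
      simpa [Code.eval, Seq.seq] using hv
    filter_upwards [hf x v1 h1, hg x v2 h2, eventually_ge_atTop (Nat.pair v1 v2)]
      with N hf hg hN I hI hr
    simp only [codeRules, List.forall_mem_cons, List.forall_mem_append] at hr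
    exact hr.1.apply [0, x, v1, v2, Nat.pair v1 v2]
      (by simp [hf I hI hr.2.1, hg I hI hr.2.2, hI.pair hN])
  | comp f g hf hg =>
    intro x v hv
    obtain ⟨u, h1, h2⟩ : ∃ u ∈ g.eval x, v ∈ f.eval u := Part.mem_bind_iff.1 hv
    filter_upwards [hg x u h1, hf u v h2] with N hg hf I hI hr
    simp only [codeRules, List.forall_mem_cons, List.forall_mem_append] at hr
    exact hr.1.apply [0, x, u, v] (by simp [hf I hI hr.2.1, hg I hI hr.2.2])
  | prec f g hf hg =>
    intro x v hv
    obtain ⟨b, k, rfl⟩ : ∃ b k, Nat.pair b k = x := ⟨_, _, Nat.pair_unpair x⟩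
    induction k generalizing v with
    | zero =>
      rw [Code.eval_prec_zero] at hv
      filter_upwards [hf b v hv, eventually_ge_atTop (Nat.pair b 0)] with N hf hN I hI hr
      simp only [codeRules, List.forall_mem_cons, List.forall_mem_append] at hr
      exact hr.1.apply [0, b, v, 0, Nat.pair b 0]
        (by simp [hf I hI hr.2.2.1, hI.zero, hI.pair hN])
    | succ k ih =>
      rw [Code.eval_prec_succ] at hv
      obtain ⟨u, hu, hv⟩ := Part.mem_bind_iff.1 hv
      filter_upwards [ih u hu, hg _ v hv, eventually_ge_atTop (Nat.pair b k),
        eventually_gt_atTop k, eventually_ge_atTop (Nat.pair k u),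
        eventually_ge_atTop (Nat.pair b (Nat.pair k u)), eventually_ge_atTop (Nat.pair b (k + 1))]
        with N ih hg h1 h2 h3 h4 h5 I hI hr
      have hi := ih I hI hr
      simp only [codeRules, List.forall_mem_cons, List.forall_mem_append] at hr
      exact hr.2.1.apply [0, b, k, Nat.pair b k, u, k + 1, Nat.pair k u,
        Nat.pair b (Nat.pair k u), v, Nat.pair b (k + 1)]
        (by simp [hi, hg I hI hr.2.2.2, hI.pair h1, hI.succ k h2, hI.pair h3, hI.pair h4,
          hI.pair h5])
  | rfind' f hf =>
    intro x v hv
    obtain ⟨b, k, rfl⟩ : ∃ b k, Nat.pair b k = x := ⟨_, _, Nat.pair_unpair x⟩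
    obtain ⟨n, rfl, h0, hlt⟩ := mem_eval_rfind'.1 hv
    clear hv
    induction n generalizing k with
    | zero =>
      rw [zero_add] at h0 ⊢
      filter_upwards [hf _ 0 h0, eventually_ge_atTop (Nat.pair b k)] with N hf hN I hI hr
      simp only [codeRules, List.forall_mem_cons] at hr
      exact hr.1.apply [0, Nat.pair b k, 0, b, k] (by simp [hf I hI hr.2.2, hI.zero, hI.pair hN])
    | succ n ih =>
      obtain ⟨y, hy0, hy⟩ := hlt 0 (by omega)
      obtain ⟨y, rfl⟩ := Nat.exists_eq_succ_of_ne_zero hy0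
      rw [zero_add] at hy
      have e : n + 1 + k = n + (k + 1) := by omega
      rw [e] at h0 ⊢
      have := ih (k + 1) h0 fun j hj => by
        simpa [add_assoc, add_comm, add_left_comm] using hlt (j + 1) (by omega)
      filter_upwards [this, hf _ _ hy, eventually_ge_atTop (Nat.pair b k),
        eventually_ge_atTop (Nat.pair b (k + 1)), eventually_gt_atTop y, eventually_gt_atTop k]
        with N ih hf h1 h2 h3 h4 I hI hr
      have hi := ih I hI hr
      simp only [codeRules, List.forall_mem_cons] at hr
      exact hr.2.1.apply [0, Nat.pair b k, y + 1, y, b, k, k + 1, Nat.pair b (k + 1),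
        n + (k + 1)] (by simp [hi, hf I hI hr.2.2, hI.pair h1, hI.pair h2, hI.succ y h3,
          hI.succ k h4])

/-- Accepted numbers are eventually derived. -/
theorem eventually_accept {c : Code} {a p x : ℕ}
    (h : 0 ∈ c.eval (Nat.pair a (Nat.pair p x))) : ∀ᶠ N in atTop, ∀ I, Arith N I →
    (∀ r ∈ localRules c a, Sound I r) → I prPrev [p] → I prGd [x] := by
  filter_upwards [eventually_code c _ _ h, eventually_ge_atTop a,
    eventually_ge_atTop (Nat.pair p x), eventually_ge_atTop (Nat.pair a (Nat.pair p x))]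
    with N hc h1 h2 h3 I hI hr hp
  simp only [localRules, List.forall_mem_cons, List.forall_mem_append] at hr
  have hA : I prA [a] := by
    refine hr.1 (fun v => v - 1) ?_
    simp only [inputRule, List.forall_mem_cons, List.forall_mem_map, List.mem_range]
    exact ⟨hI.zero, fun i hi => hI.succ i (by omega)⟩
  exact hr.2.1.apply [0, p, x, Nat.pair p x, a, Nat.pair a (Nat.pair p x), 0]
    (by simp [hp, hA, hc I hI hr.2.2.2, hI.pair h2, hI.pair h3, hI.zero])

end ChaseTermination

namespace ChaseTermination

open Nat.Partrec (Code)
open Filter Relation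

/-! ### Steps of the chase -/

variable {c : Code} {a : ℕ} {F : Set Fact}

theorem exists_fresh (h : F.Finite) (t : GroundTerm) : ∃ y, Fresh F y ∧ y ≠ t := by
  obtain ⟨n, hn⟩ := (((termsOf_finite h).insert t).preimage
    (f := (Sum.inr : ℕ → GroundTerm)) Sum.inr_injective.injOn).exists_notMem
  simp only [Set.mem_preimage, Set.mem_insert_iff, not_or] at hn
  exact ⟨_, ⟨⟨n, rfl⟩, hn.2⟩, hn.1⟩

theorem chaseStep_guess {w x y : GroundTerm} (hl : ∀ f ∈ guessFacts w x, f ∈ F)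
    (hob : ∀ t, (prSu, [w, x, t]) ∈ F → (prRe, [w, t]) ∉ F) (hy : Fresh F y) :
    ChaseStep (reductionRules c a) F (F ∪ {f | f ∈ (Move.guess w x y).out}) := by
  have hex : ∀ v, existVar guessRule v ↔ v = 2 := by
    intro v
    simp only [guessRule, existVar_mkRule]
    simp [guessBody, guessHead]
    omega
  refine ⟨(guessRule, fun v => [w, x].getD v w), ⟨by simp [reductionRules], ?_, ?_⟩,
    fun v => [w, x, y].getD v w, ⟨?_, ?_, ?_⟩, ?_⟩
  · rw [guessRule, loaded_mkRule]
    simpa [guessBody, guessFacts, VAtom.inst] using hl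
  · rw [guessRule, obsolete_mkRule]
    rintro ⟨σ, h1, h2⟩
    have e0 : σ 0 = w := h1 0 (by simp [guessBody])
    have e1 : σ 1 = x := h1 1 (by simp [guessBody])
    simp [guessHead, VAtom.inst, e0, e1] at h2
    exact hob _ h2.1 h2.2.1
  · intro v hv
    simp only [guessRule, bodyVar_mkRule] at hv
    simp [guessBody] at hv
    obtain rfl | rfl : v = 0 ∨ v = 1 := by omega
    · rfl
    · rfl
  · intro v hv
    obtain rfl := (hex v).1 hv
    obtain ⟨⟨n, rfl⟩, hn⟩ := hy
    exact ⟨n, rfl, hn⟩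
  · intro v v' hv hv' _
    rw [(hex v).1 hv, (hex v').1 hv']
  · rw [guessRule, outputOf_mkRule]
    rfl

theorem chaseStep_level {w x u z : GroundTerm} (hg : (prGd, [w, x]) ∈ F)
    (hl : ∀ f ∈ guessFacts w x, f ∈ F)
    (hob : ∀ u z, (prNx, [w, x, u, z]) ∈ F → (prRe, [u, z]) ∉ F)
    (hu : Fresh F u) (hz : Fresh F z) (huz : u ≠ z) :
    ChaseStep (reductionRules c a) F (F ∪ {f | f ∈ (Move.level w x u z).out}) := by
  have hex : ∀ v, existVar levelRule v ↔ v = 2 ∨ v = 3 := by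
    intro v
    simp only [levelRule, existVar_mkRule]
    simp [guessBody, levelHead]
    omega
  refine ⟨(levelRule, fun v => [w, x].getD v w), ⟨by simp [reductionRules], ?_, ?_⟩,
    fun v => [w, x, u, z].getD v w, ⟨?_, ?_, ?_⟩, ?_⟩
  · rw [levelRule, loaded_mkRule, List.forall_mem_cons]
    exact ⟨hg, by simpa [guessBody, guessFacts, VAtom.inst] using hl⟩
  · rw [levelRule, obsolete_mkRule]
    rintro ⟨σ, h1, h2⟩
    have e0 : σ 0 = w := h1 0 (by simp [guessBody])
    have e1 : σ 1 = x := h1 1 (by simp [guessBody])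
    simp [levelHead, VAtom.inst, e0, e1] at h2
    exact hob _ _ h2.1 h2.2.2.2.1
  · intro v hv
    simp only [levelRule, bodyVar_mkRule] at hv
    simp [guessBody] at hv
    obtain rfl | rfl : v = 0 ∨ v = 1 := by omega
    · rfl
    · rfl
  · intro v hv
    obtain ⟨⟨n, rfl⟩, hn⟩ := hu
    obtain ⟨⟨k, rfl⟩, hk⟩ := hz
    obtain rfl | rfl := (hex v).1 hv
    · exact ⟨n, rfl, hn⟩
    · exact ⟨k, rfl, hk⟩
  · intro v v' hv hv' e
    obtain rfl | rfl := (hex v).1 hv <;> obtain rfl | rfl := (hex v').1 hv'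
    · rfl
    · exact (huz e).elim
    · exact (huz e.symm).elim
    · rfl
  · rw [levelRule, outputOf_mkRule]
    rfl

theorem obsolete_brakeRule {σ : ℕ → GroundTerm} : obsolete (brakeRule, σ) F ↔ Braked F (σ 0) := by
  rw [brakeRule, obsolete_mkRule]
  constructor
  · rintro ⟨σ', h1, h2⟩
    have e0 : σ' 0 = σ 0 := h1 0 (by simp)
    simpa [brakeHead, VAtom.inst, e0, Braked, brakeFacts] using h2
  · intro h
    exact ⟨σ, fun _ _ => rfl, by simpa [brakeHead, VAtom.inst, Braked, brakeFacts] using h⟩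

theorem reflTransGen_brake {w : GroundTerm} (hl : (prLv, [w]) ∈ F) :
    ReflTransGen (ChaseStep (reductionRules c a)) F (F ∪ {f | f ∈ brakeFacts w}) := by
  by_cases hb : Braked F w
  · rw [Set.union_eq_self_of_subset_right (t := {f | f ∈ brakeFacts w}) hb]
  · refine .single ⟨(brakeRule, fun _ => w), ⟨by simp [reductionRules], ?_, ?_⟩,
      fun _ => w, ⟨fun _ _ => rfl, ?_, ?_⟩, ?_⟩
    · rw [brakeRule, loaded_mkRule]
      simpa [VAtom.inst] using hl
    · rwa [obsolete_brakeRule]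
    · intro v hv
      simp only [brakeRule, existVar_mkRule] at hv
      simp [brakeHead] at hv
    · intro v v' hv
      simp only [brakeRule, existVar_mkRule] at hv
      simp [brakeHead] at hv
    · rw [brakeRule, outputOf_mkRule]
      rfl

/-- `F` is closed under the Datalog rules. -/
def Model (c : Code) (a : ℕ) (F : Set Fact) : Prop :=
  ∀ d ∈ datalogRules c a, ∀ σ : ℕ → GroundTerm, (∀ x ∈ d.1, x.inst σ ∈ F) → d.2.inst σ ∈ F

theorem chaseStep_datalog {d : DRule} (hd : d ∈ datalogRules c a) {σ : ℕ → GroundTerm}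
    (hl : ∀ x ∈ d.1, x.inst σ ∈ F) (hn : d.2.inst σ ∉ F) :
    ChaseStep (reductionRules c a) F (insert (d.2.inst σ) F) := by
  have hex : ∀ v, ¬ existVar d.toRule v := by
    intro v hv
    rw [DRule.toRule, existVar_mkRule] at hv
    obtain ⟨⟨x, hx, hxv⟩, h⟩ := hv
    rw [List.mem_singleton.1 hx] at hxv
    exact h ((datalogRules_prop hd).1 v hxv)
  refine ⟨(d.toRule, σ), ⟨?_, loaded_mkRule.2 hl, ?_⟩, σ, ⟨fun _ _ => rfl,
    fun v hv => (hex v hv).elim, fun v v' hv => (hex v hv).elim⟩, ?_⟩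
  · simp only [reductionRules, List.mem_cons]
    exact Or.inr (Or.inr (Or.inr (List.mem_map_of_mem hd)))
  · rw [DRule.toRule, obsolete_mkRule]
    rintro ⟨σ', h1, h2⟩
    refine hn (inst_congr (σ := σ') (fun v hv => h1 v ?_) ▸ h2 _ (by simp))
    exact (datalogRules_prop hd).1 v hv
  · rw [DRule.toRule, outputOf_mkRule, Set.insert_eq, Set.union_comm]
    simp

/-- Finite fact sets can be closed under the Datalog rules. -/
theorem exists_saturation (hF : F.Finite) : ∃ G, ReflTransGen (ChaseStep (reductionRules c a)) F G ∧
    F ⊆ G ∧ G.Finite ∧ Model c a G ∧ ∀ p l, p < 5 → (p, l) ∈ G → (p, l) ∈ F := by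
  have hT := datalogFacts_finite c a (termsOf_finite hF)
  suffices H : ∀ n (G : Set Fact), (datalogFacts c a (termsOf F) \ G).ncard = n →
      ReflTransGen (ChaseStep (reductionRules c a)) F G → F ⊆ G → termsOf G ⊆ termsOf F →
      G.Finite → (∀ p l, p < 5 → (p, l) ∈ G → (p, l) ∈ F) →
      ∃ G, ReflTransGen (ChaseStep (reductionRules c a)) F G ∧
        F ⊆ G ∧ G.Finite ∧ Model c a G ∧ ∀ p l, p < 5 → (p, l) ∈ G → (p, l) ∈ F from
    H _ F rfl .refl subset_rfl subset_rfl hF fun p l _ h => h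
  intro n
  induction n using Nat.strong_induction_on with
  | _ n ih =>
  intro G hn hs hFG hGT hG hcore
  by_cases hM : Model c a G
  · exact ⟨G, hs, hFG, hG, hM, hcore⟩
  · simp only [Model, not_forall] at hM
    obtain ⟨d, hd, σ, hl, hnot⟩ := hM
    have hmem := inst_mem_datalogFacts hGT hd hl
    refine ih _ ?_ (insert (d.2.inst σ) G) rfl (hs.tail (chaseStep_datalog hd hl hnot))
      (hFG.trans (Set.subset_insert _ _)) ?_ (hG.insert _) ?_
    · rw [← hn]
      refine Set.ncard_lt_ncard ⟨Set.sdiff_subset_sdiff_right (Set.subset_insert _ _), fun h => ?_⟩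
        (hT.subset Set.sdiff_subset)
      exact (h ⟨hmem, hnot⟩).2 (Set.mem_insert _ _)
    · rintro t ⟨f, rfl | hf, ht⟩
      · exact hmem.choose_spec.2.2.2 t ht
      · exact hGT ⟨f, hf, ht⟩
    · rintro p l hp (h | h)
      · have := (datalogRules_prop hd).2
        have h1 : p = d.2.1 := congrArg Prod.fst h
        omega
      · exact hcore p l hp h

theorem Model.obsolete {d : DRule} (h : Model c a F) (hd : d ∈ datalogRules c a)
    {σ : ℕ → GroundTerm} (hl : loaded (d.toRule, σ) F) : obsolete (d.toRule, σ) F :=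
  obsolete_mkRule.2 ⟨σ, fun _ _ => rfl, by simpa using h d hd σ (loaded_mkRule.1 hl)⟩

end ChaseTermination

namespace ChaseTermination

open Nat.Partrec (Code)
open Filter Relation

/-! ### Non-termination -/

/-- `y 0, …, y N` is the number line of the unbraked level `w`. -/
structure Line (F : Set Fact) (w : GroundTerm) (y : ℕ → GroundTerm) (N : ℕ) : Prop where
  lv : (prLv, [w]) ∈ F
  zr : (prZr, [w, y 0]) ∈ F
  re : ∀ i ≤ N, (prRe, [w, y i]) ∈ F
  su : ∀ i < N, (prSu, [w, y i, y (i + 1)]) ∈ F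
  suw : ∀ i ≤ N, (prSu, [w, y i, w]) ∈ F
  nxw : ∀ i ≤ N, (prNx, [w, y i, w, w]) ∈ F
  tip : ∀ t, (prSu, [w, y N, t]) ∈ F → t = w
  nx : ∀ i ≤ N, ∀ u z, (prNx, [w, y i, u, z]) ∈ F → u = w ∧ z = w
  nre : (prRe, [w, w]) ∉ F

variable {c : Code} {a : ℕ} {F G : Set Fact} {w : GroundTerm} {y : ℕ → GroundTerm} {N : ℕ}

theorem Line.mono (h : Line F w y N) (hFG : F ⊆ G)
    (hG : ∀ p l, p < 5 → (p, w :: l) ∈ G → (p, w :: l) ∈ F) : Line G w y N :=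
  ⟨hFG h.lv, hFG h.zr, fun i hi => hFG (h.re i hi), fun i hi => hFG (h.su i hi),
    fun i hi => hFG (h.suw i hi), fun i hi => hFG (h.nxw i hi),
    fun t ht => h.tip t (hG _ _ (by decide) ht),
    fun i hi u z hz => h.nx i hi u z (hG _ _ (by decide) hz),
    fun hw => h.nre (hG _ _ (by decide) hw)⟩

theorem Line.guessFacts_subset (h : Line F w y N) {i : ℕ} (hi : i ≤ N) :
    ∀ f ∈ guessFacts w (y i), f ∈ F := by
  simp [guessFacts, h.lv, h.re i hi, h.suw i hi, h.nxw i hi]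

theorem Line.guess (h : Line F w y N) {x : GroundTerm} (hx : x ∉ termsOf F) :
    Line (F ∪ {f | f ∈ (Move.guess w (y N) x).out}) w (Function.update y (N + 1) x) (N + 1) := by
  have hw : w ≠ x := fun e => hx (e ▸ ⟨_, h.lv, by simp⟩)
  have hy : ∀ i ≤ N, y i ≠ x := fun i hi e => hx (e ▸ ⟨_, h.re i hi, by simp⟩)
  have hxF : ∀ p l, x ∈ l → (p, l) ∉ F := fun p l hl hf => hx ⟨_, hf, hl⟩
  have e : ∀ i ≤ N, Function.update y (N + 1) x i = y i := fun i hi =>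
    Function.update_of_ne (by omega) _ _
  have hsub : F ⊆ F ∪ {f | f ∈ (Move.guess w (y N) x).out} := Set.subset_union_left
  refine ⟨hsub h.lv, ?_, fun i hi => ?_, fun i hi => ?_, fun i hi => ?_, fun i hi => ?_,
    fun t ht => ?_, fun i hi u z hz => ?_, ?_⟩
  · rw [e 0 (Nat.zero_le _)]; exact hsub h.zr
  · rcases Nat.le_succ_iff.1 hi with hi | rfl
    · rw [e i hi]; exact hsub (h.re i hi)
    · simp [Move.out]
  · rcases Nat.lt_succ_iff_lt_or_eq.1 hi with hi | rfl
    · rw [e i hi.le, e (i + 1) hi]; exact hsub (h.su i hi)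
    · rw [e i le_rfl]; simp [Move.out]
  · rcases Nat.le_succ_iff.1 hi with hi | rfl
    · rw [e i hi]; exact hsub (h.suw i hi)
    · simp [Move.out]
  · rcases Nat.le_succ_iff.1 hi with hi | rfl
    · rw [e i hi]; exact hsub (h.nxw i hi)
    · simp [Move.out]
  · rw [Function.update_self] at ht
    rcases ht with ht | ht
    · exact (hxF _ _ (by simp) ht).elim
    · simp [Move.out] at ht
      rcases ht with ht | ht
      · exact (hy N le_rfl ht.1.symm).elim
      · exact ht
  · rcases Nat.le_succ_iff.1 hi with hi | rfl
    · rw [e i hi] at hz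
      rcases hz with hz | hz
      · exact h.nx i hi u z hz
      · simp [Move.out] at hz
        exact (hy i hi hz.1).elim
    · rw [Function.update_self] at hz
      rcases hz with hz | hz
      · exact (hxF _ _ (by simp) hz).elim
      · simpa [Move.out] using hz
  · rintro (hf | hf)
    · exact h.nre hf
    · simp [Move.out] at hf
      exact hw hf

theorem Line.level {u z : GroundTerm} (hw : w ∈ termsOf F) (x : GroundTerm) (hu : u ∉ termsOf F)
    (huz : u ≠ z) : Line (F ∪ {f | f ∈ (Move.level w x u z).out}) u (fun _ => z) 0 := by
  have hwu : w ≠ u := fun e => hu (e ▸ hw)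
  have huF : ∀ p l, (p, u :: l) ∉ F := fun p l hf => hu ⟨_, hf, by simp⟩
  refine ⟨?_, ?_, fun i hi => ?_, fun i hi => ?_, fun i hi => ?_, fun i hi => ?_,
    fun t ht => ?_, fun i hi u' z' hz => ?_, ?_⟩
  · simp [Move.out]
  · simp [Move.out]
  · simp [Move.out]
  · omega
  · simp [Move.out]
  · simp [Move.out]
  · rcases ht with ht | ht
    · exact (huF _ _ ht).elim
    · simpa [Move.out] using ht
  · rcases hz with hz | hz
    · exact (huF _ _ hz).elim
    · simp [Move.out, hwu.symm] at hz
      exact hz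
  · rintro (hf | hf)
    · exact huF _ _ hf
    · simp [Move.out] at hf
      exact huz hf

/-- Number lines can be extended. -/
theorem Line.exists_extend (h : Line F w y N) (hF : F.Finite) (n : ℕ) :
    ∃ G y', ReflTransGen (ChaseStep (reductionRules c a)) F G ∧ F ⊆ G ∧ G.Finite ∧
      Line G w y' (N + n) ∧ y' 0 = y 0 ∧ ∀ u, (prLv, [u]) ∈ G → (prLv, [u]) ∈ F := by
  induction n with
  | zero => exact ⟨F, y, .refl, subset_rfl, hF, h, rfl, fun _ h => h⟩
  | succ n ih =>
    obtain ⟨G, y', h1, h2, h3, h4, h5, h6⟩ := ih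
    obtain ⟨x, hx, -⟩ := exists_fresh h3 w
    refine ⟨_, _, h1.tail (chaseStep_guess (h4.guessFacts_subset le_rfl) ?_ hx),
      h2.trans Set.subset_union_left, h3.union (List.finite_toSet _), h4.guess hx.2, ?_, ?_⟩
    · intro t ht hr
      exact h4.nre (h4.tip t ht ▸ hr)
    · rw [Function.update_of_ne (by omega), h5]
    · rintro u (hu | hu)
      · exact h6 u hu
      · simp [Move.out] at hu

theorem zero_notMem_codeRules (d : Code) :
    ∀ r ∈ codeRules d, (∀ x ∈ r.1, 0 ∉ x.2) ∧ 0 ∉ r.2.2 := by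
  induction d with
  | zero => simp [codeRules, -Prod.forall]
  | succ => simp [codeRules]
  | left => simp [codeRules]
  | right => simp [codeRules]
  | pair f g hf hg =>
    simp only [codeRules, List.forall_mem_cons, List.forall_mem_append]
    exact ⟨by simp, hf, hg⟩
  | comp f g hf hg =>
    simp only [codeRules, List.forall_mem_cons, List.forall_mem_append]
    exact ⟨by simp, hf, hg⟩
  | prec f g hf hg =>
    simp only [codeRules, List.forall_mem_cons, List.forall_mem_append]
    exact ⟨by simp, by simp, hf, hg⟩
  | rfind' f hf =>
    simp only [codeRules, List.forall_mem_cons]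
    exact ⟨by simp, by simp, hf⟩

/-- The local rules do not use the level variable. -/
theorem zero_notMem_localRules (c : Code) (a : ℕ) :
    ∀ r ∈ localRules c a, (∀ x ∈ r.1, 0 ∉ x.2) ∧ 0 ∉ r.2.2 := by
  simp only [localRules, List.forall_mem_cons, List.forall_mem_append]
  exact ⟨by simp [inputRule], by simp [acceptRule], by simp [arithRules, -Prod.forall],
    zero_notMem_codeRules c⟩

theorem Model.sound_localRules (h : Model c a F) (w : GroundTerm) (y : ℕ → GroundTerm) :
    ∀ r ∈ localRules c a, Sound (fun p l => (p, w :: l.map y) ∈ F) r := by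
  intro r hr ρ hb
  obtain ⟨h1, h2⟩ := zero_notMem_localRules c a r hr
  have hm : ∀ l : List ℕ, 0 ∉ l →
      l.map (fun v => if v = 0 then w else y (ρ v)) = (l.map ρ).map y := by
    intro l hl
    rw [List.map_map]
    exact List.map_congr_left fun v hv => if_neg fun e : v = 0 => hl (e ▸ hv)
  have := h r.lift (List.mem_append_left _ (List.mem_map_of_mem hr))
    (fun v => if v = 0 then w else y (ρ v)) ?_
  · change (r.2.1, _ :: r.2.2.map _) ∈ F at this
    rwa [hm _ h2] at this
  · intro _ hx
    obtain ⟨x, hxr, rfl⟩ := List.mem_map.1 hx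
    rw [inst_lift, hm _ (h1 x hxr)]
    exact hb x hxr

/-- Apply a linking rule under the valuation listed by `l`. -/
theorem Model.link (h : Model c a F) {b : List VAtom} {p : ℕ} {args : List ℕ}
    (hr : (b, (p, args)) ∈ linkRules) (l : List GroundTerm)
    (hb : ∀ x ∈ b, x.inst (fun v => l.getD v (.inl 0)) ∈ F) :
    (p, args.map fun v => l.getD v (.inl 0)) ∈ F :=
  h _ (List.mem_append_right _ hr) _ hb

theorem Line.arith (h : Line F w y N) (hM : Model c a F) :
    Arith N fun p l => (p, w :: l.map y) ∈ F := by
  refine ⟨fun r hr => hM.sound_localRules w y r ?_, ?_, fun i hi => ?_, fun i hi => ?_⟩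
  · simp [localRules, hr]
  · exact hM.link (b := [(prZr, [0, 1]), (prRe, [0, 1])]) (p := prZ) (args := [0, 1])
      (by simp [linkRules]) [w, y 0] (by simp [VAtom.inst, h.zr, h.re 0 (Nat.zero_le _)])
  · exact hM.link (b := [(prSu, [0, 1, 2]), (prRe, [0, 2])]) (p := prS) (args := [0, 1, 2])
      (by simp [linkRules]) [w, y i, y (i + 1)]
      (by simp [VAtom.inst, h.su i hi, h.re (i + 1) hi])
  · exact h.re i hi

/-- A level learns the number of its parent level. -/
theorem Line.prev {w' : GroundTerm} {y' : ℕ → GroundTerm} {N' s : ℕ} (h : Line G w' y' N')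
    (hM : Model c a G) (hs : s ≤ N') (hzr : (prZr, [w, y 0]) ∈ G)
    (hsu : ∀ i < s, (prSu, [w, y i, y (i + 1)]) ∈ G) (hnx : (prNx, [w, y s, w', y' 0]) ∈ G) :
    (prPrev, [w', y' s]) ∈ G := by
  have hA := h.arith hM
  have hre := h.re 0 (Nat.zero_le _)
  have hcp : ∀ i ≤ s, (prCp, [w', y i, y' i]) ∈ G := by
    intro i
    induction i with
    | zero =>
      intro _
      exact hM.link (b := [(prNx, [0, 1, 2, 3]), (prRe, [2, 3]), (prZr, [0, 4]), (prZ, [2, 5])])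
        (p := prCp) (args := [2, 4, 5]) (by simp [linkRules]) [w, y s, w', y' 0, y 0, y' 0]
        (by simpa [VAtom.inst, hnx, hre, hzr] using hA.zero)
    | succ i ih =>
      intro hi
      exact hM.link (b := [(prNx, [0, 1, 2, 3]), (prRe, [2, 3]), (prCp, [2, 4, 5]),
        (prSu, [0, 4, 6]), (prS, [2, 5, 7])]) (p := prCp) (args := [2, 6, 7])
        (by simp [linkRules]) [w, y s, w', y' 0, y i, y' i, y (i + 1), y' (i + 1)]
        (by simpa [VAtom.inst, hnx, hre, ih (by omega), hsu i hi] using hA.succ i (by omega))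
  exact hM.link (b := [(prNx, [0, 1, 2, 3]), (prRe, [2, 3]), (prCp, [2, 1, 4])])
    (p := prPrev) (args := [2, 4]) (by simp [linkRules]) [w, y s, w', y' 0, y' s]
    (by simp [VAtom.inst, hnx, hre, hcp s le_rfl])

/-- The current level `w` of a chase has accepted the number `s`, all other levels are braked. -/
structure Stage (c : Code) (a : ℕ) (F : Set Fact) (w : GroundTerm) (y : ℕ → GroundTerm)
    (N s : ℕ) : Prop where
  finite : F.Finite
  model : Model c a F
  line : Line F w y N
  le : s ≤ N
  gd : (prGd, [w, y s]) ∈ F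
  braked : ∀ u, (prLv, [u]) ∈ F → u = w ∨ Braked F u

/-- Extend the number line of a new level and derive that it accepts. -/
theorem Stage.next {s s' : ℕ} (h : Stage c a F w y N s)
    (hs : 0 ∈ c.eval (Nat.pair a (Nat.pair s s'))) :
    ∃ F' w' y' N', Stage c a F' w' y' N' s' ∧ TransGen (ChaseStep (reductionRules c a)) F F' ∧
      F ⊆ F' ∧ ∀ u, (prLv, [u]) ∈ F → Braked F' u := by
  obtain ⟨u, hu, -⟩ := exists_fresh h.finite w
  obtain ⟨z, hz, hzu⟩ := exists_fresh h.finite u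
  have hwF : w ∈ termsOf F := ⟨_, h.line.lv, by simp⟩
  have hwu : w ≠ u := fun e => hu.2 (e ▸ hwF)
  have st1 : ChaseStep (reductionRules c a) F (F ∪ {f | f ∈ (Move.level w (y s) u z).out}) := by
    refine chaseStep_level h.gd (h.line.guessFacts_subset h.le) (fun u z hx hr => ?_) hu hz hzu.symm
    obtain ⟨rfl, rfl⟩ := h.line.nx s h.le u z hx
    exact h.line.nre hr
  have l1 := Line.level hwF (y s) hu.2 hzu.symm
  set F1 := F ∪ {f | f ∈ (Move.level w (y s) u z).out} with hF1
  have s1 : F ⊆ F1 := Set.subset_union_left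
  have fin1 : F1.Finite := h.finite.union (List.finite_toSet _)
  have nx1 : (prNx, [w, y s, u, z]) ∈ F1 := by simp [hF1, Move.out]
  have lv1 : ∀ v, (prLv, [v]) ∈ F1 → v = u ∨ (prLv, [v]) ∈ F := by
    rintro v (hv | hv)
    · exact Or.inr hv
    · left; simpa [Move.out] using hv
  have st2 := reflTransGen_brake (c := c) (a := a) (s1 h.line.lv)
  set F2 := F1 ∪ {f | f ∈ brakeFacts w} with hF2
  have s2 : F1 ⊆ F2 := Set.subset_union_left
  have fin2 : F2.Finite := fin1.union (List.finite_toSet _)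
  have l2 : Line F2 u (fun _ => z) 0 := by
    refine l1.mono s2 fun p l _ hf => hf.resolve_right fun hf => ?_
    simp [brakeFacts, hwu.symm] at hf
  have lv2 : ∀ v, (prLv, [v]) ∈ F2 → v = u ∨ (prLv, [v]) ∈ F := by
    rintro v (hv | hv)
    · exact lv1 v hv
    · simp [brakeFacts] at hv
  have br2 : ∀ v, (prLv, [v]) ∈ F → Braked F2 v := by
    intro v hv
    rcases h.braked v hv with rfl | hb
    · exact fun f hf => Or.inr hf
    · exact hb.mono (s1.trans s2)
  obtain ⟨n, hn, hn1, hn2⟩ := ((eventually_accept hs).and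
    ((eventually_ge_atTop s).and (eventually_ge_atTop s'))).exists
  obtain ⟨F3, y', st3, s3, fin3, l3, hy0, lv3⟩ := l2.exists_extend (c := c) (a := a) fin2 n
  rw [zero_add] at l3
  obtain ⟨F4, st4, s4, fin4, hM, core4⟩ := exists_saturation (c := c) (a := a) fin3
  have l4 : Line F4 u y' n := l3.mono s4 fun p l hp hf => core4 p _ hp hf
  have s14 : F1 ⊆ F4 := s2.trans (s3.trans s4)
  have s04 := s1.trans s14
  have br4 : ∀ v, (prLv, [v]) ∈ F → Braked F4 v := fun v hv => (br2 v hv).mono (s3.trans s4)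
  have hp : (prPrev, [u, y' s]) ∈ F4 := by
    refine l4.prev hM hn1 (s04 h.line.zr) (fun i hi => s04 (h.line.su i (hi.trans_le h.le))) ?_
    rw [hy0]
    exact s14 nx1
  refine ⟨F4, u, y', n, ⟨fin4, hM, l4, hn2, ?_, fun v hv => ?_⟩, ?_, s04, br4⟩
  · exact hn _ (l4.arith hM) (hM.sound_localRules u y') hp
  · rcases lv2 v (lv3 v (core4 _ _ (by decide) hv)) with e | e
    · exact Or.inl e
    · exact Or.inr (br4 v e)
  · exact (TransGen.head' st1 (st2.trans (st3.trans st4)))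

end ChaseTermination

namespace ChaseTermination

open Nat.Partrec (Code)
open Relation

/-! ### Infinite fair derivations -/

/-- `Y` is obtained from `X` by `n + 1` chase steps. -/
def Reach (S : RuleSet) : ℕ → Set Fact → Set Fact → Prop
  | 0, X, Y => ChaseStep S X Y
  | n + 1, X, Y => ∃ Z, ChaseStep S X Z ∧ Reach S n Z Y

variable {S : RuleSet}

theorem ChaseStep.subset {X Y : Set Fact} (h : ChaseStep S X Y) : X ⊆ Y := by
  obtain ⟨t, -, σ, -, rfl⟩ := h
  exact Set.subset_union_left

theorem Reach.subset {n : ℕ} {X Y : Set Fact} (h : Reach S n X Y) : X ⊆ Y := by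
  induction n generalizing X with
  | zero => exact ChaseStep.subset h
  | succ n ih =>
    obtain ⟨Z, h1, h2⟩ := h
    exact h1.subset.trans (ih h2)

theorem exists_reach {X Y : Set Fact} (h : TransGen (ChaseStep S) X Y) : ∃ n, Reach S n X Y := by
  induction h using TransGen.head_induction_on with
  | single h => exact ⟨0, h⟩
  | head h _ ih =>
    obtain ⟨n, hn⟩ := ih
    exact ⟨n + 1, _, h, hn⟩

/-- Infinitely many finite derivations, each of which makes the triggers loaded at its start
obsolete, compose to an infinite fair derivation. -/
theorem exists_fair_chase (H : ℕ → Set Fact)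
    (hstep : ∀ k, TransGen (ChaseStep S) (H k) (H (k + 1)))
    (hfair : ∀ k, ∀ t : Trigger, t.1 ∈ S → loaded t (H k) → obsolete t (H (k + 1))) :
    ∃ ch : Chase S (H 0), IsInfinite ch ∧ Fair ch := by
  choose n hn using fun k => exists_reach (hstep k)
  let T := {s : ℕ × ℕ × Set Fact // Reach S s.2.1 s.2.2 (H (s.1 + 1))}
  have hnext : ∀ s : T, ∃ s' : T, ChaseStep S s.1.2.2 s'.1.2.2 ∧
      ((s.1.2.1 = 0 ∧ s'.1.1 = s.1.1 + 1 ∧ s'.1.2.2 = H (s.1.1 + 1)) ∨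
        (s'.1.1 = s.1.1 ∧ s.1.2.1 = s'.1.2.1 + 1)) := by
    rintro ⟨⟨k, _ | m, X⟩, h⟩
    · exact ⟨⟨(k + 1, n (k + 1), H (k + 1)), hn _⟩, h, .inl ⟨rfl, rfl, rfl⟩⟩
    · obtain ⟨Z, h1, h2⟩ := h
      exact ⟨⟨(k, m, Z), h2⟩, h1, .inr ⟨rfl, rfl⟩⟩
  choose next hX hkn using hnext
  let E : ℕ → T := fun i => Nat.rec ⟨(0, n 0, H 0), hn 0⟩ (fun _ s => next s) i
  have hE : ∀ i, E (i + 1) = next (E i) := fun _ => rfl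
  have hreach : ∀ m i, (E i).1.2.1 = m →
      ∃ j, (E j).1.1 = (E i).1.1 + 1 ∧ (E j).1.2.2 = H ((E i).1.1 + 1) := by
    intro m
    induction m with
    | zero =>
      intro i hi
      rcases hkn (E i) with h | h
      · exact ⟨i + 1, h.2⟩
      · omega
    | succ m ih =>
      intro i hi
      rcases hkn (E i) with h | h
      · omega
      · have := ih (i + 1) (by rw [hE]; omega)
        rwa [hE, h.1] at this
  have hhit : ∀ k, ∃ i, (E i).1.1 = k ∧ (E i).1.2.2 = H k := by
    intro k
    induction k with
    | zero => exact ⟨0, rfl, rfl⟩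
    | succ k ih =>
      obtain ⟨i, hi, -⟩ := ih
      subst hi
      exact hreach _ i rfl
  choose trig hact ext hext hsucc using fun i => hX (E i)
  let ch : Chase S (H 0) :=
    { len := ⊤
      fact := fun i => (E i).1.2.2
      trig := trig
      ext := ext
      init := rfl
      activeAt := fun i _ => hact i
      extOk := fun i _ => hext i
      succ := fun i _ => hsucc i
      stall := fun i h => (h (ENat.natCast_lt_top i)).elim }
  refine ⟨ch, rfl, fun t ht i hl => ?_⟩
  have h1 := hfair _ t ht (loaded_mono (E i).2.subset hl)
  obtain ⟨j, -, hj⟩ := hhit ((E i).1.1 + 1 + 1)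
  refine ⟨max i j, le_max_left _ _, obsolete_mono (ch.mono (le_max_right i j)) ?_⟩
  change obsolete t (E j).1.2.2
  rwa [hj]

variable {c : Code} {a : ℕ} {F G : Set Fact}

/-- All triggers of a model are obsolete once all its levels are braked. -/
theorem obsolete_of_braked (hM : Model c a F) (hFG : F ⊆ G)
    (hb : ∀ u, (prLv, [u]) ∈ F → Braked G u) {t : Trigger} (ht : t.1 ∈ reductionRules c a)
    (hl : loaded t F) : obsolete t G := by
  obtain ⟨r, σ⟩ := t
  simp only [reductionRules, List.mem_cons, List.mem_map] at ht
  rcases ht with rfl | rfl | rfl | ⟨d, hd, rfl⟩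
  · have h := loaded_mkRule.1 hl
    exact obsolete_guessRule (fun x hx => hFG (h x hx)) (hb _ (h (prLv, [0]) (by simp [guessBody])))
  · have h := (List.forall_mem_cons.1 (loaded_mkRule.1 hl)).2
    exact obsolete_levelRule (fun x hx => hFG (h x hx)) (hb _ (h (prLv, [0]) (by simp [guessBody])))
  · exact obsolete_brakeRule.2 (hb _ (loaded_mkRule.1 hl (prLv, [0]) (by simp)))
  · exact obsolete_mono hFG (hM.obsolete hd hl)

/-- A database with a single level, whose zero is accepted. -/
def rootDatabase : Database :=
  [(prLv, [.inl 0]), (prZr, [.inl 0, .inl 1]), (prRe, [.inl 0, .inl 1]),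
    (prSu, [.inl 0, .inl 1, .inl 0]), (prNx, [.inl 0, .inl 1, .inl 0, .inl 0]),
    (prGd, [.inl 0, .inl 1])]

theorem isDatabase_rootDatabase : IsDatabase rootDatabase := by
  simp [IsDatabase, rootDatabase, factNullFree]

theorem line_rootDatabase : Line (dbSet rootDatabase) (.inl 0) (fun _ => .inl 1) 0 := by
  constructor <;> simp [dbSet, rootDatabase]

theorem exists_stage_root : ∃ G, ReflTransGen (ChaseStep (reductionRules c a))
    (dbSet rootDatabase) G ∧ Stage c a G (.inl 0) (fun _ => .inl 1) 0 0 := by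
  obtain ⟨G, h1, h2, h3, h4, h5⟩ := exists_saturation (c := c) (a := a)
    (F := dbSet rootDatabase) (List.finite_toSet _)
  refine ⟨G, h1, h3, h4, line_rootDatabase.mono h2 fun p l hp h => h5 p _ hp h, le_rfl,
    h2 (by simp [dbSet, rootDatabase]), fun u hu => Or.inl ?_⟩
  simpa [dbSet, rootDatabase] using h5 _ _ (by decide) hu

/-- Infinite descending sequences yield infinite fair derivations. -/
theorem not_TRRall_reductionRules {s : ℕ → ℕ} (h0 : s 0 = 0)
    (hs : ∀ k, 0 ∈ c.eval (Nat.pair a (Nat.pair (s k) (s (k + 1))))) :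
    ¬ TRRall (reductionRules c a) := by
  intro hT
  obtain ⟨G0, hD, hG0⟩ := exists_stage_root (c := c) (a := a)
  let T := {p : ℕ × Set Fact // ∃ w y N, Stage c a p.2 w y N (s p.1)}
  have hnext : ∀ p : T, ∃ p' : T, p'.1.1 = p.1.1 + 1 ∧
      TransGen (ChaseStep (reductionRules c a)) p.1.2 p'.1.2 ∧ p.1.2 ⊆ p'.1.2 ∧
      ∀ u, (prLv, [u]) ∈ p.1.2 → Braked p'.1.2 u := by
    rintro ⟨⟨k, F⟩, w, y, N, h⟩
    obtain ⟨F', w', y', N', h1, h2⟩ := h.next (hs k)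
    exact ⟨⟨(k + 1, F'), w', y', N', h1⟩, rfl, h2⟩
  choose next _ hstep hsub hbr using hnext
  let E : ℕ → T := fun i =>
    Nat.rec ⟨(0, G0), _, _, _, by rw [h0]; exact hG0⟩ (fun _ p => next p) i
  have hloaded : ∀ k, ∀ t : Trigger, t.1 ∈ reductionRules c a → loaded t (E k).1.2 →
      obsolete t (E (k + 1)).1.2 := fun k t ht hl => by
    obtain ⟨w, y, N, h⟩ := (E k).2
    exact obsolete_of_braked h.model (hsub (E k)) (hbr (E k)) ht hl
  have hDG : dbSet rootDatabase ⊆ G0 := by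
    have : ∀ X, ReflTransGen (ChaseStep (reductionRules c a)) (dbSet rootDatabase) X →
        dbSet rootDatabase ⊆ X := fun X h => by
      induction h with
      | refl => exact subset_rfl
      | tail _ h ih => exact ih.trans h.subset
    exact this _ hD
  obtain ⟨ch, h1, h2⟩ := exists_fair_chase (S := reductionRules c a)
    (fun k => Nat.casesOn k (dbSet rootDatabase) fun k => (E (k + 1)).1.2)
    (fun k => by
      rcases k with _ | k
      · exact TransGen.trans_right hD (hstep (E 0))
      · exact hstep (E (k + 1)))
    (fun k t ht hl => by
      rcases k with _ | k
      · exact hloaded 0 t ht (loaded_mono hDG hl)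
      · exact hloaded (k + 1) t ht hl)
  exact hT.2 rootDatabase isDatabase_rootDatabase ⟨ch, h1, h2⟩

theorem pi11Hard_TRRall : Pi11Hard TRRall := by
  intro q hq
  obtain ⟨c, h1, h2⟩ := exists_code_of_pi11 hq
  refine ⟨reductionRules c, computable_reductionRules c, fun a => ⟨fun h =>
    TRRall_reductionRules (h1 a h), fun h => by_contra fun hn => ?_⟩⟩
  obtain ⟨s, h0, hs⟩ := h2 a hn
  exact not_TRRall_reductionRules h0 hs h

end ChaseTermination

namespace ChaseTermination

/-- The class `TRR∀` of finite rule sets `Σ` such that every restricted chase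
sequence of `⟨Σ, D⟩` is finite for every database `D` is `Π¹₁`-complete. -/
theorem TRRall_Pi11Complete : Pi11Complete TRRall := ⟨pi11_TRRall, pi11Hard_TRRall⟩

end ChaseTermination
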